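/- Let k: ℝ^{2n+1} → ℝ be bounded, continuous and cylindrically symmetric, k(z,t) = k̃(|z|,t) with k̃ locally Hölder continuous on (0,∞)×ℝ, such that the limit k(∞) = lim_{|(z,t)|→∞} k(z,t) exists in ℝ. Assume there exist μ > 0 and s ∈ ℝ such that either ∫_{ℝ^{2n+1}} (k(z,t) − sup_{σ∈ℝ} k(0,σ)) U_{μ,s}(z,t)^{Q*} dz dt > 0, or ∫_{ℝ^{2n+1}} (k(z,t) − inf_{σ∈ℝ} k(0,σ)) U_{μ,s}(z,t)^{Q*} dz dt < 0. Then there exists ε₀ > 0 such that for every ε with |ε| < ε₀ the equation −Δ_{ℍⁿ}u = (1+εk) u^{Q*−1} has a positive cylindrically symmetric finite-energy weak solution. -/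

import Mathlib

open MeasureTheory Filter Topology

noncomputable section

/-- Points of the Heisenberg group `ℍⁿ ≅ ℝⁿ × ℝⁿ × ℝ`, written `(x, y, t)`. -/
abbrev Pt (n : ℕ) : Type := (Fin n → ℝ) × (Fin n → ℝ) × ℝ

namespace Heis

/-- Unit vector in the `x_j` direction. -/
def ex (n : ℕ) (j : Fin n) : Pt n := (Pi.single j 1, 0, 0)

/-- Unit vector in the `y_j` direction. -/
def ey (n : ℕ) (j : Fin n) : Pt n := (0, Pi.single j 1, 0)

/-- Unit vector in the `t` direction. -/
def et (n : ℕ) : Pt n := (0, 0, 1)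

/-- The left-invariant vector field `X_j u = ∂u/∂x_j + 2 y_j ∂u/∂t`. -/
def Xd (n : ℕ) (j : Fin n) (u : Pt n → ℝ) (p : Pt n) : ℝ :=
  fderiv ℝ u p (ex n j) + 2 * p.2.1 j * fderiv ℝ u p (et n)

/-- The left-invariant vector field `Y_j u = ∂u/∂y_j - 2 x_j ∂u/∂t`. -/
def Yd (n : ℕ) (j : Fin n) (u : Pt n → ℝ) (p : Pt n) : ℝ :=
  fderiv ℝ u p (ey n j) - 2 * p.1 j * fderiv ℝ u p (et n)

/-- The Kohn Laplacian `Δ_{ℍⁿ} u = Σ_j (X_j² u + Y_j² u)`. -/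
def kohn (n : ℕ) (u : Pt n → ℝ) (p : Pt n) : ℝ :=
  ∑ j, (Xd n j (Xd n j u) p + Yd n j (Yd n j u) p)

/-- `|z|` for `p = (x, y, t)`, i.e. the Euclidean norm of `(x, y)`. -/
def znorm (n : ℕ) (p : Pt n) : ℝ :=
  Real.sqrt (∑ j, (p.1 j) ^ 2 + ∑ j, (p.2.1 j) ^ 2)

/-- Cylindrical symmetry: `u (z, t)` depends only on `(|z|, t)`. -/
def IsCyl (n : ℕ) (u : Pt n → ℝ) : Prop :=
  ∃ v : ℝ → ℝ → ℝ, ∀ p : Pt n, u p = v (znorm n p) p.2.2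

/-- Homogeneous dimension `Q = 2n + 2`. -/
def Qh (n : ℕ) : ℝ := 2 * n + 2

/-- Critical exponent `Q* = 2Q/(Q-2)`. -/
def Qs (n : ℕ) : ℝ := 2 * Qh n / (Qh n - 2)

/-- Smooth compactly supported test functions. -/
def TestFun (n : ℕ) (φ : Pt n → ℝ) : Prop :=
  ContDiff ℝ (⊤ : ℕ∞) φ ∧ HasCompactSupport φ

/-- Pointwise inner product of horizontal gradients `∇_{ℍⁿ}u · ∇_{ℍⁿ}v`. -/
def hDot (n : ℕ) (u v : Pt n → ℝ) (p : Pt n) : ℝ :=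
  ∑ j, (Xd n j u p * Xd n j v p + Yd n j u p * Yd n j v p)

/-- `|∇_{ℍⁿ}u|²`. -/
def hGradSq (n : ℕ) (u : Pt n → ℝ) (p : Pt n) : ℝ := hDot n u u p

/-- `G = (Gx, Gy)` is the weak horizontal gradient of `u`, and is in `L²`. -/
def HasWeakHGrad (n : ℕ) (u : Pt n → ℝ)
    (G : Pt n → (Fin n → ℝ) × (Fin n → ℝ)) : Prop :=
  (∀ j : Fin n, MemLp (fun p => (G p).1 j) 2 volume ∧
      MemLp (fun p => (G p).2 j) 2 volume) ∧
  ∀ φ : Pt n → ℝ, TestFun n φ → ∀ j : Fin n,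
    (∫ p : Pt n, u p * Xd n j φ p = -∫ p : Pt n, (G p).1 j * φ p) ∧
    (∫ p : Pt n, u p * Yd n j φ p = -∫ p : Pt n, (G p).2 j * φ p)

/-- `G · ∇_{ℍⁿ}φ` pointwise. -/
def gDot (n : ℕ) (G : Pt n → (Fin n → ℝ) × (Fin n → ℝ)) (φ : Pt n → ℝ)
    (p : Pt n) : ℝ :=
  ∑ j, ((G p).1 j * Xd n j φ p + (G p).2 j * Yd n j φ p)

/-- `u` is a positive cylindrically symmetric finite-energy weak solution of
`-Δ_{ℍⁿ} u = K u^{Q*-1}`. -/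
def IsWeakSol (n : ℕ) (K u : Pt n → ℝ) : Prop :=
  IsCyl n u ∧ MemLp u (ENNReal.ofReal (Qs n)) volume ∧
  (∀ᵐ p : Pt n, 0 < u p) ∧
  ∃ G : Pt n → (Fin n → ℝ) × (Fin n → ℝ), HasWeakHGrad n u G ∧
    ∀ φ : Pt n → ℝ, TestFun n φ →
      ∫ p : Pt n, gDot n G φ p = ∫ p : Pt n, K p * u p ^ (Qs n - 1) * φ p

/-- The standard bubble `U_{μ,s}`. -/
def bubble (n : ℕ) (μ s : ℝ) (p : Pt n) : ℝ :=
  μ ^ (-(Qh n - 2) / 2) *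
    (((p.2.2 - s) / μ ^ 2) ^ 2 + (1 + (znorm n p) ^ 2 / μ ^ 2) ^ 2)
      ^ (-(Qh n - 2) / 4)

/-- Local Hölder continuity of an uncurried function of two real variables on a set. -/
def LocHolderOn (f : ℝ → ℝ → ℝ) (s : Set (ℝ × ℝ)) : Prop :=
  ∀ x ∈ s, ∃ t ∈ nhdsWithin x s, ∃ C α : NNReal, 0 < α ∧
    HolderOnWith C α (fun q : ℝ × ℝ => f q.1 q.2) t

/-- `K` is cylindrically symmetric, `K(z,t) = K̃(|z|,t)`, with `K̃` locally Hölder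
continuous on `(0,∞) × ℝ`. -/
def CylHolder (n : ℕ) (K : Pt n → ℝ) : Prop :=
  ∃ Kt : ℝ → ℝ → ℝ, (∀ p : Pt n, K p = Kt (znorm n p) p.2.2) ∧
    LocHolderOn Kt (Set.Ioi 0 ×ˢ Set.univ)

/-- The standard solution `ω(z,t) = (Q-2)^{(Q-2)/2} (t² + (1+|z|²)²)^{-(Q-2)/4}`. -/
def omegaFun (n : ℕ) (p : Pt n) : ℝ :=
  (Qh n - 2) ^ ((Qh n - 2) / 2) *
    (p.2.2 ^ 2 + (1 + (znorm n p) ^ 2) ^ 2) ^ (-(Qh n - 2) / 4)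

end Heis
namespace Heis

/-- The Cayley transform `F : S^{2n+1} ∖ {(0,…,0,-1)} → ℍⁿ`. -/
def cayley (n : ℕ) (ζ : Fin (n + 1) → ℂ) : Pt n :=
  (fun j => (ζ j.castSucc / (1 + ζ (Fin.last n))).re,
   fun j => (ζ j.castSucc / (1 + ζ (Fin.last n))).im,
   (Complex.I * (1 - ζ (Fin.last n)) / (1 + ζ (Fin.last n))).re)

/-- The partial Laplacian `Δ_{x,y} k = Σ_i (∂²k/∂x_i² + ∂²k/∂y_i²)`. -/
def lapXY (n : ℕ) (k : Pt n → ℝ) (p : Pt n) : ℝ :=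
  ∑ j, (fderiv ℝ (fun q => fderiv ℝ k q (ex n j)) p (ex n j)
      + fderiv ℝ (fun q => fderiv ℝ k q (ey n j)) p (ey n j))

/-- The rescaling operator `(𝒰_{μ,s} u)(z,t) = μ^{-(Q-2)/2} u(z/μ, (t-s)/μ²)`. -/
def rescale (n : ℕ) (μ s : ℝ) (u : Pt n → ℝ) (p : Pt n) : ℝ :=
  μ ^ (-(Qh n - 2) / 2) *
    u (fun j => p.1 j / μ, fun j => p.2.1 j / μ, (p.2.2 - s) / μ ^ 2)

/-- The point `(μ z, μ² t + s)`. -/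
def scalePt (n : ℕ) (μ s : ℝ) (p : Pt n) : Pt n :=
  (fun j => μ * p.1 j, fun j => μ * p.2.1 j, μ ^ 2 * p.2.2 + s)

/-- The reduced functional `Γ(μ,s) = (1/Q*) ∫ k(μz, μ²t+s) ω^{Q*}`. -/
def Gam (n : ℕ) (k : Pt n → ℝ) (μ s : ℝ) : ℝ :=
  (1 / Qs n) * ∫ p : Pt n, k (scalePt n μ s p) * omegaFun n p ^ Qs n

/-- The Heisenberg group law
`(x,y,t) ∘ (x',y',t') = (x+x', y+y', t+t'+2x'·y-2x·y')`. -/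
def heisMul (n : ℕ) (a b : Pt n) : Pt n :=
  (fun j => a.1 j + b.1 j, fun j => a.2.1 j + b.2.1 j,
   a.2.2 + b.2.2 + 2 * (∑ j, b.1 j * a.2.1 j) - 2 * (∑ j, a.1 j * b.2.1 j))

end Heis

open Heis
set_option linter.all false
namespace HW
open Polynomial in
lemma markov_end {d : ℕ} {P : ℝ[X]} (hd : P.degree ≤ d)
    (h : ∀ x ∈ Set.Icc (-1:ℝ) 1, |P.eval x| ≤ 1) : P.derivative.eval 1 ≤ (d:ℝ)^2 := by
  have := Polynomial.Chebyshev.eval_iterate_derivative_le_of_forall_abs_le_one (k := 1)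
    (le_refl (1:ℝ)) hd h
  simp only [Function.iterate_one, Chebyshev.T_derivative_eq_U, eval_mul,
    Chebyshev.U_eval_one] at this
  simpa [sq] using this

open Polynomial in
lemma markov_seg {d : ℕ} {P : ℝ[X]} (hd : P.degree ≤ d) {a b B : ℝ} (hB : 0 < B) 
    (h : ∀ x ∈ segment ℝ a b, |P.eval x| ≤ B) : |P.derivative.eval b| * |b - a| ≤ 2 * (d:ℝ)^2 * B := by
  have key : ∀ s : ℝ, |s| = 1 → s * (P.derivative.eval b * ((b-a)/2)) ≤ d^2 * B := by
    intro s hs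
    set P' : ℝ[X] := C (s/B) * P.comp (C ((b-a)/2) * X + C ((a+b)/2)) with hP'
    have hlin : (C ((b-a)/2) * X + C ((a+b)/2) : ℝ[X]).natDegree ≤ 1 := natDegree_linear_le
    have h1 : P'.degree ≤ d := by
      have : P'.natDegree ≤ d := by
        rw [hP']
        refine (natDegree_C_mul_le _ _).trans (natDegree_comp_le.trans ?_)
        calc _ ≤ P.natDegree * 1 := Nat.mul_le_mul_left _ hlin
          _ ≤ d := by rw [mul_one]; exact natDegree_le_of_degree_le hd
      exact degree_le_of_natDegree_le this
    have h2 : ∀ x ∈ Set.Icc (-1:ℝ) 1, |P'.eval x| ≤ 1 := by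
      intro x hx
      have := h ((b-a)/2*x + (a+b)/2) ⟨(1-x)/2, (1+x)/2, by linarith [hx.2], by linarith [hx.1], by ring, by
        simp only [smul_eq_mul]; ring⟩
      simp only [hP', eval_mul, eval_C, eval_comp, eval_add, eval_X, abs_mul, abs_div, hs, abs_of_pos hB]
      rw [one_div, inv_mul_le_iff₀ hB]; simpa using this
    have h3 := markov_end h1 h2
    simp only [hP', derivative_comp, eval_mul, eval_C, eval_comp, eval_add, eval_X,
      derivative_add, derivative_mul, derivative_C, derivative_X] at h3
    have e : (b-a)/2*1 + (a+b)/2 = b := by ring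
    rw [e] at h3
    simp only [eval_zero, zero_mul, zero_add, eval_one, mul_one, add_zero] at h3
    have : s/B * ((b-a)/2 * P.derivative.eval b) * B ≤ d^2 * B := by gcongr
    calc _ = s/B * ((b-a)/2 * P.derivative.eval b) * B := by field_simp
      _ ≤ _ := this
  rw [← abs_mul]
  rcases abs_cases (P.derivative.eval b * (b-a)) with ⟨e, _⟩ | ⟨e, _⟩
  · have := key 1 (by simp); rw [e]; linarith
  · have := key (-1) (by simp); rw [e]; linarith

open Polynomial in
lemma nikolskii (n d : ℕ) (hn : 1 ≤ n) {P : ℝ[X]} (hd : P.degree ≤ d)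
    (h0 : ∀ x ∈ Set.Icc (0:ℝ) 1, 0 ≤ P.eval x) (x : ℝ) (hx : x ∈ Set.Icc (0:ℝ) 1) :
    P.eval x ≤ 2 * (16 * (d:ℝ)^2 + 4)^n * ∫ r in (0:ℝ)..1, P.eval r * (1-r)^(n-1) := by
  obtain ⟨x0, hx0, hmax⟩ := isCompact_Icc.exists_isMaxOn (Set.nonempty_Icc.2 (zero_le_one' ℝ))
    (P.continuous.continuousOn)
  set M := P.eval x0 with hM
  have hle : ∀ y ∈ Set.Icc (0:ℝ) 1, P.eval y ≤ M := fun y hy => hmax hy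
  have hint : 0 ≤ ∫ r in (0:ℝ)..1, P.eval r * (1-r)^(n-1) := by
    apply intervalIntegral.integral_nonneg zero_le_one
    intro u hu
    exact mul_nonneg (h0 u hu) (pow_nonneg (by linarith [hu.2]) _)
  rcases le_or_gt M 0 with hM0 | hM0
  · exact (hle x hx).trans (hM0.trans (by positivity))
  refine (hle x hx).trans ?_
  set l : ℝ := 1/(8*(d:ℝ)^2+2) with hl
  have hlpos : 0 < l := by positivity
  have hlhalf : l ≤ 1/2 := by
    rw [hl]; apply one_div_le_one_div_of_le (by norm_num); nlinarith [sq_nonneg (d:ℝ)]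
  have hder : ∀ y ∈ Set.Icc (0:ℝ) 1, |P.derivative.eval y| ≤ 4 * d^2 * M := by
    intro y hy
    have hsub : ∀ a ∈ Set.Icc (0:ℝ) 1, ∀ z ∈ segment ℝ a y, |P.eval z| ≤ M := by
      intro a ha z hz
      have hz' : z ∈ Set.Icc (0:ℝ) 1 := (convex_Icc (0:ℝ) 1).segment_subset ha hy hz
      rw [abs_of_nonneg (h0 z hz')]; exact hle z hz'
    rcases le_total y (1/2) with h | h
    · have := markov_seg hd hM0 (hsub 1 (by simp))
      rw [abs_of_nonpos (by linarith : y - 1 ≤ 0)] at this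
      nlinarith [abs_nonneg (P.derivative.eval y)]
    · have := markov_seg hd hM0 (hsub 0 (by simp))
      rw [abs_of_nonneg (by linarith : 0 ≤ y - 0)] at this
      nlinarith [abs_nonneg (P.derivative.eval y)]
  obtain ⟨a, ha0, ha1, hax⟩ : ∃ a : ℝ, 0 ≤ a ∧ a + l ≤ 1 ∧ x0 ∈ Set.Icc a (a+l) := by
    rcases le_total x0 (1/2) with h | h
    · exact ⟨x0, hx0.1, by linarith, by simp [hlpos.le]⟩
    · exact ⟨x0 - l, by linarith, by linarith [hx0.2], by simp [hlpos.le]⟩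
  have hlow : ∀ y ∈ Set.Icc a (a+l), M/2 ≤ P.eval y := by
    intro y hy
    have := (convex_Icc (0:ℝ) 1).norm_image_sub_le_of_norm_hasDerivWithin_le (f := fun y => P.eval y)
      (f' := fun y => P.derivative.eval y) (C := 4*d^2*M)
      (fun z hz => (P.hasDerivAt z).hasDerivWithinAt) (fun z hz => hder z hz) hx0
      (y := y) ⟨by linarith [hy.1], by linarith [hy.2]⟩
    have h1 : ‖y - x0‖ ≤ l := by
      rw [Real.norm_eq_abs, abs_le]; constructor <;> linarith [hax.1, hax.2, hy.1, hy.2]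
    have h2 : 4*(d:ℝ)^2*M*‖y-x0‖ ≤ M/2 := by
      calc 4*(d:ℝ)^2*M*‖y-x0‖ ≤ 4*(d:ℝ)^2*M*l := by gcongr
        _ ≤ M/2 := by
          rw [hl]; rw [mul_one_div, div_le_div_iff₀ (by positivity) (by norm_num)]; nlinarith
    rw [Real.norm_eq_abs, abs_le] at this
    linarith [this.1]
  have hi : ∀ u v : ℝ, IntervalIntegrable (fun r => P.eval r * (1-r)^(n-1)) volume u v := fun u v =>
    (Continuous.intervalIntegrable (by fun_prop) _ _)
  have step : (M/2) * (l/2)^(n-1) * (l/2) ≤ ∫ r in (0:ℝ)..1, P.eval r * (1-r)^(n-1) := by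
    have e1 : ∫ r in a..(a+l/2), (M/2) * (l/2)^(n-1) ≤ ∫ r in a..(a+l/2), P.eval r * (1-r)^(n-1) := by
      apply intervalIntegral.integral_mono_on (by linarith) (by simp) (hi _ _)
      intro r hr
      have := hlow r ⟨hr.1, by linarith [hr.2]⟩
      gcongr
      all_goals linarith [hr.2]
    rw [intervalIntegral.integral_const] at e1
    have e2 : ∫ r in a..(a+l/2), P.eval r * (1-r)^(n-1) ≤ ∫ r in (0:ℝ)..1, P.eval r * (1-r)^(n-1) := by
      apply intervalIntegral.integral_mono_interval ha0 (by linarith) (by linarith) _ (hi _ _)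
      filter_upwards [ae_restrict_mem measurableSet_Ioc] with r hr
      exact mul_nonneg (h0 r ⟨hr.1.le, hr.2⟩) (pow_nonneg (by linarith [hr.2]) _)
    simp only [add_sub_cancel_left, smul_eq_mul] at e1
    linarith
  have e3 : (16 * (d:ℝ)^2 + 4) * (l/2) = 1 := by rw [hl]; field_simp; ring
  have e4 : (l/2)^(n-1) * (l/2) = (l/2)^n := by rw [← pow_succ, Nat.sub_add_cancel hn]
  calc M = 2 * ((16 * (d:ℝ)^2 + 4) * (l/2))^n * (M/2) := by rw [e3]; simp; ring
    _ = 2 * (16 * (d:ℝ)^2 + 4)^n * ((M/2) * (l/2)^(n-1) * (l/2)) := by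
      rw [mul_assoc (M/2), e4, mul_pow]; ring
    _ ≤ _ := by gcongr

lemma beta_rec (n : ℕ) (hn : 1 ≤ n) (j : ℕ) :
    ((j:ℝ)+1+n) * ∫ r in (0:ℝ)..1, r^(j+1) * (1-r)^(n-1) = (j+1) * ∫ r in (0:ℝ)..1, r^j * (1-r)^(n-1) := by
  obtain ⟨m, rfl⟩ : ∃ m, n = m+1 := ⟨n-1, by omega⟩
  simp only [Nat.add_sub_cancel]
  have hF : ∀ r : ℝ, HasDerivAt (fun r : ℝ => r^(j+1) * (1-r)^(m+1))
      ((j+1) * (r^j * (1-r)^m) - ((j:ℝ)+1+(m+1:ℕ)) * (r^(j+1) * (1-r)^m)) r := by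
    intro r
    have h1 := (hasDerivAt_pow (j+1) r)
    have h2 := (((hasDerivAt_id r).const_sub 1).pow (m+1))
    exact (h1.mul h2).congr_deriv (by simp; ring)
  have := intervalIntegral.integral_eq_sub_of_hasDerivAt (a := 0) (b := 1) (fun r _ => hF r)
    (Continuous.intervalIntegrable (by fun_prop) _ _)
  rw [intervalIntegral.integral_sub (Continuous.intervalIntegrable (by fun_prop) _ _)
    (Continuous.intervalIntegrable (by fun_prop) _ _), intervalIntegral.integral_const_mul,
    intervalIntegral.integral_const_mul] at this
  simp at this
  push_cast
  linarith
variable {n : ℕ}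
open ComplexConjugate
instance instHaar (n : ℕ) : (volume : Measure (Pt n)).IsAddHaarMeasure := by
  have h : (volume : Measure ((Fin n → ℝ) × ℝ)).IsAddHaarMeasure :=
    inferInstanceAs ((volume : Measure (Fin n → ℝ)).prod (volume : Measure ℝ)).IsAddHaarMeasure
  exact MeasureTheory.Measure.prod.instIsAddHaarMeasure (volume : Measure (Fin n → ℝ))
    (volume : Measure ((Fin n → ℝ) × ℝ))

def shear (n : ℕ) (j : Fin n) (s : ℝ) (p : Pt n) : Pt n :=
  (p.1, p.2.1, p.2.2 + s * (p.1 j * p.2.1 j))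

lemma shear_mp (j : Fin n) (s : ℝ) : MeasurePreserving (shear n j s) volume volume := by
  have h := MeasurePreserving.skew_product (μa := (volume : Measure (Fin n → ℝ))) (μb := volume)
    (μc := (volume : Measure ((Fin n → ℝ) × ℝ))) (μd := volume) (MeasurePreserving.id volume)
    (g := fun x w => (w.1, w.2 + s * (x j * w.1 j))) (by unfold Function.uncurry; fun_prop) (by
      refine Eventually.of_forall fun x => ?_
      have := MeasurePreserving.skew_product (μa := (volume : Measure (Fin n → ℝ))) (μb := volume)
        (μc := (volume : Measure ℝ)) (μd := volume) (MeasurePreserving.id volume)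
        (g := fun y t => t + s * (x j * y j)) (by unfold Function.uncurry; fun_prop)
        (Eventually.of_forall fun y => (measurePreserving_add_right volume _).map_eq)
      exact this.map_eq)
  exact h

lemma shear_hasFDerivAt (j : Fin n) (s : ℝ) (p : Pt n) : ∃ S' : Pt n →L[ℝ] Pt n,
    HasFDerivAt (shear n j s) S' p ∧ S' (ex n j) = ex n j + (s * p.2.1 j) • et n ∧
    S' (ey n j) = ey n j + (s * p.1 j) • et n := by
  have h1 : HasFDerivAt (fun p : Pt n => p.1) (ContinuousLinearMap.fst ℝ _ _) p := hasFDerivAt_fst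
  have h2 : HasFDerivAt (fun p : Pt n => p.2) (ContinuousLinearMap.snd ℝ _ _) p := hasFDerivAt_snd
  have h21 := h2.fst
  have h22 := h2.snd
  have h1j := (hasFDerivAt_apply (𝕜 := ℝ) j p.1).comp p h1
  have h2j := (hasFDerivAt_apply (𝕜 := ℝ) j p.2.1).comp p h21
  have := h1.prodMk (h21.prodMk (h22.add ((h1j.mul h2j).const_mul s)))
  refine ⟨_, this, ?_, ?_⟩
  · simp [ex, et]
  · simp [ey, et]

lemma integral_lie_zero {F : Pt n → ℝ} (hF : Differentiable ℝ F) (j : Fin n) (s : ℝ) (e : Pt n)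
    (E : Pt n → ℝ) (hE : ∀ p (S' : Pt n →L[ℝ] Pt n), HasFDerivAt (shear n j s) S' p →
      fderiv ℝ F (shear n j s p) (S' e) = E (shear n j s p))
    (hi : Integrable F) (hi' : Integrable E) : ∫ p, E p = 0 := by
  have hS := shear_mp j s
  have hd : ∀ p, HasFDerivAt (fun p => F (shear n j s p))
      ((fderiv ℝ F (shear n j s p)).comp (fderiv ℝ (shear n j s) p)) p := by
    intro p
    obtain ⟨S', h, -, -⟩ := shear_hasFDerivAt j s p
    exact ((hF _).hasFDerivAt).comp p h.differentiableAt.hasFDerivAt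
  have hfd : ∀ p, fderiv ℝ (fun p => F (shear n j s p)) p e = E (shear n j s p) := by
    intro p
    obtain ⟨S', h, -, -⟩ := shear_hasFDerivAt j s p
    rw [(hd p).fderiv, ← hE p _ h.differentiableAt.hasFDerivAt]; rfl
  have i1 : Integrable (fun p => F (shear n j s p)) := hS.integrable_comp_of_integrable hi
  have i2 : Integrable (fun p => E (shear n j s p)) := hS.integrable_comp_of_integrable hi'
  have := integral_mul_fderiv_eq_neg_fderiv_mul_of_integrable (μ := (volume : Measure (Pt n)))
    (f := fun _ => (1:ℝ)) (g := fun p => F (shear n j s p)) (v := e) (by simp)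
    (by simpa [hfd] using i2) (by simpa using i1) (by simp) (fun x _ => (hd x).differentiableAt)
  simp only [one_mul, hfd] at this
  simp at this
  rw [← this]
  have hinv : MeasurePreserving (shear n j (-s)) volume volume := shear_mp j (-s)
  let eq : Pt n ≃ᵐ Pt n := ⟨⟨shear n j s, shear n j (-s), fun p => by simp [shear], fun p => by simp [shear]⟩,
    hS.measurable, hinv.measurable⟩
  exact (hS.integral_comp eq.measurableEmbedding E).symm

lemma Xd_integral_zero {F : Pt n → ℝ} (hF : Differentiable ℝ F) (j : Fin n)
    (hi : Integrable F) (hi' : Integrable (Xd n j F)) : ∫ p, Xd n j F p = 0 := by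
  refine integral_lie_zero hF j 2 (ex n j) _ (fun p S' h => ?_) hi hi'
  obtain ⟨S'', h', e1, -⟩ := shear_hasFDerivAt j 2 p
  rw [h.unique h', e1]; simp [Xd, shear]

lemma Yd_integral_zero {F : Pt n → ℝ} (hF : Differentiable ℝ F) (j : Fin n)
    (hi : Integrable F) (hi' : Integrable (Yd n j F)) : ∫ p, Yd n j F p = 0 := by
  refine integral_lie_zero hF j (-2) (ey n j) _ (fun p S' h => ?_) hi hi'
  obtain ⟨S'', h', -, e1⟩ := shear_hasFDerivAt j (-2) p
  rw [h.unique h', e1]; simp [Yd, shear]; ring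

lemma Xd_mul {f g : Pt n → ℝ} {p : Pt n} (hf : DifferentiableAt ℝ f p) (hg : DifferentiableAt ℝ g p) (j : Fin n) :
    Xd n j (fun p => f p * g p) p = f p * Xd n j g p + Xd n j f p * g p := by
  simp only [Xd]; rw [fderiv_fun_mul hf hg]; simp; ring

lemma Yd_mul {f g : Pt n → ℝ} {p : Pt n} (hf : DifferentiableAt ℝ f p) (hg : DifferentiableAt ℝ g p) (j : Fin n) :
    Yd n j (fun p => f p * g p) p = f p * Yd n j g p + Yd n j f p * g p := by
  simp only [Yd]; rw [fderiv_fun_mul hf hg]; simp; ring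

/-- integration by parts with a smooth function `f` and any product integrable -/
lemma Xd_parts {f g : Pt n → ℝ} (hf : Differentiable ℝ f) (hg : Differentiable ℝ g) (j : Fin n)
    (h0 : Integrable (fun p => f p * g p)) (h1 : Integrable (fun p => f p * Xd n j g p))
    (h2 : Integrable (fun p => Xd n j f p * g p)) :
    ∫ p, f p * Xd n j g p = - ∫ p, Xd n j f p * g p := by
  have e : Xd n j (fun p => f p * g p) = fun p => f p * Xd n j g p + Xd n j f p * g p :=
    funext fun p => Xd_mul (hf p) (hg p) j
  have := Xd_integral_zero (hf.mul hg) j h0 (by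
    have := h1.add h2
    refine this.congr (Eventually.of_forall fun p => ?_)
    exact (congrFun e p).symm)
  have e2 : ∫ p, Xd n j (fun p => f p * g p) p = 0 := this
  rw [e, integral_add h1 h2] at e2
  linarith

lemma Yd_parts {f g : Pt n → ℝ} (hf : Differentiable ℝ f) (hg : Differentiable ℝ g) (j : Fin n)
    (h0 : Integrable (fun p => f p * g p)) (h1 : Integrable (fun p => f p * Yd n j g p))
    (h2 : Integrable (fun p => Yd n j f p * g p)) :
    ∫ p, f p * Yd n j g p = - ∫ p, Yd n j f p * g p := by
  have e : Yd n j (fun p => f p * g p) = fun p => f p * Yd n j g p + Yd n j f p * g p :=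
    funext fun p => Yd_mul (hf p) (hg p) j
  have := Yd_integral_zero (hf.mul hg) j h0 (by
    have := h1.add h2
    refine this.congr (Eventually.of_forall fun p => ?_)
    exact (congrFun e p).symm)
  have e2 : ∫ p, Yd n j (fun p => f p * g p) p = 0 := this
  rw [e, integral_add h1 h2] at e2
  linarith
def rho (n : ℕ) (p : Pt n) : ℝ := ∑ j, (p.1 j) ^ 2 + ∑ j, (p.2.1 j) ^ 2
def sg (n : ℕ) (p : Pt n) : ℂ := (rho n p : ℂ) - (p.2.2 : ℂ) * Complex.I
def nq (n : ℕ) (p : Pt n) : ℝ := ‖sg n p + 1‖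

lemma rho_nonneg (p : Pt n) : 0 ≤ rho n p := by unfold rho; positivity
@[simp] lemma sg_re (p : Pt n) : (sg n p).re = rho n p := by simp [sg]
@[simp] lemma sg_im (p : Pt n) : (sg n p).im = -p.2.2 := by simp [sg]
lemma continuous_rho : Continuous (rho n) := by unfold rho; fun_prop
lemma continuous_sg : Continuous (sg n) := by
  have := continuous_rho (n := n); unfold sg; fun_prop
lemma continuous_nq : Continuous (nq n) := by
  have := continuous_sg (n := n); unfold nq; fun_prop

lemma nq_ge (p : Pt n) : 1 + rho n p ≤ nq n p := by
  have := Complex.re_le_norm (sg n p + 1)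
  simp at this; unfold nq; linarith
lemma one_le_nq (p : Pt n) : 1 ≤ nq n p := by linarith [nq_ge p, rho_nonneg p]
lemma nq_pos (p : Pt n) : 0 < nq n p := by linarith [one_le_nq p]

lemma x_sq_le (p : Pt n) (j : Fin n) : (p.1 j)^2 ≤ rho n p := by
  unfold rho
  have := Finset.single_le_sum (f := fun j => (p.1 j)^2) (fun i _ => sq_nonneg _) (Finset.mem_univ j)
  have h2 : 0 ≤ ∑ j, (p.2.1 j) ^ 2 := by positivity
  linarith
lemma y_sq_le (p : Pt n) (j : Fin n) : (p.2.1 j)^2 ≤ rho n p := by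
  unfold rho
  have := Finset.single_le_sum (f := fun j => (p.2.1 j)^2) (fun i _ => sq_nonneg _) (Finset.mem_univ j)
  have h2 : 0 ≤ ∑ j, (p.1 j) ^ 2 := by positivity
  linarith
lemma x_le (p : Pt n) (j : Fin n) : |p.1 j| ≤ √(nq n p) := by
  apply Real.abs_le_sqrt; linarith [x_sq_le p j, nq_ge p]
lemma y_le (p : Pt n) (j : Fin n) : |p.2.1 j| ≤ √(nq n p) := by
  apply Real.abs_le_sqrt; linarith [y_sq_le p j, nq_ge p]

lemma supnorm_sq_le (x : Fin n → ℝ) : ‖x‖^2 ≤ ∑ j, (x j)^2 := by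
  have h0 : 0 ≤ ∑ j, (x j)^2 := by positivity
  have : ‖x‖ ≤ √(∑ j, (x j)^2) := by
    rw [pi_norm_le_iff_of_nonneg (Real.sqrt_nonneg _)]
    intro i
    rw [Real.norm_eq_abs]
    apply Real.abs_le_sqrt
    exact Finset.single_le_sum (f := fun j => (x j)^2) (fun i _ => sq_nonneg _) (Finset.mem_univ i)
  calc ‖x‖^2 ≤ (√(∑ j, (x j)^2))^2 := by gcongr
    _ = _ := Real.sq_sqrt h0

lemma integrable_nq {β : ℝ} (hβ : (n:ℝ) + 1 < β) : Integrable (fun p : Pt n => nq n p ^ (-β)) := by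
  set δ := (β - n - 1)/2 with hδ
  have hδ0 : 0 < δ := by rw [hδ]; linarith
  have hX : Integrable (fun x : Fin n → ℝ => ((1:ℝ) + ‖x‖^2) ^ (-(n+δ)/2)) :=
    integrable_rpow_neg_one_add_norm_sq (by simp [hδ0])
  have hT : Integrable (fun x : ℝ => ((1:ℝ) + ‖x‖^2) ^ (-(1+δ)/2)) :=
    integrable_rpow_neg_one_add_norm_sq (by simp [hδ0])
  have hP := hX.mul_prod (hX.mul_prod hT)
  refine Integrable.mono' hP ?_ (Eventually.of_forall fun p => ?_)
  · refine (Continuous.rpow_const continuous_nq fun p => Or.inl (nq_pos p).ne').aestronglyMeasurable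
  · have hq := nq_pos p
    have hr := nq_ge p
    have hx := supnorm_sq_le p.1
    have hy := supnorm_sq_le p.2.1
    have sx : 0 ≤ ∑ j, (p.1 j)^2 := by positivity
    have sy : 0 ≤ ∑ j, (p.2.1 j)^2 := by positivity
    have hrho : rho n p = ∑ j, (p.1 j)^2 + ∑ j, (p.2.1 j)^2 := rfl
    have ht : 1 + ‖p.2.2‖^2 ≤ nq n p ^ (2:ℝ) := by
      have : nq n p ^ (2:ℝ) = (1 + rho n p)^2 + p.2.2^2 := by
        rw [Real.rpow_two, nq, Complex.sq_norm, Complex.normSq_apply]; simp; ring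
      rw [this, Real.norm_eq_abs, sq_abs]; nlinarith [rho_nonneg p]
    rw [Real.norm_eq_abs, abs_of_nonneg (by positivity)]
    have e : -β = -(n+δ)/2 + (-(n+δ)/2 + 2 * (-(1+δ)/2)) := by rw [hδ]; ring
    have hn0 : (0:ℝ) ≤ n := by positivity
    rw [e, Real.rpow_add hq, Real.rpow_add hq, Real.rpow_mul hq.le]
    gcongr ?_ * (?_ * ?_)
    · exact Real.rpow_le_rpow_of_nonpos (by positivity) (by linarith) (by linarith)
    · exact Real.rpow_le_rpow_of_nonpos (by positivity) (by linarith) (by linarith)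
    · exact Real.rpow_le_rpow_of_nonpos (by positivity) (by linarith) (by linarith)

lemma sg_hasFDerivAt (p : Pt n) : ∃ S' : Pt n →L[ℝ] ℂ, HasFDerivAt (sg n) S' p ∧
    (∀ j, S' (ex n j) = 2 * (p.1 j : ℂ)) ∧ (∀ j, S' (ey n j) = 2 * (p.2.1 j : ℂ)) ∧
    S' (et n) = - Complex.I := by
  have h1 : HasFDerivAt (fun p : Pt n => p.1) (ContinuousLinearMap.fst ℝ _ _) p := hasFDerivAt_fst
  have h2 : HasFDerivAt (fun p : Pt n => p.2) (ContinuousLinearMap.snd ℝ _ _) p := hasFDerivAt_snd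
  have h21 := h2.fst
  have h22 := h2.snd
  have h1j := fun j => ((hasFDerivAt_apply (𝕜 := ℝ) j p.1).comp p h1).pow 2
  have h2j := fun j => ((hasFDerivAt_apply (𝕜 := ℝ) j p.2.1).comp p h21).pow 2
  have hr := (HasFDerivAt.fun_sum (u := Finset.univ) fun j _ => h1j j).add
    (HasFDerivAt.fun_sum (u := Finset.univ) fun j _ => h2j j)
  have hs := ((Complex.ofRealCLM.hasFDerivAt (x := rho n p)).comp p hr).sub
    (((Complex.ofRealCLM.hasFDerivAt (x := p.2.2)).comp p h22).mul_const Complex.I)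
  refine ⟨_, hs, ?_, ?_, ?_⟩
  · intro j
    simp [ex, Pi.single_apply]
  · intro j
    simp [ey, Pi.single_apply]
  · simp [et]
def T (κ : ℂ) (a b : ℂ → ℂ) (s : ℂ) : ℝ := (κ * (a s * conj (b s))).re

lemma T_bound (κ : ℂ) (a b : ℂ → ℂ) (s : ℂ) : |T κ a b s| ≤ ‖κ‖ * (‖a s‖ * ‖b s‖) := by
  refine (Complex.abs_re_le_norm _).trans ?_
  simp

lemma T_hasFDerivAt {κ : ℂ} {a b : ℂ → ℂ} {s a' b' : ℂ} (ha : HasDerivAt a a' s) (hb : HasDerivAt b b' s) :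
    ∃ F' : ℂ →L[ℝ] ℝ, HasFDerivAt (T κ a b) F' s ∧
      ∀ v, F' v = (κ * (a' * v * conj (b s) + a s * conj (b' * v))).re := by
  have h1 : HasFDerivAt a _ s := ha.hasFDerivAt.restrictScalars ℝ
  have h2 : HasFDerivAt b _ s := hb.hasFDerivAt.restrictScalars ℝ
  have h3 := (Complex.conjCLE.toContinuousLinearMap.hasFDerivAt (x := b s)).comp s h2
  have h4 := (h1.mul h3).const_mul κ
  have h5 := (Complex.reCLM.hasFDerivAt (x := κ * (a s * conj (b s)))).comp s h4
  refine ⟨_, h5, fun v => ?_⟩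
  simp
  ring

lemma XT {κ : ℂ} {a b a1 b1 : ℂ → ℂ} {p : Pt n} (ha : HasDerivAt a (a1 (sg n p)) (sg n p))
    (hb : HasDerivAt b (b1 (sg n p)) (sg n p)) :
    DifferentiableAt ℝ (fun p => T κ a b (sg n p)) p ∧ ∀ j,
    Xd n j (fun p => T κ a b (sg n p)) p =
      2 * (p.1 j * (T κ a1 b (sg n p) + T κ a b1 (sg n p))
       - p.2.1 j * (T (κ * Complex.I) a1 b (sg n p) - T (κ * Complex.I) a b1 (sg n p))) ∧
    Yd n j (fun p => T κ a b (sg n p)) p =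
      2 * (p.2.1 j * (T κ a1 b (sg n p) + T κ a b1 (sg n p))
       + p.1 j * (T (κ * Complex.I) a1 b (sg n p) - T (κ * Complex.I) a b1 (sg n p))) := by
  obtain ⟨F', hF, hv⟩ := T_hasFDerivAt (κ := κ) ha hb
  obtain ⟨S', hS, e1, e2, e3⟩ := sg_hasFDerivAt p
  have h := hF.comp p hS
  have hfd : fderiv ℝ (fun p => T κ a b (sg n p)) p = F'.comp S' := h.fderiv
  refine ⟨h.differentiableAt, fun j => ⟨?_, ?_⟩⟩
  · simp only [Xd, hfd, ContinuousLinearMap.comp_apply, e1, e3, hv]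
    simp only [T]
    simp
    ring
  · simp only [Yd, hfd, ContinuousLinearMap.comp_apply, e2, e3, hv]
    simp only [T]
    simp
    ring

/-- functions with decay for which Green's formula holds -/
def Good (n : ℕ) (u L : Pt n → ℝ) : Prop :=
  Differentiable ℝ u ∧ (∀ j, Differentiable ℝ (Xd n j u)) ∧ (∀ j, Differentiable ℝ (Yd n j u)) ∧
  (∀ p, kohn n u p = L p) ∧ Continuous L ∧ (∀ j, Continuous (Xd n j (Xd n j u)) ∧ Continuous (Yd n j (Yd n j u))) ∧
  ∃ C, ∀ p, |u p| ≤ C * (nq n p ^ n)⁻¹ ∧ ∀ j,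
    |Xd n j u p| * √(nq n p) ≤ C * (nq n p ^ n)⁻¹ ∧ |Yd n j u p| * √(nq n p) ≤ C * (nq n p ^ n)⁻¹ ∧
    |Xd n j (Xd n j u) p| * nq n p ≤ C * (nq n p ^ n)⁻¹ ∧ |Yd n j (Yd n j u) p| * nq n p ≤ C * (nq n p ^ n)⁻¹

lemma Xd_add {u v : Pt n → ℝ} {p : Pt n} (hu : DifferentiableAt ℝ u p) (hv : DifferentiableAt ℝ v p) (j : Fin n) :
    Xd n j (fun p => u p + v p) p = Xd n j u p + Xd n j v p := by
  simp only [Xd]; rw [fderiv_fun_add hu hv]; simp; ring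
lemma Yd_add {u v : Pt n → ℝ} {p : Pt n} (hu : DifferentiableAt ℝ u p) (hv : DifferentiableAt ℝ v p) (j : Fin n) :
    Yd n j (fun p => u p + v p) p = Yd n j u p + Yd n j v p := by
  simp only [Yd]; rw [fderiv_fun_add hu hv]; simp; ring

lemma Good.zero : Good n (fun _ => 0) (fun _ => 0) := by
  have hX : ∀ j, Xd n j (fun _ => (0:ℝ)) = fun _ => 0 := fun j => by funext p; simp [Xd]
  have hY : ∀ j, Yd n j (fun _ => (0:ℝ)) = fun _ => 0 := fun j => by funext p; simp [Yd]
  refine ⟨by fun_prop, fun j => by rw [hX]; fun_prop, fun j => by rw [hY]; fun_prop, fun p => ?_,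
    continuous_const, fun j => ?_, 0, fun p => ?_⟩
  · simp [kohn, hX, hY]
  · simp only [hX, hY]; exact ⟨continuous_const, continuous_const⟩
  · simp [hX, hY]

lemma Good.add {u v L M : Pt n → ℝ} (hu : Good n u L) (hv : Good n v M) :
    Good n (fun p => u p + v p) (fun p => L p + M p) := by
  obtain ⟨a1, a2, a3, a4, a5, a6, C, hC⟩ := hu
  obtain ⟨b1, b2, b3, b4, b5, b6, D, hD⟩ := hv
  have eX : ∀ j, Xd n j (fun p => u p + v p) = fun p => Xd n j u p + Xd n j v p := fun j =>
    funext fun p => Xd_add (a1 p) (b1 p) j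
  have eY : ∀ j, Yd n j (fun p => u p + v p) = fun p => Yd n j u p + Yd n j v p := fun j =>
    funext fun p => Yd_add (a1 p) (b1 p) j
  have eXX : ∀ j, Xd n j (Xd n j (fun p => u p + v p)) = fun p => Xd n j (Xd n j u) p + Xd n j (Xd n j v) p :=
    fun j => by rw [eX]; exact funext fun p => Xd_add (a2 j p) (b2 j p) j
  have eYY : ∀ j, Yd n j (Yd n j (fun p => u p + v p)) = fun p => Yd n j (Yd n j u) p + Yd n j (Yd n j v) p :=
    fun j => by rw [eY]; exact funext fun p => Yd_add (a3 j p) (b3 j p) j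
  refine ⟨a1.add b1, fun j => by rw [eX]; exact (a2 j).add (b2 j), fun j => by rw [eY]; exact (a3 j).add (b3 j),
    fun p => ?_, a5.add b5, fun j => ?_, C + D, fun p => ?_⟩
  · show _ = L p + M p
    rw [← a4, ← b4]; simp only [kohn, eXX, eYY, ← Finset.sum_add_distrib]
    exact Finset.sum_congr rfl fun j _ => by ring
  · rw [eXX, eYY]; exact ⟨(a6 j).1.add (b6 j).1, (a6 j).2.add (b6 j).2⟩
  · have aux : ∀ (s t r : ℝ), 0 ≤ r → |s| * r ≤ C * (nq n p ^ n)⁻¹ → |t| * r ≤ D * (nq n p ^ n)⁻¹ →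
        |s + t| * r ≤ (C + D) * (nq n p ^ n)⁻¹ := by
      intro s t r hr h1 h2
      nlinarith [mul_le_mul_of_nonneg_right (abs_add_le s t) hr]
    have hN := (nq_pos p).le
    refine ⟨by simpa using aux _ _ 1 zero_le_one (by simpa using (hC p).1) (by simpa using (hD p).1), fun j => ?_⟩
    obtain ⟨c1, c2, c3, c4⟩ := (hC p).2 j
    obtain ⟨d1, d2, d3, d4⟩ := (hD p).2 j
    simp only [eXX, eYY]
    simp only [eX, eY]
    exact ⟨aux _ _ _ (Real.sqrt_nonneg _) c1 d1, aux _ _ _ (Real.sqrt_nonneg _) c2 d2, aux _ _ _ hN c3 d3, aux _ _ _ hN c4 d4⟩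

def Hol (n : ℕ) (a a1 a2 : ℂ → ℂ) : Prop :=
  (∀ s : ℂ, 0 ≤ s.re → HasDerivAt a (a1 s) s ∧ HasDerivAt a1 (a2 s) s ∧ ContinuousAt a2 s) ∧
  ∃ C, 0 ≤ C ∧ ∀ s : ℂ, 0 ≤ s.re → ‖a s‖ ≤ C * √((‖s+1‖^n)⁻¹) ∧
    ‖a1 s‖ * ‖s+1‖ ≤ C * √((‖s+1‖^n)⁻¹) ∧ ‖a2 s‖ * ‖s+1‖^2 ≤ C * √((‖s+1‖^n)⁻¹)

lemma T_cont {κ : ℂ} {a b : ℂ → ℂ} (ha : ∀ s : ℂ, 0 ≤ s.re → ContinuousAt a s)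
    (hb : ∀ s : ℂ, 0 ≤ s.re → ContinuousAt b s) : Continuous (fun p : Pt n => T κ a b (sg n p)) := by
  rw [continuous_iff_continuousAt]
  intro p
  have h0 : 0 ≤ (sg n p).re := by simp [rho_nonneg]
  have hs := (continuous_sg (n := n)).continuousAt (x := p)
  have h1 : ContinuousAt (fun p : Pt n => a (sg n p)) p := (ha _ h0).comp hs
  have h2 : ContinuousAt (fun p : Pt n => b (sg n p)) p := (hb _ h0).comp hs
  unfold T
  exact Complex.continuous_re.continuousAt.comp
    (continuousAt_const.mul (h1.mul (Complex.continuous_conj.continuousAt.comp h2)))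

lemma Xd_coord (j : Fin n) {G : Pt n → ℝ} {p : Pt n} (hG : DifferentiableAt ℝ G p) :
    Xd n j (fun p => p.1 j * G p) p = G p + p.1 j * Xd n j G p ∧
    Xd n j (fun p => p.2.1 j * G p) p = p.2.1 j * Xd n j G p ∧
    Yd n j (fun p => p.1 j * G p) p = p.1 j * Yd n j G p ∧
    Yd n j (fun p => p.2.1 j * G p) p = G p + p.2.1 j * Yd n j G p := by
  have h1 : HasFDerivAt (fun p : Pt n => p.1 j) _ p :=
    (hasFDerivAt_apply (𝕜 := ℝ) j p.1).comp p hasFDerivAt_fst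
  have h0 : HasFDerivAt (fun p : Pt n => p.2) (ContinuousLinearMap.snd ℝ _ _) p := hasFDerivAt_snd
  have h2' := (hasFDerivAt_apply (𝕜 := ℝ) j p.2.1).comp p h0.fst
  have h2 : HasFDerivAt (fun p : Pt n => p.2.1 j) _ p := h2'
  rw [Xd_mul h1.differentiableAt hG, Xd_mul h2.differentiableAt hG, Yd_mul h1.differentiableAt hG,
    Yd_mul h2.differentiableAt hG]
  simp only [Xd, Yd, h1.fderiv, h2.fderiv]
  simp [ex, ey, et]
  ring_nf
  simp

lemma Xd_lin (j : Fin n) {G H : Pt n → ℝ} {p : Pt n} (hG : DifferentiableAt ℝ G p) (hH : DifferentiableAt ℝ H p) :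
    Xd n j (fun p => 2 * (G p - H p)) p = 2 * (Xd n j G p - Xd n j H p) ∧
    Yd n j (fun p => 2 * (G p + H p)) p = 2 * (Yd n j G p + Yd n j H p) := by
  simp only [Xd, Yd]
  rw [fderiv_const_mul (hG.fun_sub hH), fderiv_fun_sub hG hH, fderiv_const_mul (hG.fun_add hH), fderiv_fun_add hG hH]
  simp; constructor <;> ring
lemma lin_bound {x y r A B e : ℝ} (hx : |x| ≤ r) (hy : |y| ≤ r) (hA : |A| ≤ e) (hB : |B| ≤ e) :
    |2 * (x * A - y * B)| ≤ 4 * r * e ∧ |2 * (y * A + x * B)| ≤ 4 * r * e := by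
  have h1 : |x * A| ≤ r * e := by rw [abs_mul]; exact mul_le_mul hx hA (abs_nonneg _) ((abs_nonneg _).trans hx)
  have h2 : |y * B| ≤ r * e := by rw [abs_mul]; exact mul_le_mul hy hB (abs_nonneg _) ((abs_nonneg _).trans hx)
  have h3 : |x * B| ≤ r * e := by rw [abs_mul]; exact mul_le_mul hx hB (abs_nonneg _) ((abs_nonneg _).trans hx)
  have h4 : |y * A| ≤ r * e := by rw [abs_mul]; exact mul_le_mul hy hA (abs_nonneg _) ((abs_nonneg _).trans hx)
  rw [abs_le] at *
  rw [abs_le]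
  refine ⟨⟨by linarith, by linarith⟩, ⟨by linarith, by linarith⟩⟩

lemma good_T {a a1 a2 b b1 b2 : ℂ → ℂ} (ha : Hol n a a1 a2) (hb : Hol n b b1 b2) (κ : ℂ) :
    Good n (fun p => T κ a b (sg n p)) (fun p => 4 * n * (T κ a1 b (sg n p) + T κ a b1 (sg n p))
      + 16 * rho n p * T κ a1 b1 (sg n p)) := by
  obtain ⟨ha, C, hC0, hC⟩ := ha
  obtain ⟨hb, D, hD0, hD⟩ := hb
  have h0 : ∀ p : Pt n, 0 ≤ (sg n p).re := fun p => by simp [rho_nonneg]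
  have da : ∀ p : Pt n, HasDerivAt a (a1 (sg n p)) (sg n p) := fun p => (ha _ (h0 p)).1
  have da1 : ∀ p : Pt n, HasDerivAt a1 (a2 (sg n p)) (sg n p) := fun p => (ha _ (h0 p)).2.1
  have db : ∀ p : Pt n, HasDerivAt b (b1 (sg n p)) (sg n p) := fun p => (hb _ (h0 p)).1
  have db1 : ∀ p : Pt n, HasDerivAt b1 (b2 (sg n p)) (sg n p) := fun p => (hb _ (h0 p)).2.1
  have ca := fun s hs => (ha s hs).1.continuousAt
  have ca1 := fun s hs => (ha s hs).2.1.continuousAt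
  have ca2 := fun s hs => (ha s hs).2.2
  have cb := fun s hs => (hb s hs).1.continuousAt
  have cb1 := fun s hs => (hb s hs).2.1.continuousAt
  have cb2 := fun s hs => (hb s hs).2.2
  set G : Pt n → ℝ := fun p => T κ a1 b (sg n p) + T κ a b1 (sg n p) with hG
  set H : Pt n → ℝ := fun p => T (κ * Complex.I) a1 b (sg n p) + T (-(κ * Complex.I)) a b1 (sg n p) with hH
  have neg : ∀ (k : ℂ) (a b : ℂ → ℂ) s, T (-k) a b s = - T k a b s := fun k a b s => by simp [T]
  -- first derivatives
  have eX : ∀ j, Xd n j (fun p => T κ a b (sg n p)) = fun p => 2 * (p.1 j * G p - p.2.1 j * H p) := fun j =>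
    funext fun p => by rw [((XT (da p) (db p)).2 j).1, hG, hH]; simp only [neg]; ring
  have eY : ∀ j, Yd n j (fun p => T κ a b (sg n p)) = fun p => 2 * (p.2.1 j * G p + p.1 j * H p) := fun j =>
    funext fun p => by rw [((XT (da p) (db p)).2 j).2, hG, hH]; simp only [neg]; ring
  have dG : Differentiable ℝ G := fun p => (XT (da1 p) (db p)).1.add (XT (da p) (db1 p)).1
  have dH : Differentiable ℝ H := fun p => (XT (da1 p) (db p)).1.add (XT (da p) (db1 p)).1
  have dx : ∀ j, Differentiable ℝ (fun p : Pt n => p.1 j) := fun j => by fun_prop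
  have dy : ∀ j, Differentiable ℝ (fun p : Pt n => p.2.1 j) := fun j => by fun_prop
  -- second derivatives
  set G1 : Pt n → ℝ := fun p => T κ a2 b (sg n p) + 2 * T κ a1 b1 (sg n p) + T κ a b2 (sg n p) with hG1
  set G2 : Pt n → ℝ := fun p => T (κ * Complex.I) a2 b (sg n p) - T (κ * Complex.I) a b2 (sg n p) with hG2
  set H2 : Pt n → ℝ := fun p => - T κ a2 b (sg n p) + 2 * T κ a1 b1 (sg n p) - T κ a b2 (sg n p) with hH2
  have II : ∀ (a b : ℂ → ℂ) s, T (κ * Complex.I * Complex.I) a b s = - T κ a b s := fun a b s => by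
    rw [mul_assoc, Complex.I_mul_I]; simp [T]
  have XG : ∀ j p, Xd n j G p = 2 * (p.1 j * G1 p - p.2.1 j * G2 p) ∧
      Yd n j G p = 2 * (p.2.1 j * G1 p + p.1 j * G2 p) := fun j p => by
    have A := XT (κ := κ) (da1 p) (db p)
    have B := XT (κ := κ) (da p) (db1 p)
    constructor
    · rw [hG, Xd_add A.1 B.1, (A.2 j).1, (B.2 j).1]; simp only [hG1, hG2]; ring
    · rw [hG, Yd_add A.1 B.1, (A.2 j).2, (B.2 j).2]; simp only [hG1, hG2]; ring
  have XH : ∀ j p, Xd n j H p = 2 * (p.1 j * G2 p - p.2.1 j * H2 p) ∧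
      Yd n j H p = 2 * (p.2.1 j * G2 p + p.1 j * H2 p) := fun j p => by
    have A := XT (κ := κ * Complex.I) (da1 p) (db p)
    have B := XT (κ := -(κ * Complex.I)) (da p) (db1 p)
    constructor
    · rw [hH, Xd_add A.1 B.1, (A.2 j).1, (B.2 j).1]; simp only [hG2, hH2, neg, neg_mul, II]; ring
    · rw [hH, Yd_add A.1 B.1, (A.2 j).2, (B.2 j).2]; simp only [hG2, hH2, neg, neg_mul, II]; ring
  have eXX : ∀ j, Xd n j (Xd n j (fun p => T κ a b (sg n p))) = fun p =>
      2 * (G p + p.1 j * (2 * (p.1 j * G1 p - p.2.1 j * G2 p))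
        - p.2.1 j * (2 * (p.1 j * G2 p - p.2.1 j * H2 p))) := fun j => funext fun p => by
    rw [eX, (Xd_lin j ((dx j p).fun_mul (dG p)) ((dy j p).fun_mul (dH p))).1, (Xd_coord j (dG p)).1,
      (Xd_coord j (dH p)).2.1, (XG j p).1, (XH j p).1]
  have eYY : ∀ j, Yd n j (Yd n j (fun p => T κ a b (sg n p))) = fun p =>
      2 * (G p + p.2.1 j * (2 * (p.2.1 j * G1 p + p.1 j * G2 p))
        + p.1 j * (2 * (p.2.1 j * G2 p + p.1 j * H2 p))) := fun j => funext fun p => by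
    rw [eY, (Xd_lin j ((dy j p).fun_mul (dG p)) ((dx j p).fun_mul (dH p))).2, (Xd_coord j (dG p)).2.2.2,
      (Xd_coord j (dH p)).2.2.1, (XG j p).2, (XH j p).2]
  have cont : ∀ {k : ℂ} {c d : ℂ → ℂ}, (∀ s : ℂ, 0 ≤ s.re → ContinuousAt c s) →
    (∀ s : ℂ, 0 ≤ s.re → ContinuousAt d s) → Continuous (fun p : Pt n => T k c d (sg n p)) := T_cont
  have cG : Continuous G := (cont ca1 cb).add (cont ca cb1)
  have cG1 : Continuous G1 := ((cont ca2 cb).add (continuous_const.mul (cont ca1 cb1))).add (cont ca cb2)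
  have cG2 : Continuous G2 := (cont ca2 cb).sub (cont ca cb2)
  have cH2 : Continuous H2 := ((cont ca2 cb).neg.add (continuous_const.mul (cont ca1 cb1))).sub (cont ca cb2)
  have crho := continuous_rho (n := n)
  refine ⟨fun p => (XT (da p) (db p)).1, fun j => ?_, fun j => ?_, fun p => ?_, ?_, fun j => ?_,
    ‖κ‖ * (C * D) * 100, fun p => ?_⟩
  · rw [eX]; exact (((dx j).mul dG).sub ((dy j).mul dH)).const_mul 2
  · rw [eY]; exact (((dy j).mul dG).add ((dx j).mul dH)).const_mul 2
  · simp only [kohn, eXX, eYY]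
    have : ∀ j : Fin n, (2 * (G p + p.1 j * (2 * (p.1 j * G1 p - p.2.1 j * G2 p))
        - p.2.1 j * (2 * (p.1 j * G2 p - p.2.1 j * H2 p)))
        + 2 * (G p + p.2.1 j * (2 * (p.2.1 j * G1 p + p.1 j * G2 p))
        + p.1 j * (2 * (p.2.1 j * G2 p + p.1 j * H2 p)))) = 4 * G p +
        16 * T κ a1 b1 (sg n p) * ((p.1 j)^2 + (p.2.1 j)^2) := fun j => by
      simp only [hG1, hH2]; ring
    rw [Finset.sum_congr rfl fun j _ => this j]
    have hr : ∑ j, ((p.1 j)^2 + (p.2.1 j)^2) = rho n p := Finset.sum_add_distrib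
    have hs : ∀ c d : ℝ, ∑ j : Fin n, (4 * c + 16 * d * ((p.1 j)^2 + (p.2.1 j)^2)) =
        4 * n * c + 16 * rho n p * d := fun c d => by
      rw [Finset.sum_add_distrib, ← Finset.mul_sum, ← Finset.mul_sum, hr]
      simp only [Finset.sum_const, Finset.card_univ, Fintype.card_fin, nsmul_eq_mul]
      ring
    exact hs _ _
  · exact (continuous_const.mul cG).add ((continuous_const.mul crho).mul (cont ca1 cb1))
  · rw [eXX, eYY]; constructor <;> fun_prop
  · set N := nq n p with hN
    have hN0 : 0 < N := nq_pos p
    set w := (N^n)⁻¹ with hw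
    have hw0 : 0 ≤ w := by positivity
    set K := ‖κ‖ * (C * D) with hK
    have hK0 : 0 ≤ K := by positivity
    set r := √N with hr
    have hr0 : 0 ≤ r := Real.sqrt_nonneg _
    have hr2 : r * r = N := Real.mul_self_sqrt hN0.le
    obtain ⟨c0, c1, c2⟩ := hC _ (h0 p)
    obtain ⟨d0, d1, d2⟩ := hD _ (h0 p)
    have hNe : ‖sg n p + 1‖ = N := rfl
    rw [hNe] at c0 c1 c2 d0 d1 d2
    have hww : √w * √w = w := Real.mul_self_sqrt hw0
    have hsw := Real.sqrt_nonneg w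
    have TB : ∀ (k : ℂ) (c d : ℂ → ℂ) (i j : ℕ), ‖k‖ = ‖κ‖ → ‖c (sg n p)‖ * N^i ≤ C * √w →
        ‖d (sg n p)‖ * N^j ≤ D * √w → |T k c d (sg n p)| ≤ K * w / N^(i+j) := by
      intro k c d i j hk h1 h2
      refine (T_bound _ _ _ _).trans ?_
      rw [le_div_iff₀ (by positivity), hk, pow_add]
      calc ‖κ‖ * (‖c (sg n p)‖ * ‖d (sg n p)‖) * (N^i * N^j)
          = ‖κ‖ * ((‖c (sg n p)‖ * N^i) * (‖d (sg n p)‖ * N^j)) := by ring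
        _ ≤ ‖κ‖ * ((C * √w) * (D * √w)) := by gcongr
        _ = K * (√w * √w) := by rw [hK]; ring
        _ = K * w := by rw [hww]
    have c0' : ‖a (sg n p)‖ * N^0 ≤ C * √w := by rw [pow_zero, mul_one]; exact c0
    have d0' : ‖b (sg n p)‖ * N^0 ≤ D * √w := by rw [pow_zero, mul_one]; exact d0
    have c1' : ‖a1 (sg n p)‖ * N^1 ≤ C * √w := by rw [pow_one]; exact c1
    have d1' : ‖b1 (sg n p)‖ * N^1 ≤ D * √w := by rw [pow_one]; exact d1
    have kI : ‖κ * Complex.I‖ = ‖κ‖ := by simp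
    have kI' : ‖-(κ * Complex.I)‖ = ‖κ‖ := by simp
    have t00 := TB κ a b 0 0 rfl c0' d0'
    have t10 := TB κ a1 b 1 0 rfl c1' d0'
    have t01 := TB κ a b1 0 1 rfl c0' d1'
    have t10I := TB _ a1 b 1 0 kI c1' d0'
    have t01I := TB _ a b1 0 1 kI' c0' d1'
    have t11 := TB κ a1 b1 1 1 rfl c1' d1'
    have t20 := TB κ a2 b 2 0 rfl c2 d0'
    have t02 := TB κ a b2 0 2 rfl c0' d2
    have t20I := TB _ a2 b 2 0 kI c2 d0'
    have t02I := TB _ a b2 0 2 kI c0' d2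
    simp only [Nat.reduceAdd] at t00 t10 t01 t10I t01I t11 t20 t02 t20I t02I
    rw [pow_zero, div_one] at t00
    rw [pow_one] at t10 t01 t10I t01I
    set e1 := K * w / N with he1
    set e2 := K * w / N^2 with he2
    have he1N : e1 * N = K * w := by rw [he1]; field_simp
    have he2N : e2 * N = e1 := by rw [he1, he2]; field_simp
    have hKw : 0 ≤ K * w := by positivity
    have bG : |G p| ≤ 2 * e1 := by
      rw [abs_le] at *; simp only [hG]; constructor <;> linarith
    have bH : |H p| ≤ 2 * e1 := by
      rw [abs_le] at *; simp only [hH]; constructor <;> linarith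
    have bG1 : |G1 p| ≤ 4 * e2 := by
      rw [abs_le] at *; simp only [hG1]; constructor <;> linarith
    have bG2 : |G2 p| ≤ 4 * e2 := by
      rw [abs_le] at *; simp only [hG2]; constructor <;> linarith [t20I.1, t02I.1, t20I.2, t02I.2]
    have bH2 : |H2 p| ≤ 4 * e2 := by
      rw [abs_le] at *; simp only [hH2]; constructor <;> linarith
    refine ⟨by linarith, fun j => ?_⟩
    have hx := x_le p j
    have hy := y_le p j
    have f1 := lin_bound hx hy bG bH
    have g1 := lin_bound hx hy bG1 bG2
    have g2 := lin_bound hx hy bG2 bH2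
    rw [← hN, ← hr] at f1 g1 g2 hx hy
    have m : ∀ (s t e : ℝ), |s| ≤ r → |t| ≤ 4 * r * (4 * e2) → |s * t| ≤ 16 * e1 := by
      intro s t e hs ht
      rw [abs_mul]
      calc |s| * |t| ≤ r * (4 * r * (4 * e2)) := by gcongr
        _ = 16 * (e2 * (r * r)) := by ring
        _ = 16 * e1 := by rw [hr2, he2N]
    simp only [eXX, eYY]
    simp only [eX, eY]
    have m1 := m _ _ 0 hx g1.1
    have m2 := m _ _ 0 hy g2.1
    have m3 := m _ _ 0 hy g1.2
    have m4 := m _ _ 0 hx g2.2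
    refine ⟨?_, ?_, ?_, ?_⟩
    · calc _ ≤ 4 * r * (2 * e1) * r := by gcongr; exact f1.1
        _ = 8 * (e1 * (r * r)) := by ring
        _ ≤ K * 100 * w := by rw [hr2, he1N]; linarith
    · calc _ ≤ 4 * r * (2 * e1) * r := by gcongr; exact f1.2
        _ = 8 * (e1 * (r * r)) := by ring
        _ ≤ K * 100 * w := by rw [hr2, he1N]; linarith
    · calc _ ≤ (68 * e1) * N := by
            gcongr
            rw [abs_le] at bG m1 m2 ⊢
            constructor <;> linarith
        _ ≤ K * 100 * w := by rw [mul_assoc, he1N]; linarith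
    · calc _ ≤ (68 * e1) * N := by
            gcongr
            rw [abs_le] at bG m3 m4 ⊢
            constructor <;> linarith
        _ ≤ K * 100 * w := by rw [mul_assoc, he1N]; linarith
def Vf (c σ : ℂ) : ℂ := 2 * c.re / (σ + c) - 1
def gf (c : ℂ) (s : ℝ) (j : ℕ) (σ : ℂ) : ℂ := (σ + c) ^ (-s : ℂ) * Vf c σ ^ j
def gd (c : ℂ) (s : ℝ) (j : ℕ) (σ : ℂ) : ℂ := -((s + j) * gf c (s+1) j σ + j * gf c (s+1) (j-1) σ)

lemma slit {c σ : ℂ} (hc : 0 < c.re) (hσ : 0 ≤ σ.re) : 0 < (σ + c).re := by simp; linarith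
lemma ne0 {c σ : ℂ} (hc : 0 < c.re) (hσ : 0 ≤ σ.re) : σ + c ≠ 0 := fun h => by
  have := slit hc hσ; rw [h] at this; simp at this

lemma Vf_norm {c σ : ℂ} (hc : 0 < c.re) (hσ : 0 ≤ σ.re) : ‖Vf c σ‖ ≤ 1 := by
  have h := ne0 hc hσ
  have e : Vf c σ = (2 * c.re - (σ + c)) / (σ + c) := by rw [Vf]; field_simp
  rw [e, norm_div, div_le_one (norm_pos_iff.2 h), ← sq_le_sq₀ (norm_nonneg _) (norm_nonneg _),
    ← Complex.normSq_eq_norm_sq, ← Complex.normSq_eq_norm_sq, Complex.normSq_apply, Complex.normSq_apply]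
  simp
  nlinarith

lemma gf_succ {c σ : ℂ} (hc : 0 < c.re) (hσ : 0 ≤ σ.re) (s : ℝ) (j : ℕ) :
    gf c (s+1) j σ = gf c s j σ / (σ + c) := by
  have h := ne0 hc hσ
  rw [gf, gf]
  have : (-((s+1 : ℝ):ℂ)) = -(s:ℂ) - 1 := by push_cast; ring
  rw [this, Complex.cpow_sub _ _ h, Complex.cpow_one]; ring

lemma gf_deriv {c σ : ℂ} (hc : 0 < c.re) (hσ : 0 ≤ σ.re) (s : ℝ) (j : ℕ) :
    HasDerivAt (gf c s j) (gd c s j σ) σ := by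
  have h := ne0 hc hσ
  have h1 : HasDerivAt (fun σ => σ + c) 1 σ := (hasDerivAt_id σ).add_const c
  have h2 := h1.cpow_const (c := (-s : ℂ)) (Or.inl (slit hc hσ))
  have h3 : HasDerivAt (Vf c) _ σ := ((h1.inv h).const_mul (2 * c.re : ℂ)).sub_const 1
  have h4 : HasDerivAt (gf c s j) _ σ := h2.mul (h3.pow j)
  convert h4 using 1
  rw [gd, gf_succ hc hσ, gf_succ hc hσ, gf, gf, Complex.cpow_sub _ _ h, Complex.cpow_one]
  have hV : (2 * c.re : ℂ) * (-1 / (σ + c)^2) = -(Vf c σ + 1) / (σ + c) := by rw [Vf]; field_simp; ring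
  rw [hV]
  rcases j with _ | j
  · simp
  · simp only [Nat.add_sub_cancel, pow_succ]; push_cast; field_simp; ring

lemma gf_cont {c σ : ℂ} (hc : 0 < c.re) (hσ : 0 ≤ σ.re) (s : ℝ) (j : ℕ) : ContinuousAt (gf c s j) σ :=
  (gf_deriv hc hσ s j).continuousAt

lemma gf_bound {c : ℂ} (hc : 0 < c.re) (n m : ℕ) : ∃ C, 0 ≤ C ∧ ∀ σ : ℂ, 0 ≤ σ.re → ∀ j,
    ‖gf c (n/2+m) j σ‖ * ‖σ + 1‖ ^ m ≤ C * √((‖σ+1‖^n)⁻¹) := by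
  set M := 1 + ‖c - 1‖ / c.re with hM
  have hM0 : 0 < M := by positivity
  refine ⟨M ^ ((n:ℝ)/2+m), by positivity, fun σ hσ j => ?_⟩
  have h := ne0 hc hσ
  have hq : 0 < ‖σ + c‖ := norm_pos_iff.2 h
  have h1 : 0 < ‖σ + 1‖ := norm_pos_iff.2 (ne0 (c := 1) (by simp) hσ)
  have hre : c.re ≤ ‖σ + c‖ := by
    have := Complex.re_le_norm (σ + c); simp at this; linarith
  have h2 : ‖σ + 1‖ ≤ M * ‖σ + c‖ := by
    have : σ + 1 = (σ + c) - (c - 1) := by ring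
    calc ‖σ + 1‖ ≤ ‖σ + c‖ + ‖c - 1‖ := by rw [this]; exact norm_sub_le _ _
      _ ≤ ‖σ + c‖ + ‖c - 1‖ / c.re * ‖σ + c‖ := by
        gcongr
        rw [div_mul_eq_mul_div, le_div_iff₀ hc]; gcongr
      _ = _ := by rw [hM]; ring
  have h3 : ‖gf c (n/2+m) j σ‖ ≤ ‖σ + c‖ ^ (-((n:ℝ)/2+m)) := by
    rw [gf, norm_mul, norm_pow, ← Complex.ofReal_neg, Complex.norm_cpow_real]
    exact mul_le_of_le_one_right (by positivity) (pow_le_one₀ (norm_nonneg _) (Vf_norm hc hσ))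
  have h4 : ‖σ + c‖ ^ (-((n:ℝ)/2+m)) ≤ M ^ ((n:ℝ)/2+m) * ‖σ + 1‖ ^ (-((n:ℝ)/2+m)) := by
    have h5 : ‖σ + 1‖ ^ ((n:ℝ)/2+m) ≤ M ^ ((n:ℝ)/2+m) * ‖σ + c‖ ^ ((n:ℝ)/2+m) := by
      rw [← Real.mul_rpow hM0.le hq.le]; gcongr
    rw [Real.rpow_neg hq.le, Real.rpow_neg h1.le]
    have a1 : 0 < ‖σ + c‖ ^ ((n:ℝ)/2+m) := by positivity
    have a2 : 0 < ‖σ + 1‖ ^ ((n:ℝ)/2+m) := by positivity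
    rw [← div_eq_mul_inv, le_div_iff₀ a2, inv_mul_le_iff₀ a1, mul_comm (‖σ + c‖ ^ _)]; exact h5
  have h6 : ‖σ + 1‖ ^ (-((n:ℝ)/2+m)) * ‖σ + 1‖ ^ m = √((‖σ+1‖^n)⁻¹) := by
    rw [← Real.rpow_natCast ‖σ + 1‖ m, ← Real.rpow_add h1, Real.sqrt_eq_rpow, ← Real.rpow_natCast, ← Real.rpow_neg h1.le,
      ← Real.rpow_mul h1.le]
    congr 1; ring
  calc _ ≤ M ^ ((n:ℝ)/2+m) * ‖σ + 1‖ ^ (-((n:ℝ)/2+m)) * ‖σ + 1‖ ^ m := by gcongr; exact h3.trans h4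
    _ = _ := by rw [mul_assoc, h6]

def gdd (c : ℂ) (s : ℝ) (j : ℕ) (σ : ℂ) : ℂ := -((s + j) * gd c (s+1) j σ + j * gd c (s+1) (j-1) σ)

lemma hol_gf {c : ℂ} (hc : 0 < c.re) (n j : ℕ) : Hol n (gf c (n/2) j) (gd c (n/2) j) (gdd c (n/2) j) := by
  refine ⟨fun σ hσ => ⟨gf_deriv hc hσ _ _, ?_, ?_⟩, ?_⟩
  · exact (((gf_deriv hc hσ _ _).const_mul _).add ((gf_deriv hc hσ _ _).const_mul _)).neg
  · have k := fun s j => gf_cont hc hσ s j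
    unfold gdd gd
    fun_prop
  · obtain ⟨C0, p0, h0⟩ := gf_bound hc n 0
    obtain ⟨C1, p1, h1⟩ := gf_bound hc n 1
    obtain ⟨C2, p2, h2⟩ := gf_bound hc n 2
    set K1 : ℝ := (‖((n:ℝ)/2 + j : ℂ)‖ + j) * C1
    set K2 : ℝ := (‖((n:ℝ)/2 + j : ℂ)‖ * (‖((n:ℝ)/2 + 1 + j : ℂ)‖ + j) + j * (‖((n:ℝ)/2 + 1 + (j-1:ℕ) : ℂ)‖ + (j-1:ℕ))) * C2
    have q1 : 0 ≤ K1 := by positivity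
    have q2 : 0 ≤ K2 := by positivity
    refine ⟨C0 + K1 + K2, by positivity, fun σ hσ => ?_⟩
    have A0 : ∀ j, ‖gf c (n/2) j σ‖ ≤ C0 * √((‖σ+1‖^n)⁻¹) := fun j => by simpa using h0 σ hσ j
    have A1 : ∀ j, ‖gf c (n/2+1) j σ‖ * ‖σ+1‖ ≤ C1 * √((‖σ+1‖^n)⁻¹) := fun j => by simpa using h1 σ hσ j
    have A2 : ∀ j, ‖gf c (n/2+1+1) j σ‖ * ‖σ+1‖^2 ≤ C2 * √((‖σ+1‖^n)⁻¹) := fun j => by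
      have := h2 σ hσ j; rw [add_assoc]; norm_num at this ⊢; exact this
    set w := √((‖σ+1‖^n)⁻¹)
    have w0 : 0 ≤ w := Real.sqrt_nonneg _
    have key : ∀ (x y a b : ℂ) (N X Y : ℝ), 0 ≤ N → ‖a‖ * N ≤ X → ‖b‖ * N ≤ Y →
        ‖-(x * a + y * b)‖ * N ≤ ‖x‖ * X + ‖y‖ * Y := by
      intro x y a b N X Y hN ha hb
      rw [norm_neg]
      calc _ ≤ (‖x‖ * ‖a‖ + ‖y‖ * ‖b‖) * N := by
            gcongr; exact (norm_add_le _ _).trans (by rw [norm_mul, norm_mul])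
        _ = ‖x‖ * (‖a‖ * N) + ‖y‖ * (‖b‖ * N) := by ring
        _ ≤ _ := by gcongr
    refine ⟨(A0 j).trans (by nlinarith [mul_nonneg q1 w0, mul_nonneg q2 w0]), ?_, ?_⟩
    · refine (key _ _ _ _ _ _ _ (norm_nonneg _) (A1 _) (A1 _)).trans ?_
      have : ‖((n:ℝ)/2 + j : ℂ)‖ * (C1 * w) + ‖(j:ℂ)‖ * (C1 * w) = K1 * w := by simp [K1]; ring
      push_cast at this ⊢
      rw [this]; nlinarith [mul_nonneg p0 w0, mul_nonneg q2 w0]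
    · refine (key _ _ _ _ _ _ _ (by positivity) (key _ _ _ _ _ _ _ (by positivity) (A2 _) (A2 _))
        (key _ _ _ _ _ _ _ (by positivity) (A2 _) (A2 _))).trans ?_
      have : ‖((n:ℝ)/2 + j : ℂ)‖ * (‖((n:ℝ)/2 + 1 + j : ℂ)‖ * (C2 * w) + ‖(j:ℂ)‖ * (C2 * w)) +
        ‖(j:ℂ)‖ * (‖((n:ℝ)/2 + 1 + (j-1:ℕ) : ℂ)‖ * (C2 * w) + ‖((j-1:ℕ):ℂ)‖ * (C2 * w)) = K2 * w := by
        simp only [K2, Complex.norm_natCast]; ring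
      push_cast at this ⊢
      rw [this]; nlinarith [mul_nonneg p0 w0, mul_nonneg q1 w0]
abbrev Po := (ℕ × ℕ) →₀ ℂ
def mon (m : ℕ × ℕ) (w : ℂ) : ℂ := w ^ m.1 * conj w ^ m.2
def cev (w : ℂ) : Po →ₗ[ℂ] ℂ := Finsupp.linearCombination ℂ (fun m => mon m w)
def ev (P : Po) (w : ℂ) : ℝ := (cev w P).re
def Lam (n : ℕ) (m : ℕ × ℕ) : ℝ := (2 * m.1 + n) * (2 * m.2 + n) / n^2
def Lop (n : ℕ) : Po →ₗ[ℂ] Po := Finsupp.linearCombination ℂ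
  (fun m => Finsupp.single m (Lam n m : ℂ) - Finsupp.single (m.1-1, m.2-1) ((4 * m.1 * m.2 / n^2 : ℝ) : ℂ))
/-- frame function -/
def uf (n : ℕ) (c : ℂ) (P : Po) (p : Pt n) : ℝ := (‖sg n p + c‖^n)⁻¹ * ev P (Vf c (sg n p))
def Lf (n : ℕ) (c : ℂ) (P : Po) (p : Pt n) : ℝ :=
  -(4 * n^2 * c.re) * ((‖sg n p + c‖^(n+2))⁻¹ * ev (Lop n P) (Vf c (sg n p)))

@[simp] lemma ev_add (P Q : Po) (w) : ev (P + Q) w = ev P w + ev Q w := by simp [ev]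
@[simp] lemma ev_zero (w) : ev 0 w = 0 := by simp [ev]
@[simp] lemma cev_single (m κ w) : cev w (Finsupp.single m κ) = κ * mon m w := by simp [cev]
lemma Lop_single (m κ) : Lop n (Finsupp.single m κ) = Finsupp.single m (κ * Lam n m) -
    Finsupp.single (m.1-1, m.2-1) (κ * (4 * m.1 * m.2 / n^2 : ℝ)) := by
  simp only [Lop, Finsupp.linearCombination_single, smul_sub, Finsupp.smul_single, smul_eq_mul]

lemma gg {c σ : ℂ} (hc : 0 < c.re) (hσ : 0 ≤ σ.re) (n j k : ℕ) :
    gf c (n/2) j σ * conj (gf c (n/2) k σ) = ((‖σ + c‖^n)⁻¹ : ℝ) * mon (j,k) (Vf c σ) := by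
  have h := ne0 hc hσ
  have h1 : (σ + c) ^ (-((n:ℝ)/2 : ℝ) : ℂ) * conj ((σ + c) ^ (-((n:ℝ)/2 : ℝ) : ℂ)) = ((‖σ + c‖^n)⁻¹ : ℝ) := by
    rw [Complex.mul_conj, Complex.normSq_eq_norm_sq, ← Complex.ofReal_neg, Complex.norm_cpow_real]
    congr 1
    rw [← Real.rpow_natCast, ← Real.rpow_mul (norm_nonneg _), ← Real.rpow_natCast, ← Real.rpow_neg (norm_nonneg _)]
    congr 1; push_cast; ring
  simp only [gf, mon, map_mul, map_pow]
  rw [← h1]; ring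

lemma gf_rel {c σ : ℂ} (hc : 0 < c.re) (hσ : 0 ≤ σ.re) (s : ℝ) (j : ℕ) :
    (j:ℂ) * ((σ + c) * (gf c s j σ + gf c s (j-1) σ) - 2 * c.re * gf c s (j-1) σ) = 0 := by
  have h := ne0 hc hσ
  rcases j with _ | j
  · simp
  · simp only [gf, Nat.add_sub_cancel, pow_succ]
    have : (σ + c) * Vf c σ = 2 * c.re - (σ + c) := by rw [Vf]; field_simp
    linear_combination (↑(j+1):ℂ) * (σ + c) ^ (-s : ℂ) * Vf c σ ^ j * this

lemma good_single {c : ℂ} (hc : 0 < c.re) (hn : 1 ≤ n) (m : ℕ × ℕ) (κ : ℂ) :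
    Good n (uf n c (Finsupp.single m κ)) (Lf n c (Finsupp.single m κ)) := by
  obtain ⟨j, k⟩ := m
  have hG := good_T (hol_gf hc n j) (hol_gf hc n k) κ
  have e1 : (fun p => T κ (gf c (n/2) j) (gf c (n/2) k) (sg n p)) = uf n c (Finsupp.single (j,k) κ) := by
    funext p
    have hσ : 0 ≤ (sg n p).re := by simp [rho_nonneg]
    simp only [T, gg hc hσ, uf, ev, cev_single]
    rw [← Complex.re_ofReal_mul]; congr 1; ring
  rw [← e1]
  convert hG using 1
  funext p
  have hσ : 0 ≤ (sg n p).re := by simp [rho_nonneg]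
  have h := ne0 hc hσ
  set q := sg n p + c with hq
  have hqn : (‖q‖^2 : ℝ) = q * conj q := by rw [Complex.mul_conj, Complex.normSq_eq_norm_sq]
  have hcq : conj q ≠ 0 := by simpa using h
  have hrho : (rho n p : ℂ) = (q + conj q) / 2 - c.re := by
    rw [Complex.add_conj]; simp [hq]
  have r1 := gf_rel hc hσ (n/2) j
  have r2 := congrArg conj (gf_rel hc hσ (n/2) k)
  have hn' : (n:ℂ) ≠ 0 := by exact_mod_cast (by omega : n ≠ 0)
  have g1 := gg hc hσ n j k
  have g2 := gg hc hσ n (j-1) (k-1)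
  rw [← hq] at r1 r2 g1 g2
  simp only [Lf, ev, Lop_single, map_sub, cev_single, T]
  have d : ∀ j, gd c (n/2) j (sg n p) = -(((n/2:ℝ) + j) * gf c (n/2) j (sg n p) + j * gf c (n/2) (j-1) (sg n p)) / q := fun j => by
    rw [gd, gf_succ hc hσ, gf_succ hc hσ]; ring
  rw [d, d]
  set A := gf c (n/2) j (sg n p)
  set A' := gf c (n/2) (j-1) (sg n p)
  set B := gf c (n/2) k (sg n p)
  set B' := gf c (n/2) (k-1) (sg n p)
  have fin : ∀ (x y : ℂ) (a b : ℝ), (a:ℂ) * x = b * y → a * x.re = b * y.re := fun x y a b h => by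
    simpa using congrArg Complex.re h
  have lhs : ((-(4 * n^2 * c.re) * (‖q‖^(n+2))⁻¹ : ℝ) : ℂ) * (κ * (Lam n (j,k) : ℂ) * mon (j,k) (Vf c (sg n p)) -
      κ * ((4 * j * k / n^2 : ℝ) : ℂ) * mon (j-1,k-1) (Vf c (sg n p))) =
      κ * (-(16 * c.re) / (q * conj q) * (((n/2:ℝ) + j) * ((n/2:ℝ) + k) * (A * conj B) - j * k * (A' * conj B'))) := by
    rw [g1, g2, ← hqn, Lam, pow_add, mul_inv]; push_cast
    field_simp
    ring
  have e := congrArg Complex.re lhs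
  rw [mul_assoc, Complex.re_ofReal_mul, mul_assoc] at e
  refine Eq.trans ?_ (e.trans ?_)
  · simp only [Complex.sub_re]; push_cast; ring
  · have : ∀ (x : ℝ) (z : ℂ), x * z.re = ((x:ℂ) * z).re := fun x z => by simp
    rw [← Complex.add_re, this, this, ← Complex.add_re]
    congr 1
    push_cast
    rw [hrho]
    simp only [map_div₀, map_neg, map_add, map_mul, Complex.conj_natCast, map_sub, Complex.conj_ofReal, map_ofNat, map_zero] at r2 ⊢
    field_simp
    push_cast at r1 r2 ⊢
    linear_combination (-64) * κ * ((n/2 + k) * conj B + k * conj B') * r1 - 64 * κ * ((n/2 + j) * A + j * A') * r2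
lemma good_poly {c : ℂ} (hc : 0 < c.re) (hn : 1 ≤ n) (P : Po) : Good n (uf n c P) (Lf n c P) := by
  induction P using Finsupp.induction_linear with
  | zero =>
    convert Good.zero (n := n) using 1 <;> (funext p; simp [uf, Lf])
  | add P Q hP hQ =>
    convert hP.add hQ using 1 <;> (funext p; simp [uf, Lf]; ring)
  | single m κ => exact good_single hc hn m κ

/-- decay class: `|f| ≤ C nq^(-β)`, measurable -/
lemma int_of_decay {f g : Pt n → ℝ} (hn : 1 ≤ n) (hf : Continuous f) (hg : Continuous g) {C D : ℝ}
    (h1 : ∀ p, |f p| * √(nq n p) ≤ C * (nq n p ^ n)⁻¹) (h2 : ∀ p, |g p| ≤ D * (nq n p ^ n)⁻¹) :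
    Integrable (fun p => f p * g p) := by
  have hi := integrable_nq (n := n) (β := 2 * n + 1/2) (by
    have : (1:ℝ) ≤ n := by exact_mod_cast hn
    linarith)
  refine (hi.const_mul (C * D)).mono' (hf.mul hg).aestronglyMeasurable (Eventually.of_forall fun p => ?_)
  have hN := nq_pos p
  have hs : 0 < √(nq n p) := Real.sqrt_pos.2 hN
  have e : nq n p ^ (-(2 * n + 1/2 : ℝ)) = (nq n p ^ n)⁻¹ * (nq n p ^ n)⁻¹ / √(nq n p) := by
    rw [Real.sqrt_eq_rpow, neg_add, ← sub_eq_add_neg, Real.rpow_sub hN, Real.rpow_neg hN.le, two_mul,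
      Real.rpow_add hN, Real.rpow_natCast, mul_inv]
  rw [Real.norm_eq_abs, abs_mul, e]
  have a := (le_div_iff₀ hs).2 (h1 p)
  calc |f p| * |g p| ≤ (C * (nq n p ^ n)⁻¹ / √(nq n p)) * (D * (nq n p ^ n)⁻¹) :=
        mul_le_mul a (h2 p) (abs_nonneg _) ((abs_nonneg _).trans a)
    _ = _ := by ring

lemma sqrt_imp {x N K : ℝ} (hN : 1 ≤ N) (h : |x| * √N ≤ K) : |x| ≤ K := by
  have : 1 ≤ √N := Real.one_le_sqrt.2 hN
  nlinarith [abs_nonneg x]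
lemma n_imp {x N K : ℝ} (hN : 1 ≤ N) (h : |x| * N ≤ K) : |x| * √N ≤ K := by
  have : √N ≤ N := by rw [Real.sqrt_le_left (by linarith)]; nlinarith
  nlinarith [abs_nonneg x]

lemma green {u L u' L' : Pt n → ℝ} (hn : 1 ≤ n) (hu : Good n u L) (hu' : Good n u' L') :
    Integrable (fun p => u p * L' p) ∧ (∀ j, Integrable (fun p => Xd n j u p * Xd n j u' p) ∧
      Integrable (fun p => Yd n j u p * Yd n j u' p)) ∧
    ∫ p, u p * L' p = - ∑ j, ((∫ p, Xd n j u p * Xd n j u' p) + ∫ p, Yd n j u p * Yd n j u' p) := by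
  obtain ⟨a1, a2, a3, a4, a5, a6, C, hC⟩ := hu
  obtain ⟨b1, b2, b3, b4, b5, b6, D, hD⟩ := hu'
  have N1 := fun p => one_le_nq (n := n) p
  have comm : ∀ {f g : Pt n → ℝ}, Integrable (fun p => f p * g p) → Integrable (fun p => g p * f p) := fun h => by
    simpa only [mul_comm] using h
  have iX := fun j => comm (int_of_decay hn (b6 j).1 a1.continuous (fun p => n_imp (N1 p) ((hD p).2 j).2.2.1) (fun p => (hC p).1))
  have iY := fun j => comm (int_of_decay hn (b6 j).2 a1.continuous (fun p => n_imp (N1 p) ((hD p).2 j).2.2.2) (fun p => (hC p).1))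
  have iXX := fun j => int_of_decay hn (a2 j).continuous (b2 j).continuous (fun p => ((hC p).2 j).1)
    (fun p => sqrt_imp (N1 p) ((hD p).2 j).1)
  have iYY := fun j => int_of_decay hn (a3 j).continuous (b3 j).continuous (fun p => ((hC p).2 j).2.1)
    (fun p => sqrt_imp (N1 p) ((hD p).2 j).2.1)
  have i0X := fun j => comm (int_of_decay hn (b2 j).continuous a1.continuous (fun p => ((hD p).2 j).1) (fun p => (hC p).1))
  have i0Y := fun j => comm (int_of_decay hn (b3 j).continuous a1.continuous (fun p => ((hD p).2 j).2.1) (fun p => (hC p).1))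
  have e : (fun p => u p * L' p) = fun p => ∑ j, (u p * Xd n j (Xd n j u') p + u p * Yd n j (Yd n j u') p) := by
    funext p; rw [← b4, kohn, Finset.mul_sum]; exact Finset.sum_congr rfl fun j _ => by ring
  refine ⟨?_, fun j => ⟨iXX j, iYY j⟩, ?_⟩
  · rw [e]; exact integrable_finsetSum _ fun j _ => (iX j).add (iY j)
  · rw [e, integral_finsetSum _ fun j _ => (iX j).fun_add (iY j), ← Finset.sum_neg_distrib]
    refine Finset.sum_congr rfl fun j _ => ?_
    rw [integral_add (iX j) (iY j), Xd_parts a1 (b2 j) j (i0X j) (iX j) (iXX j),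
      Yd_parts a1 (b3 j) j (i0Y j) (iY j) (iYY j)]
    ring

lemma green_symm {u L u' L' : Pt n → ℝ} (hn : 1 ≤ n) (hu : Good n u L) (hu' : Good n u' L') :
    ∫ p, u p * L' p = ∫ p, u' p * L p := by
  rw [(green hn hu hu').2.2, (green hn hu' hu).2.2]
  congr 1
  exact Finset.sum_congr rfl fun j _ => by simp only [mul_comm]

lemma Xd_test {φ : Pt n → ℝ} (hφ : TestFun n φ) (j : Fin n) :
    Continuous (Xd n j φ) ∧ HasCompactSupport (Xd n j φ) ∧ Continuous (Yd n j φ) ∧ HasCompactSupport (Yd n j φ) := by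
  obtain ⟨h1, h2⟩ := hφ
  have c : Continuous (fderiv ℝ φ) := h1.continuous_fderiv (by simp)
  have s := h2.fderiv (𝕜 := ℝ)
  have aux : ∀ g : Pt n → ℝ, (∀ p, fderiv ℝ φ p = 0 → g p = 0) → HasCompactSupport g := fun g hg =>
    s.mono fun p hp => by
      rw [Function.mem_support] at hp ⊢; exact fun h => hp (hg p h)
  refine ⟨?_, aux _ fun p h => by simp [Xd, h], ?_, aux _ fun p h => by simp [Yd, h]⟩
  · unfold Xd; fun_prop
  · unfold Yd; fun_prop

lemma green_test {u L φ : Pt n → ℝ} (hu : Good n u L) (hφ : TestFun n φ) :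
    (∀ j, ∫ p, u p * Xd n j φ p = - ∫ p, Xd n j u p * φ p) ∧
    (∀ j, ∫ p, u p * Yd n j φ p = - ∫ p, Yd n j u p * φ p) ∧
    ∑ j, ((∫ p, Xd n j u p * Xd n j φ p) + ∫ p, Yd n j u p * Yd n j φ p) = - ∫ p, L p * φ p := by
  obtain ⟨a1, a2, a3, a4, a5, a6, -⟩ := hu
  have d : Differentiable ℝ φ := hφ.1.differentiable (by simp)
  have I : ∀ {f g : Pt n → ℝ}, Continuous f → Continuous g → HasCompactSupport g → Integrable (fun p => f p * g p) :=
    fun hf hg hs => (hf.mul hg).integrable_of_hasCompactSupport hs.mul_left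
  have T := Xd_test hφ
  have cX := fun j => (a2 j).continuous
  have cY := fun j => (a3 j).continuous
  have sX := fun j => (T j).2.1
  have i1 := fun j => I (cX j) (T j).1 (T j).2.1
  have i2 := fun j => I (cY j) (T j).2.2.1 (T j).2.2.2
  have k1 := fun j => I (a6 j).1 d.continuous hφ.2
  have k2 := fun j => I (a6 j).2 d.continuous hφ.2
  refine ⟨fun j => Xd_parts a1 d j (I a1.continuous d.continuous hφ.2) (I a1.continuous (T j).1 (T j).2.1) (I (cX j) d.continuous hφ.2),
    fun j => Yd_parts a1 d j (I a1.continuous d.continuous hφ.2) (I a1.continuous (T j).2.2.1 (T j).2.2.2) (I (cY j) d.continuous hφ.2), ?_⟩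
  have e : (fun p => L p * φ p) = fun p => ∑ j, (Xd n j (Xd n j u) p * φ p + Yd n j (Yd n j u) p * φ p) := by
    funext p; rw [← a4, kohn, Finset.sum_mul]; exact Finset.sum_congr rfl fun j _ => by ring
  rw [e, integral_finsetSum _ fun j _ => (k1 j).fun_add (k2 j), ← Finset.sum_neg_distrib]
  refine Finset.sum_congr rfl fun j _ => ?_
  rw [integral_add (k1 j) (k2 j), Xd_parts (a2 j) d j (I (cX j) d.continuous hφ.2) (i1 j) (k1 j),
    Yd_parts (a3 j) d j (I (cY j) d.continuous hφ.2) (i2 j) (k2 j)]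
  ring
def mu (n : ℕ) : Measure (Pt n) := volume.withDensity (fun p => ENNReal.ofReal ((nq n p ^ (2*n+2))⁻¹))
def Wm (n : ℕ) (p : Pt n) : ℂ := Vf 1 (sg n p)
def nu (n : ℕ) : Measure ℂ := (mu n).map (Wm n)

lemma sg_nonneg (p : Pt n) : 0 ≤ (sg n p).re := by simp [rho_nonneg]

lemma continuous_V {c : ℂ} (hc : 0 < c.re) : Continuous (fun p : Pt n => Vf c (sg n p)) := by
  unfold Vf
  have := continuous_sg (n := n)
  exact (continuous_const.div (this.add continuous_const) (fun p => ne0 hc (sg_nonneg p))).sub continuous_const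

lemma continuous_Wm : Continuous (Wm n) := continuous_V (by simp)
lemma measurable_Wm : Measurable (Wm n) := continuous_Wm.measurable
lemma Wm_norm (p : Pt n) : ‖Wm n p‖ ≤ 1 := Vf_norm (by simp) (sg_nonneg p)

lemma dens_cont : Continuous (fun p : Pt n => (nq n p ^ (2*n+2))⁻¹) :=
  (continuous_nq.pow _).inv₀ fun p => (pow_pos (nq_pos p) _).ne'
lemma dens_pos (p : Pt n) : 0 < (nq n p ^ (2*n+2))⁻¹ := by have := nq_pos p; positivity

lemma integrable_dens : Integrable (fun p : Pt n => (nq n p ^ (2*n+2))⁻¹) := by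
  have := integrable_nq (n := n) (β := 2*n+2) (by nlinarith [(Nat.cast_nonneg n : (0:ℝ) ≤ n)])
  refine this.congr (Eventually.of_forall fun p => ?_)
  simp only
  rw [Real.rpow_neg (nq_pos p).le]; congr 1
  exact_mod_cast Real.rpow_natCast (nq n p) (2*n+2)

instance : IsFiniteMeasure (mu n) := by
  refine isFiniteMeasure_withDensity_ofReal integrable_dens.hasFiniteIntegral
instance : IsFiniteMeasure (nu n) := by unfold nu; infer_instance

lemma int_mu {E : Type*} [NormedAddCommGroup E] [NormedSpace ℝ E] (f : Pt n → E) :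
    ∫ p, f p ∂(mu n) = ∫ p, (nq n p ^ (2*n+2))⁻¹ • f p := by
  rw [mu, integral_withDensity_eq_integral_toReal_smul (dens_cont.measurable.ennreal_ofReal) (Eventually.of_forall fun p => ENNReal.ofReal_lt_top)]
  simp only [ENNReal.toReal_ofReal (dens_pos _).le]

lemma int_nu {E : Type*} [NormedAddCommGroup E] [NormedSpace ℝ E] {f : ℂ → E} (hf : AEStronglyMeasurable f (nu n)) :
    ∫ w, f w ∂(nu n) = ∫ p, (nq n p ^ (2*n+2))⁻¹ • f (Wm n p) := by
  rw [nu, integral_map measurable_Wm.aemeasurable hf, int_mu]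

lemma ae_mu {P : Pt n → Prop} : (∀ᵐ p ∂(mu n), P p) ↔ ∀ᵐ p, P p := by
  rw [mu, ae_withDensity_iff dens_cont.measurable.ennreal_ofReal]
  simp only [ne_eq, ENNReal.ofReal_eq_zero, not_le, dens_pos, forall_const]

lemma ae_nu {P : ℂ → Prop} (hP : MeasurableSet {w | P w}) : (∀ᵐ w ∂(nu n), P w) ↔ ∀ᵐ p, P (Wm n p) := by
  rw [nu, ae_map_iff measurable_Wm.aemeasurable hP, ae_mu]

lemma ae_nu_imp {P : ℂ → Prop} (h : ∀ᵐ w ∂(nu n), P w) : ∀ᵐ p, P (Wm n p) := by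
  rw [nu] at h; exact ae_mu.1 (ae_of_ae_map measurable_Wm.aemeasurable h)

lemma nu_disc : ∀ᵐ w ∂(nu n), ‖w‖ ≤ 1 :=
  (ae_nu (measurableSet_le measurable_norm measurable_const)).2 (Eventually.of_forall Wm_norm)

lemma nu_pos : 0 < (nu n).real Set.univ := by
  have : (nu n).real Set.univ = ∫ p : Pt n, (nq n p ^ (2*n+2))⁻¹ := by
    have h := int_nu (n := n) (f := fun _ => (1:ℝ)) aestronglyMeasurable_const
    simpa using h
  rw [this]
  refine (integral_pos_iff_support_of_nonneg (fun p => (dens_pos p).le) integrable_dens).2 ?_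
  have : Function.support (fun p : Pt n => (nq n p ^ (2*n+2))⁻¹) = Set.univ :=
    Set.eq_univ_of_forall fun p => (dens_pos p).ne'
  rw [this]; simp

lemma int_disc {E : Type*} [NormedAddCommGroup E] [NormedSpace ℝ E] {f : ℂ → E} (hf : AEStronglyMeasurable f (nu n))
    {C : ℝ} (hC : ∀ w, ‖w‖ ≤ 1 → ‖f w‖ ≤ C) : Integrable f (nu n) :=
  Integrable.of_bound hf C (nu_disc.mono fun w hw => hC w hw)

lemma int_cont {E : Type*} [NormedAddCommGroup E] [NormedSpace ℝ E] {f : ℂ → E} (hf : Continuous f) : Integrable f (nu n) := by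
  obtain ⟨C, hC⟩ := (isCompact_closedBall (0:ℂ) 1).exists_bound_of_continuousOn hf.continuousOn
  exact int_disc hf.aestronglyMeasurable (C := C) fun w hw => hC w (by simpa using hw)

lemma continuous_mon (m) : Continuous (mon m) := by unfold mon; fun_prop
lemma continuous_cev (P : Po) : Continuous (fun w => cev w P) := by
  simp only [cev, Finsupp.linearCombination_apply, Finsupp.sum]
  exact continuous_finsetSum _ fun m _ => by have := continuous_mon m; fun_prop
lemma continuous_ev (P : Po) : Continuous (ev P) := Complex.continuous_re.comp (continuous_cev P)

lemma uf_one (P : Po) (p : Pt n) : uf n 1 P p = (nq n p ^ n)⁻¹ * ev P (Wm n p) := rfl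
lemma Lf_one (P : Po) (p : Pt n) : Lf n 1 P p = -(4 * n^2) * ((nq n p ^ (n+2))⁻¹ * ev (Lop n P) (Wm n p)) := by
  simp [Lf, nq, Wm]

lemma uL_one (P Q : Po) : ∫ p, uf n 1 P p * Lf n 1 Q p = -(4 * n^2) * ∫ w, ev P w * ev (Lop n Q) w ∂(nu n) := by
  rw [int_nu ((continuous_ev _).fun_mul (continuous_ev _)).aestronglyMeasurable, ← integral_const_mul]
  congr 1; funext p
  rw [uf_one, Lf_one, smul_eq_mul, show 2*n+2 = n + (n+2) by ring, pow_add _ n (n+2), mul_inv]; ring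

lemma L_symm (hn : 1 ≤ n) (P Q : Po) : ∫ w, ev P w * ev (Lop n Q) w ∂(nu n) = ∫ w, ev Q w * ev (Lop n P) w ∂(nu n) := by
  have h := green_symm hn (good_poly (c := 1) (by simp) hn P) (good_poly (c := 1) (by simp) hn Q)
  rw [uL_one, uL_one] at h
  have : (0:ℝ) < n := by exact_mod_cast hn
  exact mul_left_cancel₀ (by simp; omega) h

lemma energy (hn : 1 ≤ n) (P : Po) : ∑ j, ((∫ p, Xd n j (uf n 1 P) p ^ 2) + ∫ p, Yd n j (uf n 1 P) p ^ 2) =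
    4 * n^2 * ∫ w, ev P w * ev (Lop n P) w ∂(nu n) := by
  have h := (green hn (good_poly (c := 1) (by simp) hn P) (good_poly (c := 1) (by simp) hn P)).2.2
  rw [uL_one] at h
  simp only [pow_two] at h ⊢
  linarith
lemma ev_smul_real (r : ℝ) (P : Po) (w) : ev ((r:ℂ) • P) w = r * ev P w := by simp [ev]
lemma cev_eq (P : Po) (w) : cev w P = (ev P w : ℂ) + (ev (-Complex.I • P) w : ℂ) * Complex.I := by
  apply Complex.ext <;> simp [ev]

lemma Lop_int (hn : 1 ≤ n) (P : Po) : ∫ w, cev w (Lop n P) ∂(nu n) = ∫ w, cev w P ∂(nu n) := by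
  have hn' : (n:ℂ) ≠ 0 := by exact_mod_cast (by omega : n ≠ 0)
  have key : ∀ P, ∫ w, ev (Lop n P) w ∂(nu n) = ∫ w, ev P w ∂(nu n) := fun P => by
    have h := L_symm hn P (Finsupp.single (0,0) 1)
    have e1 : ∀ w, ev (Lop n (Finsupp.single (0,0) 1)) w = 1 := fun w => by
      rw [Lop_single]; simp [ev, Lam, mon]
      field_simp; simp
    have e2 : ∀ w, ev (Finsupp.single (0,0) 1) w = 1 := fun w => by simp [ev, mon]
    simp only [e1, e2, one_mul, mul_one] at h
    exact h.symm
  have I1 : ∀ P, Integrable (fun w => (ev P w : ℂ)) (nu n) := fun P =>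
    int_cont (Complex.continuous_ofReal.comp (continuous_ev P))
  have : ∀ P, ∫ w, cev w P ∂(nu n) = (∫ w, ev P w ∂(nu n) : ℝ) + (∫ w, ev (-Complex.I • P) w ∂(nu n) : ℝ) * Complex.I := fun P => by
    simp only [cev_eq P]
    rw [integral_add (I1 _) ((I1 _).mul_const _), integral_mul_const, integral_complex_ofReal, integral_complex_ofReal]
  rw [this, this, key, ← map_smul, key]

def mom (n : ℕ) (m : ℕ × ℕ) : ℂ := ∫ w, mon m w ∂(nu n)

lemma mom_rec (hn : 1 ≤ n) (j k : ℕ) :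
    ((2 * j + n) * (2 * k + n) - n^2 : ℂ) * mom n (j,k) = 4 * j * k * mom n (j-1,k-1) := by
  have hn' : (n:ℂ) ≠ 0 := by exact_mod_cast (by omega : n ≠ 0)
  have h := Lop_int hn (Finsupp.single (j,k) 1)
  simp only [Lop_single, map_sub, cev_single, one_mul] at h
  rw [integral_sub ((int_cont (continuous_mon _)).const_mul _) ((int_cont (continuous_mon _)).const_mul _),
    integral_const_mul, integral_const_mul] at h
  change _ * mom n (j,k) - _ * mom n (j-1,k-1) = mom n (j,k) at h
  simp only [Lam] at h
  push_cast at h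
  field_simp at h
  linear_combination h

lemma mom_off (hn : 1 ≤ n) : ∀ j k : ℕ, j ≠ k → mom n (j,k) = 0 := by
  have hn' : (0:ℝ) < n := by exact_mod_cast hn
  have fac : ∀ j k : ℕ, j ≠ k → ((2 * j + n) * (2 * k + n) - n^2 : ℂ) ≠ 0 := by
    intro j k hjk
    have : (0:ℝ) < (2 * j + n) * (2 * k + n) - n^2 := by
      have h : 1 ≤ j + k := by omega
      have h' : (1:ℝ) ≤ j + k := by exact_mod_cast h
      have : (0:ℝ) ≤ (j:ℝ) * k := by positivity
      nlinarith
    exact_mod_cast this.ne'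
  intro j
  induction j with
  | zero => intro k h; have := mom_rec hn 0 k; simp only [Nat.cast_zero, mul_zero, zero_mul] at this
            exact (mul_eq_zero.1 this).resolve_left (by have := fac 0 k h; simpa using this)
  | succ j ih =>
    intro k h
    have := mom_rec hn (j+1) k
    rcases k with _ | k
    · simp only [Nat.cast_zero, mul_zero, zero_mul] at this
      exact (mul_eq_zero.1 this).resolve_left (by have := fac (j+1) 0 h; simpa using this)
    · rw [Nat.add_sub_cancel, Nat.add_sub_cancel, ih k (by omega), mul_zero] at this
      exact (mul_eq_zero.1 this).resolve_left (fac _ _ h)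

/-- total mass -/
def nn (n : ℕ) : ℝ := (nu n).real Set.univ
def be (n j : ℕ) : ℝ := ∫ r in (0:ℝ)..1, r^j * (1-r)^(n-1)

lemma mom_diag (hn : 1 ≤ n) (j : ℕ) : mom n (j,j) = (nn n * (n * be n j) : ℝ) := by
  have hn' : (n:ℂ) ≠ 0 := by exact_mod_cast (by omega : n ≠ 0)
  induction j with
  | zero =>
    have : (n:ℝ) * be n 0 = 1 := by
      have h : ∀ x ∈ Set.uIcc (0:ℝ) 1, HasDerivAt (fun r:ℝ => -(1-r)^n/n) ((1-x)^(n-1)) x := fun x _ => by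
        have : HasDerivAt (fun r:ℝ => -(1-r)^n/n) _ x := ((((hasDerivAt_id x).const_sub 1).pow n).neg).div_const (n:ℝ)
        convert this using 1
        have : (n:ℝ) ≠ 0 := by exact_mod_cast (by omega : n ≠ 0)
        simp; field_simp
      simp only [be, pow_zero, one_mul]
      rw [intervalIntegral.integral_eq_sub_of_hasDerivAt h (Continuous.intervalIntegrable (by fun_prop) _ _)]
      have h1 : (n:ℝ) ≠ 0 := by exact_mod_cast (by omega : n ≠ 0)
      have h2 : n ≠ 0 := by omega
      simp [h2]; field_simp
    rw [this]; simp [mom, mon, nn]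
  | succ j ih =>
    have h := mom_rec hn (j+1) (j+1)
    have hb := beta_rec n hn j
    rw [Nat.add_sub_cancel, ih] at h
    have hb' : ((j:ℂ) + 1 + n) * be n (j+1) = (j+1) * be n j := by exact_mod_cast hb
    have h3 : (4 * (j+1) * ((j:ℂ) + 1 + n)) ≠ 0 := by
      have : (4 * (j+1) * ((j:ℝ) + 1 + n)) ≠ 0 := by positivity
      exact_mod_cast this
    apply mul_left_cancel₀ h3
    push_cast at h ⊢
    linear_combination h - 4 * (j+1) * nn n * n * hb'

open Polynomial in
/-- integrals of `w^a w̄^b S(|w|²)` -/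
lemma mom_poly (hn : 1 ≤ n) (a b : ℕ) (S : ℝ[X]) :
    ∫ w, mon (a,b) w * ((S.eval (Complex.normSq w) : ℝ) : ℂ) ∂(nu n) =
      if a = b then ((nn n * (n * ∫ r in (0:ℝ)..1, (X^a * S).eval r * (1-r)^(n-1)) : ℝ):ℂ) else 0 := by
  have cS : ∀ S : ℝ[X], Continuous (fun w => mon (a,b) w * ((S.eval (Complex.normSq w) : ℝ) : ℂ)) := fun S => by
    have := continuous_mon (a,b)
    have h2 := S.continuous.comp Complex.continuous_normSq
    exact this.mul (Complex.continuous_ofReal.comp h2)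
  have ci : ∀ S : ℝ[X], IntervalIntegrable (fun r => (X^a * S).eval r * (1-r)^(n-1)) volume 0 1 := fun S => by
    have := (X^a * S).continuous
    exact Continuous.intervalIntegrable (by fun_prop) _ _
  induction S using Polynomial.induction_on' with
  | add P Q hP hQ =>
    have e : ∀ w, mon (a,b) w * (((P+Q).eval (Complex.normSq w) : ℝ) : ℂ) =
      mon (a,b) w * ((P.eval (Complex.normSq w) : ℝ) : ℂ) + mon (a,b) w * ((Q.eval (Complex.normSq w) : ℝ) : ℂ) := fun w => by
        simp; ring
    simp only [e]
    rw [integral_add (int_cont (cS P)) (int_cont (cS Q)), hP, hQ]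
    split_ifs with h
    · have e2 : ∀ r, (X^a * (P+Q)).eval r * (1-r)^(n-1) = (X^a * P).eval r * (1-r)^(n-1) + (X^a * Q).eval r * (1-r)^(n-1) :=
        fun r => by simp; ring
      simp only [e2]
      rw [intervalIntegral.integral_add (ci P) (ci Q)]; push_cast; ring
    · simp
  | monomial i c =>
    have e : ∀ w, mon (a,b) w * (((monomial i c).eval (Complex.normSq w) : ℝ) : ℂ) = c * mon (a+i,b+i) w := fun w => by
      simp only [eval_monomial, mon]; push_cast; rw [Complex.normSq_eq_conj_mul_self, mul_pow, pow_add, pow_add]; ring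
    simp only [e]
    rw [integral_const_mul]
    change _ * mom n (a+i,b+i) = _
    split_ifs with h
    · subst h
      rw [mom_diag hn, be]
      have e2 : ∀ r : ℝ, (X^a * monomial i c).eval r * (1-r)^(n-1) = c * (r^(a+i) * (1-r)^(n-1)) := fun r => by
        simp [eval_monomial]; ring
      simp only [e2]
      rw [intervalIntegral.integral_const_mul]; push_cast; ring
    · rw [mom_off hn _ _ (by omega), mul_zero]
def gam (n a k : ℕ) : ℕ → ℝ
  | 0 => 1
  | i+1 => -(4 * ((k+a-i : ℕ):ℝ) * ((k-i:ℕ):ℝ) / n^2) * gam n a k i / (Lam n (k+a,k) - Lam n (k+a-(i+1),k-(i+1)))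
def eg (n a k : ℕ) : Po := ∑ i ∈ Finset.range (k+1), Finsupp.single (k+a-i,k-i) (gam n a k i : ℂ)
open Polynomial in
def rad (n a k : ℕ) : ℝ[X] := ∑ i ∈ Finset.range (k+1), C (gam n a k i) * X^(k-i)

lemma Lam_lt (hn : 1 ≤ n) {j k j' k' : ℕ} (h1 : j < j') (h2 : k < k') : Lam n (j,k) < Lam n (j',k') := by
  have hn' : (0:ℝ) < n := by exact_mod_cast hn
  have a1 : (j:ℝ) < j' := by exact_mod_cast h1
  have a2 : (k:ℝ) < k' := by exact_mod_cast h2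
  unfold Lam; gcongr

lemma eg_eig (hn : 1 ≤ n) (a k : ℕ) : Lop n (eg n a k) = (Lam n (k+a,k) : ℂ) • eg n a k := by
  have hn' : (n:ℝ) ≠ 0 := by exact_mod_cast (by omega : n ≠ 0)
  set D : ℕ → Po := fun i => Finsupp.single (k+a-i,k-i)
    (((Lam n (k+a,k) - Lam n (k+a-i,k-i)) * gam n a k i : ℝ):ℂ) with hD
  have step : ∀ i ∈ Finset.range (k+1), Lop n (Finsupp.single (k+a-i,k-i) (gam n a k i : ℂ)) =
      (Lam n (k+a,k) : ℂ) • Finsupp.single (k+a-i,k-i) (gam n a k i : ℂ) + (D (i+1) - D i) := by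
    intro i hi
    have hi' : i ≤ k := by simpa [Nat.lt_succ_iff] using hi
    rw [Lop_single]
    have h1 : D (i+1) = - Finsupp.single (k+a-i-1,k-i-1) (gam n a k i * (4 * ((k+a-i:ℕ):ℝ) * ((k-i:ℕ):ℝ) / n^2 : ℝ) : ℂ) := by
      rw [hD]
      have hl : (Lam n (k+a,k) - Lam n (k+a-(i+1),k-(i+1))) * gam n a k (i+1) =
          -(gam n a k i * (4 * ((k+a-i:ℕ):ℝ) * ((k-i:ℕ):ℝ) / n^2)) := by
        rcases eq_or_lt_of_le hi' with h | h
        · subst h; simp [gam]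
        · have := Lam_lt hn (j := k+a-(i+1)) (k := k-(i+1)) (j' := k+a) (k' := k) (by omega) (by omega)
          rw [gam, mul_div_cancel₀ _ (sub_ne_zero.2 this.ne')]; ring
      show Finsupp.single (k+a-(i+1),k-(i+1)) (((Lam n (k+a,k) - Lam n (k+a-(i+1),k-(i+1))) * gam n a k (i+1) : ℝ):ℂ) = _
      rw [hl, ← Finsupp.single_neg, Nat.sub_sub, Nat.sub_sub]
      congr 1; push_cast; ring
    rw [h1, hD]
    simp only [Finsupp.smul_single, smul_eq_mul]
    have h2 : ∀ (m : ℕ × ℕ) (x y z : ℂ) (Q : Po), x = y - z → Finsupp.single m x - Q =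
      Finsupp.single m y + (-Q - Finsupp.single m z) := by
      intro m x y z Q h; rw [h, Finsupp.single_sub]; abel
    exact h2 _ _ _ _ _ (by push_cast; ring)
  rw [eg, map_sum, Finset.sum_congr rfl step, Finset.sum_add_distrib, ← Finset.smul_sum, Finset.sum_range_sub]
  have d0 : D 0 = 0 := by simp [hD]
  have d1 : D (k+1) = 0 := by simp [hD, gam]
  rw [d0, d1]; simp

lemma cev_eg (a k : ℕ) (w : ℂ) : cev w (eg n a k) = w^a * (((rad n a k).eval (Complex.normSq w) : ℝ):ℂ) := by
  rw [eg, map_sum, rad, Polynomial.eval_finset_sum]; push_cast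
  rw [Finset.mul_sum]
  refine Finset.sum_congr rfl fun i hi => ?_
  have hi' : i ≤ k := by simpa [Nat.lt_succ_iff] using hi
  have : k + a - i = a + (k - i) := by omega
  simp [mon, this, Complex.normSq_eq_conj_mul_self]
  ring

lemma rad_monic (a k : ℕ) : (rad n a k).Monic ∧ (rad n a k).natDegree = k := by
  have : rad n a k = Polynomial.X^k + ∑ i ∈ Finset.range k, Polynomial.C (gam n a k (i+1)) * Polynomial.X^(k-(i+1)) := by
    rw [rad, Finset.sum_range_succ']; simp [gam]; ring
  have d : (∑ i ∈ Finset.range k, Polynomial.C (gam n a k (i+1)) * Polynomial.X^(k-(i+1))).degree < (k:WithBot ℕ) := by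
    refine (Polynomial.degree_sum_le _ _).trans_lt ((Finset.sup_lt_iff (WithBot.bot_lt_coe k)).2 fun i hi => ?_)
    refine (Polynomial.degree_C_mul_X_pow_le _ _).trans_lt ?_
    have := Finset.mem_range.1 hi
    exact WithBot.coe_lt_coe.2 (by omega : k - (i+1) < k)
  have m := Polynomial.monic_X_pow_add d
  rw [← this] at m
  refine ⟨m, ?_⟩
  rw [this]; exact Polynomial.natDegree_eq_of_degree_eq_some (by
    rw [Polynomial.degree_add_eq_left_of_degree_lt (by simpa using d)]; simp)

def am (m : ℕ × ℕ) : ℕ := (m.1 - m.2) + (m.2 - m.1)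
def km (m : ℕ × ℕ) : ℕ := min m.1 m.2
def kap (m : ℕ × ℕ) : ℂ := if m.2 ≤ m.1 then 1 else -Complex.I
def pol (n : ℕ) (m : ℕ × ℕ) : Po := kap m • eg n (am m) (km m)
def fb (n : ℕ) (m : ℕ × ℕ) (w : ℂ) : ℝ := ev (pol n m) w

lemma pol_eig (hn : 1 ≤ n) (m : ℕ × ℕ) : Lop n (pol n m) = (Lam n m : ℂ) • pol n m := by
  have : Lam n (km m + am m, km m) = Lam n m := by
    obtain ⟨j, k⟩ := m
    simp only [am, km]
    rcases le_total j k with h | h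
    · rw [min_eq_left h, Nat.sub_eq_zero_of_le h, zero_add, Nat.add_sub_cancel' h]; simp only [Lam]; ring
    · rw [min_eq_right h, Nat.sub_eq_zero_of_le h, add_zero, Nat.add_sub_cancel' h]
  rw [pol, map_smul, eg_eig hn, this, smul_comm]

lemma fb_eig (hn : 1 ≤ n) (m w) : ev (Lop n (pol n m)) w = Lam n m * fb n m w := by
  rw [pol_eig hn, ev_smul_real, fb]

/-- product formula -/
lemma fb_int (hn : 1 ≤ n) (m m' : ℕ × ℕ) : ∫ w, fb n m w * fb n m' w ∂(nu n) =
    (kap m * kap m' * ∫ w, mon (am m + am m', 0) w *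
        (((rad n (am m) (km m) * rad n (am m') (km m')).eval (Complex.normSq w) : ℝ):ℂ) ∂(nu n)).re / 2 +
    (kap m * conj (kap m') * ∫ w, mon (am m, am m') w *
        (((rad n (am m) (km m) * rad n (am m') (km m')).eval (Complex.normSq w) : ℝ):ℂ) ∂(nu n)).re / 2 := by
  set R := rad n (am m) (km m) * rad n (am m') (km m')
  have ci : ∀ x, Integrable (fun w => mon x w * ((R.eval (Complex.normSq w) : ℝ):ℂ)) (nu n) := fun x =>
    int_cont ((continuous_mon x).mul (Complex.continuous_ofReal.comp (R.continuous.comp Complex.continuous_normSq)))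
  rw [← integral_const_mul, ← integral_const_mul, ← add_div, ← Complex.add_re,
    ← integral_add ((ci _).const_mul _) ((ci _).const_mul _)]
  rw [← RCLike.re_eq_complex_re, ← integral_re (((ci _).const_mul _).fun_add ((ci _).const_mul _)), ← integral_div]
  congr 1; funext w
  have key : ∀ x y : ℂ, x.re * y.re = (x * y + x * conj y).re / 2 := fun x y => by simp
  simp only [fb, ev, pol, map_smul, cev_eg, smul_eq_mul, RCLike.re_eq_complex_re]
  rw [key]; congr 2
  simp only [R, mon, Polynomial.eval_mul, map_mul, map_pow, Complex.conj_ofReal]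
  push_cast
  ring

lemma fb_orth (hn : 1 ≤ n) {m m' : ℕ × ℕ} (h : m ≠ m') : ∫ w, fb n m w * fb n m' w ∂(nu n) = 0 := by
  by_cases ha : am m = am m'
  · by_cases hk : km m = km m'
    · have hm : am m ≠ 0 := by
        intro h0; apply h; rw [h0] at ha; simp only [am, km] at *
        ext <;> omega
      have hkap : (kap m * conj (kap m')).re = 0 := by
        simp only [kap]
        split_ifs with h1 h2 h2
        · exfalso; apply h; simp only [am, km] at *; ext <;> omega
        · simp
        · simp
        · exfalso; apply h; simp only [am, km] at *; ext <;> omega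
      rw [fb_int hn, mom_poly hn, if_neg (by omega), mom_poly hn, if_pos ha, Complex.re_mul_ofReal, hkap]
      simp
    · have hL : Lam n m ≠ Lam n m' := by
        have e : ∀ m : ℕ × ℕ, Lam n m = Lam n (km m + am m, km m) := fun m => by
          obtain ⟨j, k⟩ := m
          simp only [am, km]
          rcases le_total j k with h | h
          · rw [min_eq_left h, Nat.sub_eq_zero_of_le h, zero_add, Nat.add_sub_cancel' h]; simp only [Lam]; ring
          · rw [min_eq_right h, Nat.sub_eq_zero_of_le h, add_zero, Nat.add_sub_cancel' h]
        rw [e m, e m', ← ha]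
        rcases lt_or_gt_of_ne hk with h | h
        · exact (Lam_lt hn (by omega) h).ne
        · exact (Lam_lt hn (by omega) h).ne'
      have := L_symm hn (pol n m) (pol n m')
      simp only [fb_eig hn, ← fb.eq_1] at this
      have e1 : ∀ w, fb n m w * (Lam n m' * fb n m' w) = Lam n m' * (fb n m w * fb n m' w) := fun w => by ring
      have e2 : ∀ w, fb n m' w * (Lam n m * fb n m w) = Lam n m * (fb n m w * fb n m' w) := fun w => by ring
      simp only [e1, e2, integral_const_mul] at this
      have : (Lam n m - Lam n m') * ∫ w, fb n m w * fb n m' w ∂(nu n) = 0 := by linarith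
      exact (mul_eq_zero.1 this).resolve_left (sub_ne_zero.2 hL)
  · rw [fb_int hn, mom_poly hn, if_neg (by omega), mom_poly hn, if_neg ha]; simp

lemma norm_kap (m) : ‖kap m‖ = 1 := by unfold kap; split_ifs <;> simp

lemma fb_norm (hn : 1 ≤ n) (m : ℕ × ℕ) : 0 < ∫ w, fb n m w ^ 2 ∂(nu n) ∧ ∀ w, ‖w‖ ≤ 1 →
    fb n m w ^ 2 ≤ 4 * (16 * ((m.1 + m.2 : ℕ):ℝ)^2 + 4)^n / (nn n * n) * ∫ w, fb n m w ^ 2 ∂(nu n) := by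
  have hn' : (0:ℝ) < n := by exact_mod_cast hn
  have hnn : 0 < nn n := nu_pos
  set R := rad n (am m) (km m) with hR
  set S : Polynomial ℝ := Polynomial.X^(am m) * (R * R) with hS
  set I := ∫ r in (0:ℝ)..1, S.eval r * (1-r)^(n-1) with hI
  obtain ⟨hmon, hdeg⟩ := rad_monic (n := n) (am m) (km m)
  have hSd : S.degree ≤ ((m.1+m.2:ℕ) : WithBot ℕ) := by
    have : S.natDegree ≤ am m + (km m + km m) := by
      refine Polynomial.natDegree_mul_le.trans ?_
      rw [Polynomial.natDegree_X_pow]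
      have := Polynomial.natDegree_mul_le (p := R) (q := R)
      rw [← hR] at hdeg; rw [hdeg] at this; omega
    have h2 : am m + (km m + km m) = m.1 + m.2 := by simp only [am, km]; omega
    rw [h2] at this
    exact Polynomial.natDegree_le_iff_degree_le.1 this
  have hS0 : ∀ x ∈ Set.Icc (0:ℝ) 1, 0 ≤ S.eval x := fun x hx => by
    simp only [hS, Polynomial.eval_mul, Polynomial.eval_pow, Polynomial.eval_X]
    exact mul_nonneg (pow_nonneg hx.1 _) (mul_self_nonneg _)
  have nik := nikolskii n (m.1+m.2) hn hSd hS0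
  rw [← hI] at nik
  have hI0 : 0 < I := by
    by_contra hcon
    have : ∀ x ∈ Set.Icc (0:ℝ) 1, S.eval x = 0 := fun x hx =>
      le_antisymm ((nik x hx).trans (mul_nonpos_of_nonneg_of_nonpos (by positivity) (not_lt.1 hcon))) (hS0 x hx)
    have hz := Polynomial.eq_zero_of_infinite_isRoot S ((Set.Icc_infinite (zero_lt_one (α := ℝ))).mono this)
    exact ((Polynomial.monic_X_pow _).mul (hmon.mul hmon)).ne_zero hz
  have hint : nn n * (n * I) / 2 ≤ ∫ w, fb n m w ^ 2 ∂(nu n) := by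
    simp only [pow_two]
    rw [fb_int hn, mom_poly hn, mom_poly hn, if_pos rfl, Complex.mul_conj, Complex.normSq_eq_norm_sq, norm_kap]
    rw [← hR, ← hS, ← hI]
    have h2 : (((1:ℝ)^2 : ℝ) : ℂ) * ((nn n * (n * I) : ℝ):ℂ) = ((nn n * (n * I) : ℝ):ℂ) := by push_cast; ring
    rw [h2, Complex.ofReal_re]
    have h3 : 0 ≤ nn n * (n * I) := by positivity
    split_ifs with h0
    · have h4 : am m = 0 := by omega
      have h5 : kap m = 1 := by
        simp only [am, kap] at *; rw [if_pos (by omega)]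
      rw [h4] at hS
      rw [h5, h4]
      simp only [add_zero]
      rw [← hS, ← hI]; simp only [mul_one, one_mul, Complex.ofReal_re]; linarith
    · simp
  refine ⟨lt_of_lt_of_le (by positivity) hint, fun w hw => ?_⟩
  have hx : Complex.normSq w ∈ Set.Icc (0:ℝ) 1 := ⟨Complex.normSq_nonneg _, by
    rw [Complex.normSq_eq_norm_sq]; exact pow_le_one₀ (norm_nonneg _) hw⟩
  have h1 : fb n m w ^ 2 ≤ S.eval (Complex.normSq w) := by
    have : S.eval (Complex.normSq w) = ‖cev w (pol n m)‖^2 := by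
      rw [pol, map_smul, norm_smul, norm_kap, one_mul, cev_eg, norm_mul, norm_pow, mul_pow, Complex.norm_real,
        Real.norm_eq_abs, sq_abs, ← pow_mul, mul_comm (am m) 2, pow_mul, ← Complex.normSq_eq_norm_sq]
      rw [← hR]; simp only [hS, Polynomial.eval_mul, Polynomial.eval_pow, Polynomial.eval_X]; ring
    rw [this, fb, ev, ← sq_abs]
    gcongr; exact Complex.abs_re_le_norm _
  calc fb n m w ^ 2 ≤ 2 * (16 * ((m.1 + m.2 : ℕ):ℝ)^2 + 4)^n * I := h1.trans (nik _ hx)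
    _ = 4 * (16 * ((m.1 + m.2 : ℕ):ℝ)^2 + 4)^n / (nn n * n) * (nn n * (n * I) / 2) := by field_simp; ring
    _ ≤ _ := by gcongr
lemma exists_diag {ι E : Type*} [NormedAddCommGroup E] [InnerProductSpace ℝ E] (b : HilbertBasis ι ℝ E)
    (a : ι → ℝ) (C : ℝ) (hC : ∀ i, |a i| ≤ C) :
    ∃ T : E →L[ℝ] E, ∀ x i, inner ℝ (b i) (T x) = a i * inner ℝ (b i) x := by
  have hb : ∀ (f : lp (fun _ : ι => ℝ) 2) i, ‖a i * f i‖ ≤ ‖(C • f : lp (fun _ : ι => ℝ) 2) i‖ := fun f i => by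
    rw [lp.coeFn_smul, Pi.smul_apply, smul_eq_mul, norm_mul, norm_mul]
    exact mul_le_mul_of_nonneg_right ((hC i).trans (le_abs_self C)) (norm_nonneg _)
  let M : lp (fun _ : ι => ℝ) 2 →ₗ[ℝ] lp (fun _ : ι => ℝ) 2 :=
    { toFun := fun f => ⟨fun i => a i * f i, (lp.memℓp (C • f)).mono' (hb f)⟩
      map_add' := fun f g => by ext i; simp [mul_add]; rfl
      map_smul' := fun r f => by ext i; simp; ring }
  let M' := M.mkContinuous |C| (fun f => by
    rw [← Real.norm_eq_abs, ← norm_smul]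
    exact lp.norm_mono (by norm_num) (hb f))
  refine ⟨(b.repr.symm.toContinuousLinearEquiv : _ →L[ℝ] E) ∘L M' ∘L (b.repr.toContinuousLinearEquiv : E →L[ℝ] _), fun x i => ?_⟩
  rw [← b.repr_apply_apply, ← b.repr_apply_apply]
  simp [M', M]

abbrev H (n : ℕ) := Lp ℝ 2 (nu n)

lemma inn (f g : H n) : inner ℝ f g = ∫ w, f w * g w ∂(nu n) := by
  rw [L2.inner_def]; congr 1; funext w; simp [mul_comm]

lemma memLp_bd {f : ℂ → ℝ} (hf : AEStronglyMeasurable f (nu n)) {C : ℝ} (hC : ∀ᵐ w ∂(nu n), |f w| ≤ C) : MemLp f 2 (nu n) :=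
  MemLp.of_bound hf C hC

lemma memLp_cont {f : ℂ → ℝ} (hf : Continuous f) : MemLp f 2 (nu n) := by
  obtain ⟨C, hC⟩ := (isCompact_closedBall (0:ℂ) 1).exists_bound_of_continuousOn hf.continuousOn
  exact memLp_bd hf.aestronglyMeasurable (nu_disc.mono fun w hw => hC w (by simpa using hw))

/-- sup constant -/
def Sn (n : ℕ) : ℝ := Real.sqrt (nn n)
lemma Sn_pos : 0 < Sn n := Real.sqrt_pos.2 nu_pos
lemma norm_bd {f : H n} {c : ℝ} (hc : 0 ≤ c) (h : ∀ᵐ w ∂(nu n), |f w| ≤ c) : ‖f‖ ≤ Sn n * c := by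
  have h1 : ‖f‖^2 ≤ (Sn n * c)^2 := by
    rw [← real_inner_self_eq_norm_sq, inn, mul_pow, Sn, Real.sq_sqrt (show 0 ≤ nn n from nu_pos.le)]
    have : ∫ w, f w * f w ∂(nu n) ≤ ∫ w, c^2 ∂(nu n) := by
      refine integral_mono_ae ?_ (integrable_const _) (h.mono fun w hw => ?_)
      · simpa only [pow_two] using (Lp.memLp f).integrable_sq
      · simp only; rw [← pow_two, ← sq_abs]; gcongr
    simpa [nn] using this
  exact abs_le_of_sq_le_sq' h1 (mul_nonneg Sn_pos.le hc) |>.2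

def evL (n : ℕ) : Po →ₗ[ℝ] H n where
  toFun P := (memLp_cont (continuous_ev P)).toLp (ev P)
  map_add' P Q := by
    rw [← MemLp.toLp_add]; congr 1; funext w; simp
  map_smul' r P := by
    simp only [RingHom.id_apply]
    rw [← MemLp.toLp_const_smul]; congr 1; funext w
    simp [ev]
lemma evL_ae (P : Po) : evL n P =ᵐ[nu n] ev P := MemLp.coeFn_toLp (memLp_cont (continuous_ev P))
lemma inn_evL (P Q : Po) : inner ℝ (evL n P) (evL n Q) = ∫ w, ev P w * ev Q w ∂(nu n) := by
  rw [inn]; refine integral_congr_ae ?_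
  filter_upwards [evL_ae P, evL_ae Q] with w h1 h2; rw [h1, h2]

/-! ### density of polynomials -/
lemma cev_mul (P Q : Po) : ∃ R : Po, ∀ w, cev w R = cev w P * cev w Q := by
  induction P using Finsupp.induction_linear with
  | zero => exact ⟨0, by simp⟩
  | add P P' h h' =>
    obtain ⟨R, hR⟩ := h; obtain ⟨R', hR'⟩ := h'
    exact ⟨R + R', fun w => by simp [hR, hR', add_mul]⟩
  | single m κ =>
    induction Q using Finsupp.induction_linear with
    | zero => exact ⟨0, by simp⟩
    | add P P' h h' =>
      obtain ⟨R, hR⟩ := h; obtain ⟨R', hR'⟩ := h'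
      exact ⟨R + R', fun w => by simp only [map_add, hR, hR', mul_add]⟩
    | single m' κ' => exact ⟨Finsupp.single (m + m') (κ * κ'), fun w => by simp only [cev_single, mon, Prod.fst_add, Prod.snd_add, pow_add]; ring⟩

lemma cev_conj (P : Po) : ∃ R : Po, ∀ w, cev w R = conj (cev w P) := by
  induction P using Finsupp.induction_linear with
  | zero => exact ⟨0, by simp⟩
  | add P P' h h' =>
    obtain ⟨R, hR⟩ := h; obtain ⟨R', hR'⟩ := h'
    exact ⟨R + R', fun w => by simp [hR, hR']⟩
  | single m κ => exact ⟨Finsupp.single (m.2, m.1) (conj κ), fun w => by simp only [cev_single, mon, map_mul, map_pow, Complex.conj_conj]; ring⟩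

lemma poly_approx {g : ℂ → ℝ} (hg : Continuous g) {ε : ℝ} (hε : 0 < ε) :
    ∃ P : Po, ∀ w : ℂ, ‖w‖ ≤ 1 → |ev P w - g w| ≤ ε := by
  let X := Metric.closedBall (0:ℂ) 1
  haveI : CompactSpace X := isCompact_iff_compactSpace.1 (isCompact_closedBall 0 1)
  let S : StarSubalgebra ℂ C(X, ℂ) :=
    { carrier := {f | ∃ P : Po, ∀ w : X, f w = cev (w:ℂ) P}
      mul_mem' := by
        rintro f g ⟨P, hP⟩ ⟨Q, hQ⟩
        obtain ⟨R, hR⟩ := cev_mul P Q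
        exact ⟨R, fun w => by simp [hP, hQ, hR]⟩
      add_mem' := by
        rintro f g ⟨P, hP⟩ ⟨Q, hQ⟩
        exact ⟨P + Q, fun w => by simp [hP, hQ]⟩
      algebraMap_mem' := fun r => ⟨Finsupp.single (0,0) r, fun w => by simp [mon]⟩
      star_mem' := by
        rintro f ⟨P, hP⟩
        obtain ⟨R, hR⟩ := cev_conj P
        exact ⟨R, fun w => by simp [hP, hR]⟩ }
  have hS : S.SeparatesPoints := by
    intro x y hxy
    refine ⟨_, ⟨⟨fun w : X => (w:ℂ), continuous_subtype_val⟩, ⟨Finsupp.single (1,0) 1, fun w => ?_⟩, rfl⟩, ?_⟩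
    · simp [mon]
    · simpa [Subtype.ext_iff] using hxy
  have hd := ContinuousMap.starSubalgebra_topologicalClosure_eq_top_of_separatesPoints S hS
  let G : C(X, ℂ) := ⟨fun w => (g w : ℂ), by fun_prop⟩
  have hG : G ∈ S.topologicalClosure := by rw [hd]; trivial
  have hG' : G ∈ closure (S : Set C(X,ℂ)) := hG
  obtain ⟨f, ⟨P, hP⟩, hf⟩ := Metric.mem_closure_iff.1 hG' ε hε
  refine ⟨P, fun w hw => ?_⟩
  have h1 := (ContinuousMap.dist_apply_le_dist (f := G) (g := f) ⟨w, by simpa [X] using hw⟩).trans hf.le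
  rw [hP, dist_comm, dist_eq_norm] at h1
  refine le_trans ?_ h1
  have h2 := Complex.abs_re_le_norm (cev w P - (g w : ℂ))
  simpa [ev, G] using h2

/-- approximation with sup bound -/
lemma approx_bd (h : H n) {c : ℝ} (hc : 0 ≤ c) (hb : ∀ᵐ w ∂(nu n), |h w| ≤ c) {ε : ℝ} (hε : 0 < ε) :
    ∃ P : Po, (∀ w, ‖w‖ ≤ 1 → |ev P w| ≤ c + ε) ∧ ‖evL n P - h‖ ≤ ε := by
  have hS := Sn_pos (n := n)
  obtain ⟨g, hg, gm⟩ := (Lp.memLp h).exists_boundedContinuous_eLpNorm_sub_le (by norm_num) (ε := ENNReal.ofReal (ε/2)) (by simp [hε])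
  set g' : ℂ → ℝ := fun w => max (-c) (min c (g w)) with hg'
  have cg : Continuous g' := by have := g.continuous; fun_prop
  have cgb : ∀ w, |g' w| ≤ c := fun w => abs_le.2 ⟨le_max_left _ _, max_le (by linarith) (min_le_left _ _)⟩
  obtain ⟨P, hP⟩ := poly_approx cg (ε := min ε (ε/(2*Sn n))) (by positivity)
  refine ⟨P, fun w hw => ?_, ?_⟩
  · have h1 := (hP w hw).trans (min_le_left _ _)
    have h2 := cgb w
    rw [abs_le] at *; constructor <;> linarith
  · have e1 : ‖evL n P - (memLp_cont cg).toLp g'‖ ≤ Sn n * (ε/(2*Sn n)) := by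
      refine norm_bd (by positivity) ?_
      filter_upwards [Lp.coeFn_sub (evL n P) ((memLp_cont cg).toLp g'), evL_ae (n := n) P, (memLp_cont cg).coeFn_toLp, nu_disc] with w a1 a2 a3 a4
      rw [a1, Pi.sub_apply, a2, a3]; exact (hP w a4).trans (min_le_right _ _)
    have e2 : ‖(memLp_cont cg).toLp g' - h‖ ≤ ε/2 := by
      have : ‖(memLp_cont cg).toLp g' - h‖ ≤ ‖h - gm.toLp g‖ := by
        refine Lp.norm_le_norm_of_ae_le ?_
        filter_upwards [Lp.coeFn_sub ((memLp_cont cg).toLp g') h, Lp.coeFn_sub h (gm.toLp g), (memLp_cont cg).coeFn_toLp, gm.coeFn_toLp, hb] with w a1 a2 a3 a4 a5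
        rw [a1, a2, Pi.sub_apply, Pi.sub_apply, a3, a4, Real.norm_eq_abs, Real.norm_eq_abs]
        rw [abs_le] at a5
        simp only [hg']
        rw [abs_le]; have := neg_abs_le (h w - g w); have := le_abs_self (h w - g w)
        constructor
        · rcases max_cases (-c) (min c (g w)) with m | m <;> rcases min_cases c (g w) with m' | m' <;> linarith
        · rcases max_cases (-c) (min c (g w)) with m | m <;> rcases min_cases c (g w) with m' | m' <;> linarith
      refine this.trans ?_
      rw [Lp.norm_def]
      refine ENNReal.toReal_le_of_le_ofReal (by positivity) (le_trans (le_of_eq ?_) hg)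
      refine eLpNorm_congr_ae ?_
      filter_upwards [Lp.coeFn_sub h (gm.toLp g), gm.coeFn_toLp] with w a1 a2
      rw [a1, Pi.sub_apply, Pi.sub_apply, a2]
    have e3 : Sn n * (ε/(2*Sn n)) = ε/2 := by field_simp
    calc _ ≤ ‖evL n P - (memLp_cont cg).toLp g'‖ + ‖(memLp_cont cg).toLp g' - h‖ := norm_sub_le_norm_sub_add_norm_sub _ _ _
      _ ≤ ε := by linarith

lemma evL_dense : Dense (Set.range (evL n)) := by
  intro h
  rw [Metric.mem_closure_iff]
  intro ε hε
  obtain ⟨g, hg, gm⟩ := (Lp.memLp h).exists_boundedContinuous_eLpNorm_sub_le (by norm_num) (ε := ENNReal.ofReal (ε/3)) (by simp [hε])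
  have h0 : ‖h - gm.toLp g‖ ≤ ε/3 := by
    rw [Lp.norm_def]
    refine ENNReal.toReal_le_of_le_ofReal (by positivity) (le_trans (le_of_eq ?_) hg)
    refine eLpNorm_congr_ae ?_
    filter_upwards [Lp.coeFn_sub h (gm.toLp g), gm.coeFn_toLp] with w a1 a2
    rw [a1, Pi.sub_apply, Pi.sub_apply, a2]
  obtain ⟨P, -, hP⟩ := approx_bd (gm.toLp g) (c := ‖g‖) (norm_nonneg _) (gm.coeFn_toLp.mono fun w hw => by
    rw [hw, ← Real.norm_eq_abs]; exact g.norm_coe_le_norm w) (ε := ε/3) (by positivity)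
  refine ⟨_, ⟨P, rfl⟩, ?_⟩
  rw [dist_eq_norm]
  calc _ ≤ ‖h - gm.toLp g‖ + ‖gm.toLp g - evL n P‖ := norm_sub_le_norm_sub_add_norm_sub _ _ _
    _ < ε := by rw [norm_sub_rev (gm.toLp g)]; linarith
def fN (n : ℕ) (m : ℕ × ℕ) : ℝ := Real.sqrt (∫ w, fb n m w ^ 2 ∂(nu n))
lemma fN_pos (hn : 1 ≤ n) (m) : 0 < fN n m := Real.sqrt_pos.2 (fb_norm hn m).1
def eb (n : ℕ) (m : ℕ × ℕ) : H n := (fN n m)⁻¹ • evL n (pol n m)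

lemma eb_orth (hn : 1 ≤ n) : Orthonormal ℝ (eb n) := by
  rw [orthonormal_iff_ite]
  intro m m'
  rw [eb, eb, real_inner_smul_left, real_inner_smul_right, inn_evL]
  split_ifs with h
  · subst h
    have h1 : ∫ w, ev (pol n m) w * ev (pol n m) w ∂(nu n) = fN n m ^ 2 := by
      rw [fN, Real.sq_sqrt (fb_norm hn m).1.le]; simp only [pow_two, fb]
    have := fN_pos hn m
    rw [h1]; field_simp
  · have : ∫ w, ev (pol n m) w * ev (pol n m') w ∂(nu n) = 0 := fb_orth hn h
    rw [this]; simp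

lemma pol_mem (hn : 1 ≤ n) (m) : evL n (pol n m) ∈ Submodule.span ℝ (Set.range (eb n)) := by
  have : evL n (pol n m) = fN n m • eb n m := by rw [eb, smul_smul, mul_inv_cancel₀ (fN_pos hn m).ne', one_smul]
  rw [this]; exact Submodule.smul_mem _ _ (Submodule.subset_span ⟨m, rfl⟩)

lemma evL_ext {P Q : Po} (h : ∀ w, ev P w = ev Q w) : evL n P = evL n Q := by
  refine Lp.ext ?_
  filter_upwards [evL_ae (n := n) P, evL_ae (n := n) Q] with w a b; rw [a, b, h]

lemma eg_mem (hn : 1 ≤ n) (a k : ℕ) (z : ℂ) : evL n (z • eg n a k) ∈ Submodule.span ℝ (Set.range (eb n)) := by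
  have h1 : pol n (k+a,k) = eg n a k := by simp [pol, kap, am, km]
  have h2 : evL n (-Complex.I • eg n a k) ∈ Submodule.span ℝ (Set.range (eb n)) := by
    rcases Nat.eq_zero_or_pos a with h | h
    · subst h
      have : evL n (-Complex.I • eg n 0 k) = evL n 0 := evL_ext fun w => by
        rw [ev, map_smul, cev_eg]; simp
      rw [this, map_zero]; exact Submodule.zero_mem _
    · have : pol n (k,k+a) = -Complex.I • eg n a k := by simp [pol, kap, am, km, h.ne']
      rw [← this]; exact pol_mem hn _
  have : z • eg n a k = z.re • eg n a k + (-z.im) • (-Complex.I • eg n a k) := by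
    conv_lhs => rw [← Complex.re_add_im z]
    rw [add_smul, mul_smul, neg_smul, neg_smul, smul_neg, neg_neg]
    congr 1
  rw [this, map_add, map_smul, map_smul]
  exact Submodule.add_mem _ (Submodule.smul_mem _ _ (h1 ▸ pol_mem hn _)) (Submodule.smul_mem _ _ h2)

lemma single_mem (hn : 1 ≤ n) (a k : ℕ) : ∀ z : ℂ, evL n (Finsupp.single (k+a,k) z) ∈ Submodule.span ℝ (Set.range (eb n)) := by
  induction k using Nat.strong_induction_on with
  | _ k ih =>
    intro z
    have h : z • eg n a k = Finsupp.single (k+a,k) z +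
        ∑ i ∈ Finset.range k, Finsupp.single ((k-(i+1))+a,k-(i+1)) (z * gam n a k (i+1)) := by
      rw [eg, Finset.sum_range_succ', smul_add, Finset.smul_sum, add_comm]
      congr 1
      · simp [gam]
      · refine Finset.sum_congr rfl fun i hi => ?_
        rw [Finsupp.smul_single, smul_eq_mul]
        have := Finset.mem_range.1 hi
        rw [show k + a - (i+1) = k - (i+1) + a by omega]
    have e : Finsupp.single (k+a,k) z = z • eg n a k -
        ∑ i ∈ Finset.range k, Finsupp.single ((k-(i+1))+a,k-(i+1)) (z * gam n a k (i+1)) := by rw [h]; simp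
    rw [e, map_sub, map_sum]
    refine Submodule.sub_mem _ (eg_mem hn a k z) (Submodule.sum_mem _ fun i hi => ih _ ?_ _)
    have := Finset.mem_range.1 hi
    omega

lemma evL_mem (hn : 1 ≤ n) (P : Po) : evL n P ∈ Submodule.span ℝ (Set.range (eb n)) := by
  induction P using Finsupp.induction_linear with
  | zero => simp
  | add P Q h h' => rw [map_add]; exact Submodule.add_mem _ h h'
  | single m z =>
    obtain ⟨j, k⟩ := m
    rcases le_total k j with h | h
    · have := single_mem hn (j-k) k z
      rwa [Nat.add_sub_cancel' h] at this
    · have h1 := single_mem hn (k-j) j (conj z)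
      rw [Nat.add_sub_cancel' h] at h1
      have : evL n (Finsupp.single (j,k) z) = evL n (Finsupp.single (k,j) (conj z)) := evL_ext fun w => by
        simp only [ev, cev_single, mon]
        rw [← Complex.conj_re]; congr 1; simp only [map_mul, map_pow, Complex.conj_conj]; ring
      rwa [this]

def hb (hn : 1 ≤ n) : HilbertBasis (ℕ × ℕ) ℝ (H n) := HilbertBasis.mk (eb_orth hn) (by
  intro x _
  have : closure (Set.range (evL n)) ⊆ closure (Submodule.span ℝ (Set.range (eb n)) : Set (H n)) :=
    closure_mono (by rintro _ ⟨P, rfl⟩; exact evL_mem hn P)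
  exact this (evL_dense x))
lemma hb_eq (hn : 1 ≤ n) (m) : hb hn m = eb n m := congrFun (HilbertBasis.coe_mk _ _) m

lemma hb_ext (hn : 1 ≤ n) {x y : H n} (h : ∀ m, inner ℝ (eb n m) x = inner ℝ (eb n m) y) : x = y := by
  apply (hb hn).repr.injective
  ext m
  rw [HilbertBasis.repr_apply_apply, HilbertBasis.repr_apply_apply, hb_eq, h]

lemma hb_inner (hn : 1 ≤ n) (x y : H n) : HasSum (fun m => inner ℝ (eb n m) x * inner ℝ (eb n m) y) (inner ℝ x y) := by
  have := (hb hn).hasSum_inner_mul_inner x y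
  simp only [hb_eq] at this
  simpa only [real_inner_comm] using this

def th (n : ℕ) : ℝ := n / (n+2)
def rc (n : ℕ) (m : ℕ × ℕ) : ℝ := if m = (1,0) ∨ m = (0,1) then 0 else ((Lam n m)⁻¹ - th n)⁻¹
def pc (m : ℕ × ℕ) : ℝ := if m = (1,0) ∨ m = (0,1) then 1 else 0

lemma Lam_ge (hn : 1 ≤ n) (m) : (2 * ((m.1+m.2:ℕ):ℝ) + n) / n ≤ Lam n m := by
  have hn' : (0:ℝ) < n := by exact_mod_cast hn
  rw [Lam, div_le_div_iff₀ hn' (by positivity)]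
  push_cast
  have : (0:ℝ) ≤ (m.1:ℝ) * m.2 * n := by positivity
  nlinarith
lemma Lam_one (hn : 1 ≤ n) (m) : 1 ≤ Lam n m := by
  have hn' : (0:ℝ) < n := by exact_mod_cast hn
  refine le_trans ?_ (Lam_ge hn m)
  rw [le_div_iff₀ hn']; have : (0:ℝ) ≤ ((m.1+m.2:ℕ):ℝ) := by positivity
  linarith
lemma Lam_N (hn : 1 ≤ n) {m} (h : m = (1,0) ∨ m = (0,1)) : (Lam n m)⁻¹ = th n := by
  have hn' : (0:ℝ) < n := by exact_mod_cast hn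
  rcases h with rfl | rfl <;> simp [Lam, th] <;> field_simp <;> ring

lemma th_pos (hn : 1 ≤ n) : 0 < th n := by have : (0:ℝ) < n := by exact_mod_cast hn
                                           unfold th; positivity
lemma th_lt : th n < 1 := by unfold th; rw [div_lt_one (by positivity)]; linarith

lemma rc_bd (hn : 1 ≤ n) : ∃ C : ℝ, ∀ m, |rc n m| ≤ C := by
  have hn' : (1:ℝ) ≤ n := by exact_mod_cast hn
  refine ⟨n^2+5*n+6, fun m => ?_⟩
  unfold rc
  split_ifs with h
  · simp; positivity
  rw [abs_inv]
  refine inv_le_of_inv_le₀ (by positivity) ?_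
  by_cases h0 : m = (0,0)
  · subst h0
    have : (Lam n (0,0))⁻¹ - th n = 2/(n+2) := by simp [Lam, th]; field_simp; ring
    rw [this, abs_of_pos (by positivity), inv_le_comm₀ (by positivity) (by positivity), inv_div, div_le_iff₀ (by norm_num)]; nlinarith
  · have h2 : (2:ℝ) ≤ ((m.1+m.2:ℕ):ℝ) := by
      obtain ⟨j, k⟩ := m
      simp only [Prod.mk.injEq] at h h0
      exact_mod_cast (by omega : 2 ≤ j + k)
    have h3 := Lam_ge hn m
    have h4 : (n+4:ℝ)/n ≤ Lam n m := le_trans (div_le_div_of_nonneg_right (by linarith) (by positivity)) h3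
    have h5 : (Lam n m)⁻¹ ≤ n/(n+4) := by
      rw [← inv_div]; exact inv_anti₀ (by positivity) h4
    have h6 : th n - n/(n+4) = 2*n/((n+2)*(n+4)) := by unfold th; field_simp; ring
    have h7 : (n^2+5*n+6:ℝ)⁻¹ ≤ 2*n/((n+2)*(n+4)) := by
      rw [inv_le_comm₀ (by positivity) (by positivity), inv_div, div_le_iff₀ (by positivity)]; nlinarith [mul_nonneg (show (0:ℝ) ≤ n by linarith) (show (0:ℝ) ≤ n by linarith), mul_nonneg (mul_nonneg (show (0:ℝ) ≤ n by linarith) (show (0:ℝ) ≤ n by linarith)) (show (0:ℝ) ≤ n by linarith)]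
    rw [abs_sub_comm]
    exact le_trans (by linarith) (le_abs_self _)

lemma Ac_bd (hn : 1 ≤ n) (m) : |(Lam n m)⁻¹| ≤ 1 := by
  have := Lam_one hn m
  rw [abs_of_nonneg (by positivity)]; exact inv_le_one_of_one_le₀ this

def A (hn : 1 ≤ n) : H n →L[ℝ] H n := (exists_diag (hb hn) (fun m => (Lam n m)⁻¹) 1 (Ac_bd hn)).choose
def R (hn : 1 ≤ n) : H n →L[ℝ] H n := (exists_diag (hb hn) (rc n) _ (rc_bd hn).choose_spec).choose
lemma pc_bd (m) : |pc m| ≤ 1 := by unfold pc; split_ifs <;> simp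
def Pn (hn : 1 ≤ n) : H n →L[ℝ] H n := (exists_diag (hb hn) pc 1 pc_bd).choose
lemma A_c (hn : 1 ≤ n) (x m) : inner ℝ (eb n m) (A hn x) = (Lam n m)⁻¹ * inner ℝ (eb n m) x := by
  rw [← hb_eq hn]; exact (exists_diag (hb hn) _ 1 (Ac_bd hn)).choose_spec x m
lemma R_c (hn : 1 ≤ n) (x m) : inner ℝ (eb n m) (R hn x) = rc n m * inner ℝ (eb n m) x := by
  rw [← hb_eq hn]; exact (exists_diag (hb hn) _ _ (rc_bd hn).choose_spec).choose_spec x m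
lemma Pn_c (hn : 1 ≤ n) (x m) : inner ℝ (eb n m) (Pn hn x) = pc m * inner ℝ (eb n m) x := by
  rw [← hb_eq hn]; exact (exists_diag (hb hn) pc 1 pc_bd).choose_spec x m

lemma A_sym (hn : 1 ≤ n) (x y) : inner ℝ (A hn x) y = inner ℝ x (A hn y) := by
  refine (hb_inner hn _ _).unique ?_
  have := hb_inner hn x (A hn y)
  simp only [A_c] at this ⊢
  convert this using 2; ring
lemma Pn_sym (hn : 1 ≤ n) (x y) : inner ℝ (Pn hn x) y = inner ℝ x (Pn hn y) := by
  refine (hb_inner hn _ _).unique ?_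
  have := hb_inner hn x (Pn hn y)
  simp only [Pn_c] at this ⊢
  convert this using 2; ring

lemma rc_rel (hn : 1 ≤ n) (m) : ((Lam n m)⁻¹ - th n) * rc n m = 1 - pc m := by
  unfold rc pc
  split_ifs with h
  · simp
  · rw [mul_inv_cancel₀, sub_zero]
    intro h0
    have hn' : (0:ℝ) < n := by exact_mod_cast hn
    apply h
    have h1 : Lam n m = (n+2)/n := by
      have := sub_eq_zero.1 h0
      rw [← inv_inv (Lam n m), this, th, inv_div]
    have h2 := Lam_ge hn m
    rw [h1, div_le_div_iff_of_pos_right hn'] at h2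
    have h3 : m.1 + m.2 ≤ 1 := by
      have : ((m.1+m.2:ℕ):ℝ) ≤ 1 := by linarith
      exact_mod_cast this
    obtain ⟨j, k⟩ := m
    simp only at h3
    simp only [Prod.mk.injEq]
    by_contra hcon
    have : j = 0 ∧ k = 0 := by omega
    rw [this.1, this.2] at h1
    simp only [Lam] at h1; field_simp at h1; norm_num at h1; nlinarith

lemma A_R (hn : 1 ≤ n) (x) : A hn (R hn x) - th n • R hn x = x - Pn hn x := hb_ext hn fun m => by
  rw [inner_sub_right, inner_sub_right, real_inner_smul_right, A_c, R_c, Pn_c]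
  linear_combination (inner ℝ (eb n m) x) * rc_rel hn m
lemma R_A (hn : 1 ≤ n) (x) : R hn (A hn x - th n • x) = x - Pn hn x := hb_ext hn fun m => by
  rw [R_c, inner_sub_right, inner_sub_right, real_inner_smul_right, A_c, Pn_c]
  linear_combination (inner ℝ (eb n m) x) * rc_rel hn m
lemma R_P (hn : 1 ≤ n) (x) : R hn (Pn hn x) = 0 := hb_ext hn fun m => by
  rw [R_c, Pn_c, inner_zero_right]; unfold rc pc; split_ifs <;> simp
lemma P_R (hn : 1 ≤ n) (x) : Pn hn (R hn x) = 0 := hb_ext hn fun m => by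
  rw [Pn_c, R_c, inner_zero_right]; unfold rc pc; split_ifs <;> simp
lemma P_P (hn : 1 ≤ n) (x) : Pn hn (Pn hn x) = Pn hn x := hb_ext hn fun m => by
  rw [Pn_c, Pn_c]; unfold pc; split_ifs <;> simp
lemma A_P (hn : 1 ≤ n) (x) : A hn (Pn hn x) = th n • Pn hn x := hb_ext hn fun m => by
  rw [A_c, real_inner_smul_right, Pn_c]; unfold pc; split_ifs with h
  · rw [Lam_N hn h]
  · simp

lemma inn_Lop (hn : 1 ≤ n) (P : Po) (m) : inner ℝ (eb n m) (evL n (Lop n P)) = Lam n m * inner ℝ (eb n m) (evL n P) := by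
  rw [eb, real_inner_smul_left, real_inner_smul_left, inn_evL, inn_evL, L_symm hn]
  simp only [fb_eig hn]
  have : ∀ w, ev P w * (Lam n m * fb n m w) = Lam n m * (ev (pol n m) w * ev P w) := fun w => by rw [fb]; ring
  simp only [this, integral_const_mul]; ring
lemma A_Lop (hn : 1 ≤ n) (P : Po) : A hn (evL n (Lop n P)) = evL n P := hb_ext hn fun m => by
  have := Lam_one hn m
  rw [A_c, inn_Lop hn, ← mul_assoc, inv_mul_cancel₀ (by positivity), one_mul]
def dW : Po →ₗ[ℂ] Po := Finsupp.linearCombination ℂ (fun m => Finsupp.single (m.1-1, m.2) (m.1 : ℂ))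
def dB : Po →ₗ[ℂ] Po := Finsupp.linearCombination ℂ (fun m => Finsupp.single (m.1, m.2-1) (m.2 : ℂ))
@[simp] lemma dW_single (m κ) : dW (Finsupp.single m κ) = Finsupp.single (m.1-1, m.2) (κ * m.1) := by simp [dW]
@[simp] lemma dB_single (m κ) : dB (Finsupp.single m κ) = Finsupp.single (m.1, m.2-1) (κ * m.2) := by simp [dB]
def dD (ζ : ℂ) (P : Po) : Po := ζ • dW P + conj ζ • dB P

lemma cev_deriv (P : Po) (w ζ : ℂ) (t : ℝ) :
    HasDerivAt (fun s : ℝ => cev (w + s * ζ) P) (cev (w + t * ζ) (dD ζ P)) t := by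
  induction P using Finsupp.induction_linear with
  | zero => simpa [dD] using hasDerivAt_const t (0:ℂ)
  | add P Q h h' => 
    have := h.fun_add h'
    simp only [dD, map_add, smul_add, map_smul] at this ⊢
    refine this.congr_deriv ?_; simp only [smul_eq_mul]; ring
  | single m κ =>
    have h1 : HasDerivAt (fun s : ℝ => w + s * ζ) ζ t := by
      simpa using ((Complex.ofRealCLM.hasDerivAt (x := t)).mul_const ζ).const_add w
    have h2 : HasDerivAt (fun s : ℝ => conj w + s * conj ζ) (conj ζ) t := by
      simpa using ((Complex.ofRealCLM.hasDerivAt (x := t)).mul_const (conj ζ)).const_add (conj w)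
    have h3 := (((h1.fun_pow m.1).fun_mul (h2.fun_pow m.2)).const_mul κ)
    have e : ∀ s : ℝ, conj (w + s * ζ) = conj w + s * conj ζ := fun s => by simp
    simp only [cev_single, mon, dD, dW_single, dB_single, map_add, map_smul, smul_eq_mul, e]
    refine h3.congr_deriv ?_
    ring

lemma ev_deriv (P : Po) (w ζ : ℂ) (t : ℝ) :
    HasDerivAt (fun s : ℝ => ev P (w + s * ζ)) (ev (dD ζ P) (w + t * ζ)) t := by
  have := (Complex.reCLM.hasFDerivAt (x := cev (w + t * ζ) P)).comp_hasDerivAt t (cev_deriv P w ζ t)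
  exact this

lemma cev_lap (P : Po) (w : ℂ) : cev w (dD 1 (dD 1 P)) + cev w (dD Complex.I (dD Complex.I P)) = 4 * cev w (dW (dB P)) := by
  have e : dB (dW P) = dW (dB P) := by
    induction P using Finsupp.induction_linear with
    | zero => simp
    | add P Q h h' => simp only [map_add, h, h']
    | single m κ => simp only [dW_single, dB_single]; congr 1; ring
  simp only [dD, map_add, map_smul, smul_eq_mul, e, map_one, Complex.conj_I, one_smul, one_mul]
  linear_combination (cev w (dW (dW P)) + cev w (dB (dB P)) - 2 * cev w (dW (dB P))) * Complex.I_sq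

lemma cev_Lop (hn : 1 ≤ n) (P : Po) (w : ℂ) : cev w (Lop n P) = cev w P + (2/n) * cev w (dD w P) -
    (4/n^2) * ((1 - Complex.normSq w : ℝ):ℂ) * cev w (dW (dB P)) := by
  have hn' : (n:ℂ) ≠ 0 := by exact_mod_cast (by omega : n ≠ 0)
  induction P using Finsupp.induction_linear with
  | zero => simp [dD]
  | add P Q h h' => 
    simp only [dD, map_add, smul_add, map_smul, h, h'] at *; ring
  | single m κ =>
    obtain ⟨j, k⟩ := m
    rw [Lop_single]
    simp only [dD, dW_single, dB_single, map_add, map_smul, map_sub, cev_single, mon, Lam, smul_eq_mul]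
    push_cast
    rw [Complex.normSq_eq_conj_mul_self]
    rcases j with _ | j <;> rcases k with _ | k <;> simp only [Nat.add_sub_cancel, pow_succ] <;> push_cast <;> field_simp <;> ring

lemma lap_nonpos {P : Po} {w : ℂ} (hw : ‖w‖ < 1) (hmax : ∀ v, ‖v‖ ≤ 1 → ev P v ≤ ev P w) (ζ : ℂ) :
    ev (dD ζ (dD ζ P)) w ≤ 0 := by
  by_contra hcon
  rw [not_le] at hcon
  set f : ℝ → ℝ := fun s => ev P (w + s * ζ) with hf
  have hd : ∀ t : ℝ, HasDerivAt f (ev (dD ζ P) (w + t * ζ)) t := ev_deriv P w ζ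
  have hde : deriv f = fun t : ℝ => ev (dD ζ P) (w + t * ζ) := funext fun t => (hd t).deriv
  have hdd : HasDerivAt (deriv f) (ev (dD ζ (dD ζ P)) w) 0 := by
    rw [hde]; simpa using ev_deriv (dD ζ P) w ζ 0
  have hm : IsLocalMax f 0 := by
    have hc : Continuous (fun s : ℝ => ‖w + s * ζ‖) := by fun_prop
    have : ∀ᶠ s : ℝ in 𝓝 (0:ℝ), ‖w + s * ζ‖ < 1 := hc.continuousAt.eventually (gt_mem_nhds (by simpa using hw))
    refine this.mono fun s hs => ?_
    simpa [hf] using hmax _ hs.le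
  have h0 := hm.deriv_eq_zero
  have hmin := isLocalMin_of_deriv_deriv_pos (f := f) (x₀ := 0) (by rw [hdd.deriv]; exact hcon) h0 (hd 0).continuousAt
  have hconst : f =ᶠ[𝓝 0] fun _ => f 0 := by
    filter_upwards [hm, hmin] with s a b using le_antisymm a b
  have h1 : deriv f =ᶠ[𝓝 0] fun _ => 0 := by
    filter_upwards [hconst.eventuallyEq_nhds] with s hs
    rw [hs.deriv_eq]; simp
  have := h1.deriv_eq
  rw [hdd.deriv] at this; simp at this; linarith

lemma rad_nonneg {P : Po} {w : ℂ} (hw : ‖w‖ ≤ 1) (hmax : ∀ v, ‖v‖ ≤ 1 → ev P v ≤ ev P w) : 0 ≤ ev (dD w P) w := by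
  have hd : HasDerivAt (fun s : ℝ => ev P (w + s * w)) (ev (dD w P) w) 0 := by simpa using ev_deriv P w w 0
  by_contra hcon
  rw [not_le] at hcon
  have hs := hasDerivAt_iff_tendsto_slope_zero.1 hd
  have hs' := hs.mono_left (nhdsWithin_mono (0:ℝ) (s := Set.Iio 0) (fun x hx => ne_of_lt hx))
  have h1 : ∀ᶠ t in 𝓝[<] (0:ℝ), 0 ≤ t⁻¹ • (ev P (w + ((0 + t : ℝ):ℂ) * w) - ev P (w + ((0:ℝ):ℂ) * w)) := by
    filter_upwards [Ioo_mem_nhdsLT (show (-1:ℝ) < 0 by norm_num)] with t ht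
    have : ev P (w + (t:ℂ) * w) ≤ ev P w := hmax _ (by
      have : w + (t:ℂ) * w = ((1 + t : ℝ):ℂ) * w := by push_cast; ring
      rw [this, norm_mul, Complex.norm_real, Real.norm_eq_abs, abs_of_nonneg (by linarith [ht.1])]
      nlinarith [ht.1, ht.2, norm_nonneg w])
    simp only [zero_add, Complex.ofReal_zero, zero_mul, add_zero, smul_eq_mul]
    exact mul_nonneg_of_nonpos_of_nonpos (inv_nonpos.2 ht.2.le) (by linarith)
  have := ge_of_tendsto hs' h1
  linarith

lemma max_one (hn : 1 ≤ n) {P : Po} {c : ℝ} (hc : ∀ w, ‖w‖ ≤ 1 → ev (Lop n P) w ≤ c) : ∀ w, ‖w‖ ≤ 1 → ev P w ≤ c := by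
  obtain ⟨w0, hw0, hm⟩ := (isCompact_closedBall (0:ℂ) 1).exists_isMaxOn ⟨0, by simp⟩ (continuous_ev P).continuousOn
  have hw : ‖w0‖ ≤ 1 := by simpa using hw0
  have hmax : ∀ v, ‖v‖ ≤ 1 → ev P v ≤ ev P w0 := fun v hv => hm (by simpa using hv)
  have key : ev P w0 ≤ ev (Lop n P) w0 := by
    have h1 := rad_nonneg hw hmax
    have h2 := congrArg Complex.re (cev_Lop hn P w0)
    have h3 : 4 * ev (dW (dB P)) w0 * (1 - Complex.normSq w0) ≤ 0 := by
      rcases eq_or_lt_of_le hw with h | h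
      · rw [Complex.normSq_eq_norm_sq, h]; simp
      · have a := lap_nonpos h hmax 1
        have b := lap_nonpos h hmax Complex.I
        have e := congrArg Complex.re (cev_lap P w0)
        have e' : (4 * cev w0 (dW (dB P))).re = 4 * ev (dW (dB P)) w0 := by simp [ev]
        rw [e', Complex.add_re] at e
        simp only [ev] at a b e ⊢
        rw [← e]
        refine mul_nonpos_of_nonpos_of_nonneg (by linarith) ?_
        rw [Complex.normSq_eq_norm_sq]; nlinarith [norm_nonneg w0]
    have e1 : (2/n:ℂ) * cev w0 (dD w0 P) = ((2/n:ℝ):ℂ) * cev w0 (dD w0 P) := by push_cast; ring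
    have e2 : (4/n^2:ℂ) * ((1 - Complex.normSq w0 : ℝ):ℂ) * cev w0 (dW (dB P)) = ((4/n^2 * (1 - Complex.normSq w0) : ℝ):ℂ) * cev w0 (dW (dB P)) := by push_cast; ring
    rw [e1, e2, Complex.sub_re, Complex.add_re, Complex.re_ofReal_mul, Complex.re_ofReal_mul] at h2
    have h4 : 0 ≤ 2/(n:ℝ) * ev (dD w0 P) w0 := by positivity
    have h5 : 4/(n:ℝ)^2 * (1 - Complex.normSq w0) * ev (dW (dB P)) w0 ≤ 0 := by
      have : 4/(n:ℝ)^2 * (1 - Complex.normSq w0) * ev (dW (dB P)) w0 = (1/(n:ℝ)^2) * (4 * ev (dW (dB P)) w0 * (1 - Complex.normSq w0)) := by ring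
      rw [this]; exact mul_nonpos_of_nonneg_of_nonpos (by positivity) h3
    simp only [ev] at *; linarith
  exact fun w hw' => (hmax w hw').trans (key.trans (hc w0 hw))

lemma ev_neg (P : Po) (w) : ev (-P) w = - ev P w := by simp [ev]
lemma max_pr (hn : 1 ≤ n) {P : Po} {c : ℝ} (hc : ∀ w, ‖w‖ ≤ 1 → |ev (Lop n P) w| ≤ c) (w) (hw : ‖w‖ ≤ 1) : |ev P w| ≤ c := by
  have h1 := max_one hn (P := P) (fun w hw => (abs_le.1 (hc w hw)).2) w hw
  have h2 := max_one hn (P := -P) (c := c) (fun w hw => by rw [map_neg, ev_neg]; linarith [(abs_le.1 (hc w hw)).1]) w hw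
  rw [ev_neg] at h2
  exact abs_le.2 ⟨by linarith, h1⟩

lemma Lop_surj (hn : 1 ≤ n) (Q : Po) : ∃ P, Lop n P = Q := by
  have hs : ∀ (j k : ℕ) (κ : ℂ), ∃ P, Lop n P = Finsupp.single (j,k) κ := by
    intro j
    induction j with
    | zero =>
      intro k κ
      have hL : (Lam n (0,k) : ℂ) ≠ 0 := by have := Lam_one hn (0,k); exact_mod_cast (by positivity)
      refine ⟨Finsupp.single (0,k) (κ / Lam n (0,k)), ?_⟩
      rw [Lop_single, div_mul_cancel₀ _ hL]; simp
    | succ j ih =>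
      intro k κ
      have hL : (Lam n (j+1,k) : ℂ) ≠ 0 := by have := Lam_one hn (j+1,k); exact_mod_cast (by positivity)
      obtain ⟨P, hP⟩ := ih (k-1) (κ / Lam n (j+1,k) * (4 * (j+1:ℕ) * k / n^2 : ℝ))
      refine ⟨Finsupp.single (j+1,k) (κ / Lam n (j+1,k)) + P, ?_⟩
      rw [map_add, hP, Lop_single, div_mul_cancel₀ _ hL]; simp
  induction Q using Finsupp.induction_linear with
  | zero => exact ⟨0, by simp⟩
  | add P Q h h' => obtain ⟨a, ha⟩ := h; obtain ⟨b, hb⟩ := h'; exact ⟨a + b, by rw [map_add, ha, hb]⟩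
  | single m κ => exact hs m.1 m.2 κ

lemma closed_bd (c : ℝ) : IsClosed {f : H n | ∀ᵐ w ∂(nu n), |f w| ≤ c} := by
  refine IsSeqClosed.isClosed fun u x hu hx => ?_
  have h1 := tendstoInMeasure_of_tendsto_Lp hx
  obtain ⟨ns, -, h2⟩ := h1.exists_seq_tendsto_ae
  have h3 : ∀ᵐ w ∂(nu n), ∀ i, |u i w| ≤ c := ae_all_iff.2 hu
  filter_upwards [h2, h3] with w a b
  exact le_of_tendsto a.abs (Eventually.of_forall fun i => b _)

lemma A_bd (hn : 1 ≤ n) {h : H n} {c : ℝ} (hc : 0 ≤ c) (hb : ∀ᵐ w ∂(nu n), |h w| ≤ c) : ∀ᵐ w ∂(nu n), |A hn h w| ≤ c := by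
  have key : ∀ ε > 0, ∀ᵐ w ∂(nu n), |A hn h w| ≤ c + ε := by
    intro ε hε
    refine (closed_bd (n := n) (c + ε)).closure_subset ?_
    rw [Metric.mem_closure_iff]
    intro δ hδ
    obtain ⟨Q, hQ, hQ'⟩ := approx_bd h hc hb (ε := min ε (δ / (2*(‖A hn‖ + 1)))) (by positivity)
    obtain ⟨P, rfl⟩ := Lop_surj hn Q
    refine ⟨evL n P, ?_, ?_⟩
    · filter_upwards [evL_ae (n := n) P, nu_disc] with w a b
      rw [a]; exact max_pr hn (fun w hw => (hQ w hw).trans (by gcongr; exact min_le_left _ _)) w b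
    · rw [dist_comm, dist_eq_norm, ← A_Lop hn, ← map_sub]
      have h1 : ‖A hn‖ * (δ / (2*(‖A hn‖ + 1))) < δ := by
        rw [← mul_div_assoc, div_lt_iff₀ (by positivity)]; nlinarith [norm_nonneg (A hn)]
      exact ((A hn).le_opNorm _).trans_lt (lt_of_le_of_lt (by gcongr; exact hQ'.trans (min_le_right _ _)) h1)
  have : ∀ᵐ w ∂(nu n), ∀ k : ℕ, |A hn h w| ≤ c + 1/((k:ℝ)+1) := ae_all_iff.2 fun k => key _ (by positivity)
  filter_upwards [this] with w hw
  have ht : Tendsto (fun k : ℕ => c + 1/((k:ℝ)+1)) atTop (𝓝 (c + 0)) := tendsto_const_nhds.add tendsto_one_div_add_atTop_nhds_zero_nat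
  rw [add_zero] at ht
  exact ge_of_tendsto' ht hw
def C0 (n : ℕ) : ℝ := Real.sqrt (4 / (nn n * n)) * 4^n
lemma eb_sup (hn : 1 ≤ n) (m) : ∀ᵐ w ∂(nu n), |eb n m w| ≤ C0 n * ((m.1+m.2:ℕ)+1:ℝ)^n := by
  have hN := fN_pos hn m
  have hn' : (0:ℝ) < n := by exact_mod_cast hn
  have hnn : 0 < nn n := nu_pos
  filter_upwards [Lp.coeFn_smul (fN n m)⁻¹ (evL n (pol n m)), evL_ae (n := n) (pol n m), nu_disc] with w a b c
  have h1 : eb n m w = (fN n m)⁻¹ * fb n m w := by rw [eb, a, Pi.smul_apply, b, smul_eq_mul, fb]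
  rw [h1, abs_mul, abs_of_pos (inv_pos.2 hN), inv_mul_le_iff₀ hN]
  have h2 := (fb_norm hn m).2 w c
  set d : ℝ := ((m.1+m.2:ℕ):ℝ) with hd
  have hd0 : 0 ≤ d := by positivity
  have h3 : fb n m w ^ 2 ≤ (fN n m * (C0 n * (d+1)^n))^2 := by
    refine h2.trans ?_
    have : (fN n m * (C0 n * (d+1)^n))^2 = 4 * (16 * (d+1)^2)^n / (nn n * n) * ∫ w, fb n m w ^ 2 ∂(nu n) := by
      rw [mul_pow, fN, Real.sq_sqrt (fb_norm hn m).1.le, C0, mul_pow, mul_pow, Real.sq_sqrt (by positivity), mul_pow,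
        ← pow_mul, ← pow_mul, ← pow_mul, mul_comm n 2, pow_mul (4:ℝ)]; norm_num; ring
    rw [this]
    have := (fb_norm hn m).1.le
    refine mul_le_mul_of_nonneg_right (div_le_div_of_nonneg_right (mul_le_mul_of_nonneg_left (pow_le_pow_left₀ ?_ ?_ _) ?_) ?_) this
    · positivity
    · nlinarith
    · norm_num
    · positivity
  exact abs_le_of_sq_le_sq h3 (by unfold C0; positivity)

lemma sum_d : Summable (fun m : ℕ × ℕ => (((m.1+m.2:ℕ)+1:ℝ)^4)⁻¹) := by
  have h0 : Summable (fun j : ℕ => (((j:ℝ)+1)^2)⁻¹) := by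
    have := (summable_nat_add_iff 1).2 (Real.summable_nat_pow_inv.2 (by norm_num : 1 < 2))
    simpa using this
  refine Summable.of_nonneg_of_le (fun m => by positivity) (fun m => ?_)
    (h0.mul_of_nonneg h0 (fun _ => by positivity) (fun _ => by positivity))
  rw [← mul_inv]
  push_cast
  have a : (0:ℝ) ≤ m.1 := by positivity
  have b : (0:ℝ) ≤ m.2 := by positivity
  gcongr
  rw [← mul_pow, show ((m.1:ℝ)+m.2+1)^4 = (((m.1:ℝ)+m.2+1)^2)^2 by ring]
  gcongr; nlinarith [mul_nonneg a b]

lemma Apow_c (hn : 1 ≤ n) (N : ℕ) (x m) : inner ℝ (eb n m) ((A hn ^ N) x) = ((Lam n m)⁻¹)^N * inner ℝ (eb n m) x := by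
  induction N with
  | zero => simp
  | succ N ih => rw [pow_succ', ContinuousLinearMap.mul_apply, A_c, ih]; ring

lemma smoothing (hn : 1 ≤ n) : ∃ C : ℝ, 0 ≤ C ∧ ∀ x : H n, ∀ᵐ w ∂(nu n), |((A hn ^ (n+4)) x) w| ≤ C * ‖x‖ := by
  have hC0 : 0 ≤ C0 n := by unfold C0; positivity
  have hn' : (0:ℝ) < n := by exact_mod_cast hn
  refine ⟨∑' m : ℕ × ℕ, C0 n * n^(n+4) * (((m.1+m.2:ℕ)+1:ℝ)^4)⁻¹, tsum_nonneg fun m => by positivity, fun x => ?_⟩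
  set Ct := ∑' m : ℕ × ℕ, C0 n * n^(n+4) * (((m.1+m.2:ℕ)+1:ℝ)^4)⁻¹
  have hs := (hb hn).hasSum_repr ((A hn ^ (n+4)) x)
  refine (closed_bd (n := n) (Ct * ‖x‖)).mem_of_tendsto hs (Eventually.of_forall fun F => ?_)
  have e : ∀ᵐ w ∂(nu n), (∑ m ∈ F, (hb hn).repr ((A hn ^ (n+4)) x) m • hb hn m : H n) w =
      ∑ m ∈ F, ((Lam n m)⁻¹)^(n+4) * inner ℝ (eb n m) x * eb n m w := by
    have h1 : ∀ᵐ w ∂(nu n), ∀ m ∈ F, ((hb hn).repr ((A hn ^ (n+4)) x) m • hb hn m : H n) w = ((Lam n m)⁻¹)^(n+4) * inner ℝ (eb n m) x * eb n m w := by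
      refine (Finset.eventually_all F).2 fun m _ => ?_
      filter_upwards [Lp.coeFn_smul ((hb hn).repr ((A hn ^ (n+4)) x) m) (hb hn m)] with w a
      rw [a, Pi.smul_apply, smul_eq_mul, HilbertBasis.repr_apply_apply, hb_eq, Apow_c]
    filter_upwards [Lp.coeFn_finsetSum F (fun m => (hb hn).repr ((A hn ^ (n+4)) x) m • hb hn m), h1] with w a b
    rw [a, Finset.sum_apply]
    exact Finset.sum_congr rfl b
  have h2 : ∀ᵐ w ∂(nu n), ∀ m ∈ F, |eb n m w| ≤ C0 n * ((m.1+m.2:ℕ)+1:ℝ)^n := (Finset.eventually_all F).2 fun m _ => eb_sup hn m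
  filter_upwards [e, h2] with w a b
  rw [a]
  refine (Finset.abs_sum_le_sum_abs _ _).trans ?_
  calc _ ≤ ∑ m ∈ F, C0 n * n^(n+4) * (((m.1+m.2:ℕ)+1:ℝ)^4)⁻¹ * ‖x‖ := by
        refine Finset.sum_le_sum fun m hm => ?_
        have hL := Lam_one hn m
        have i1 : |inner ℝ (eb n m) x| ≤ ‖x‖ := by
          refine (abs_real_inner_le_norm _ _).trans ?_
          rw [(eb_orth hn).1 m, one_mul]
        have i2 : (Lam n m)⁻¹ ≤ n * ((m.1+m.2:ℕ)+1:ℝ)⁻¹ := by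
          rw [← div_eq_mul_inv, ← inv_div]
          refine inv_anti₀ (by positivity) (le_trans ?_ (Lam_ge hn m))
          have : (1:ℝ) ≤ n := by exact_mod_cast hn
          exact div_le_div_of_nonneg_right (by linarith) (by positivity)
        rw [abs_mul, abs_mul, abs_of_nonneg (by positivity : 0 ≤ ((Lam n m)⁻¹)^(n+4))]
        calc _ ≤ (n * ((m.1+m.2:ℕ)+1:ℝ)⁻¹)^(n+4) * ‖x‖ * (C0 n * ((m.1+m.2:ℕ)+1:ℝ)^n) := by
              gcongr; exact b m hm
          _ = _ := by
              have : (0:ℝ) < ((m.1+m.2:ℕ)+1:ℝ) := by positivity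
              generalize ((m.1+m.2:ℕ)+1:ℝ) = D at this
              rw [mul_pow, inv_pow, pow_add D n 4]
              field_simp
    _ = (∑ m ∈ F, C0 n * n^(n+4) * (((m.1+m.2:ℕ)+1:ℝ)^4)⁻¹) * ‖x‖ := by rw [Finset.sum_mul]
    _ ≤ _ := by
        gcongr
        exact (sum_d.mul_left _).sum_le_tsum F (fun m _ => by positivity)

/-- linear functions Re (a w) -/
def nv (n : ℕ) (a : ℂ) : H n := evL n (Finsupp.single (1,0) a)
lemma nv_ae (a : ℂ) : ∀ᵐ w ∂(nu n), nv n a w = (a * w).re := by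
  filter_upwards [evL_ae (n := n) (Finsupp.single (1,0) a)] with w h
  rw [nv, h]; simp [ev, mon]
lemma eg0 (n a : ℕ) : eg n a 0 = Finsupp.single (a,0) 1 := by simp [eg, gam]
lemma nv_eb (hn : 1 ≤ n) (a : ℂ) : nv n a = (a.re * fN n (1,0)) • eb n (1,0) + (-(a.im * fN n (0,1))) • eb n (0,1) := by
  have h1 : nv n a = a.re • evL n (pol n (1,0)) + (-a.im) • evL n (pol n (0,1)) := by
    rw [← map_smul, ← map_smul, ← map_add, nv]
    refine evL_ext fun w => ?_
    have e : ∀ (r : ℝ) (P : Po), r • P = (r:ℂ) • P := fun r P => by ext <;> simp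
    rw [ev_add, e, e, ev_smul_real, ev_smul_real]
    simp [ev, mon, pol, kap, am, km, eg0]; ring
  have e : ∀ m, evL n (pol n m) = fN n m • eb n m := fun m => by rw [eb, smul_smul, mul_inv_cancel₀ (fN_pos hn m).ne', one_smul]
  rw [h1, e, e, smul_smul, smul_smul, neg_mul]
lemma Pn_form (hn : 1 ≤ n) : ∃ C : ℝ, 0 < C ∧ ∀ x : H n, ∃ a : ℂ, Pn hn x = nv n a ∧ ‖a‖ ≤ C * ‖x‖ := by
  have h1 := fN_pos hn (1,0)
  have h2 := fN_pos hn (0,1)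
  refine ⟨(fN n (1,0))⁻¹ + (fN n (0,1))⁻¹, by positivity, fun x => ?_⟩
  have i1 : ∀ m, |inner ℝ (eb n m) x| ≤ ‖x‖ := fun m => by
    refine (abs_real_inner_le_norm _ _).trans ?_
    rw [(eb_orth hn).1 m, one_mul]
  refine ⟨⟨(fN n (1,0))⁻¹ * inner ℝ (eb n (1,0)) x, -((fN n (0,1))⁻¹ * inner ℝ (eb n (0,1)) x)⟩, ?_, ?_⟩
  · rw [nv_eb hn]
    refine hb_ext hn fun m => ?_
    rw [Pn_c, inner_add_right, real_inner_smul_right, real_inner_smul_right,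
      orthonormal_iff_ite.1 (eb_orth hn), orthonormal_iff_ite.1 (eb_orth hn)]
    unfold pc
    by_cases a : m = (1,0)
    · subst a; simp; field_simp
    · by_cases b : m = (0,1)
      · subst b; simp; field_simp
      · simp [a, b]
  · refine (Complex.norm_le_abs_re_add_abs_im _).trans ?_
    simp only [abs_neg, abs_mul, abs_inv, abs_of_pos h1, abs_of_pos h2]
    rw [add_mul]; gcongr <;> exact i1 _
lemma Pn_nv (hn : 1 ≤ n) (a : ℂ) : Pn hn (nv n a) = nv n a := by
  refine hb_ext hn fun m => ?_
  rw [Pn_c, nv_eb hn, inner_add_right, real_inner_smul_right, real_inner_smul_right,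
      orthonormal_iff_ite.1 (eb_orth hn), orthonormal_iff_ite.1 (eb_orth hn)]
  unfold pc
  by_cases a : m = (1,0)
  · subst a; simp
  · by_cases b : m = (0,1)
    · subst b; simp
    · simp [a, b]
lemma nv_bd (a : ℂ) : ∀ᵐ w ∂(nu n), |nv n a w| ≤ ‖a‖ := by
  filter_upwards [nv_ae (n := n) a, nu_disc] with w h1 h2
  rw [h1]; refine (Complex.abs_re_le_norm _).trans ?_
  rw [norm_mul]; exact mul_le_of_le_one_right (norm_nonneg _) h2
lemma nv_norm_le (hn : 1 ≤ n) : ∃ c > 0, ∀ a : ℂ, c * ‖a‖ ≤ ‖nv n a‖ := by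
  obtain ⟨C, hC, h⟩ := Pn_form hn
  have h1 := fN_pos hn (1,0)
  have h2 := fN_pos hn (0,1)
  refine ⟨min (fN n (1,0)) (fN n (0,1)) / 2, by positivity, fun a => ?_⟩
  have i1 : ∀ m, |inner ℝ (eb n m) (nv n a)| ≤ ‖nv n a‖ := fun m => by
    refine (abs_real_inner_le_norm _ _).trans ?_
    rw [(eb_orth hn).1 m, one_mul]
  have a1 := i1 (1,0)
  have a2 := i1 (0,1)
  rw [nv_eb hn, inner_add_right, real_inner_smul_right, real_inner_smul_right,
      orthonormal_iff_ite.1 (eb_orth hn), orthonormal_iff_ite.1 (eb_orth hn), ← nv_eb hn] at a1 a2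
  simp [abs_mul, abs_of_pos h1, abs_of_pos h2] at a1 a2
  have h3 := Complex.norm_le_abs_re_add_abs_im a
  have m1 := min_le_left (fN n (1,0)) (fN n (0,1))
  have m2 := min_le_right (fN n (1,0)) (fN n (0,1))
  have q1 := mul_le_mul_of_nonneg_right m1 (abs_nonneg a.re)
  have q2 := mul_le_mul_of_nonneg_right m2 (abs_nonneg a.im)
  have q3 := mul_le_mul_of_nonneg_left h3 (lt_min h1 h2).le
  linarith

lemma coe_sub (f g : H n) : ∀ᵐ w ∂(nu n), (f - g : H n) w = f w - g w := Lp.coeFn_sub f g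
lemma coe_add (f g : H n) : ∀ᵐ w ∂(nu n), (f + g : H n) w = f w + g w := Lp.coeFn_add f g
lemma coe_smul (r : ℝ) (f : H n) : ∀ᵐ w ∂(nu n), (r • f : H n) w = r * f w := Lp.coeFn_smul r f

lemma Apow_bd (hn : 1 ≤ n) (N : ℕ) {h : H n} {c : ℝ} (hc : 0 ≤ c) (hb : ∀ᵐ w ∂(nu n), |h w| ≤ c) : ∀ᵐ w ∂(nu n), |(A hn ^ N) h w| ≤ c := by
  induction N with
  | zero => simpa using hb
  | succ N ih => rw [pow_succ']; exact A_bd hn hc ih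

lemma R_bd (hn : 1 ≤ n) : ∃ C : ℝ, 0 < C ∧ ∀ (g : H n) (c : ℝ), 0 ≤ c → (∀ᵐ w ∂(nu n), |g w| ≤ c) → ∀ᵐ w ∂(nu n), |R hn g w| ≤ C * c := by
  have hth := th_pos hn
  suffices h : ∃ C : ℝ, 0 < C ∧ ∀ (g : H n) (c : ℝ), 0 ≤ c → (∀ᵐ w ∂(nu n), |g w| ≤ c) → ∀ᵐ w ∂(nu n), |(A hn ^ 0) (R hn g) w| ≤ C * c by
    simpa using h
  refine Nat.decreasingInduction (motive := fun N _ => ∃ C : ℝ, 0 < C ∧ ∀ (g : H n) (c : ℝ), 0 ≤ c → (∀ᵐ w ∂(nu n), |g w| ≤ c) → ∀ᵐ w ∂(nu n), |(A hn ^ N) (R hn g) w| ≤ C * c) (n := n+4) ?_ ?_ (Nat.zero_le _)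
  · rintro N - ⟨C, hC, h⟩
    obtain ⟨Cp, hCp, hP⟩ := Pn_form hn
    have hS := Sn_pos (n := n)
    refine ⟨(th n)⁻¹ * (C + (1 + Cp * Sn n)), by positivity, fun g c hc hg => ?_⟩
    obtain ⟨a, ha, ha'⟩ := hP g
    have h1 : ∀ᵐ w ∂(nu n), |(g - Pn hn g : H n) w| ≤ (1 + Cp * Sn n) * c := by
      rw [ha]
      filter_upwards [coe_sub g (nv n a), hg, nv_bd (n := n) a] with w x y z
      rw [x]
      have := norm_bd hc hg
      have : ‖a‖ ≤ Cp * (Sn n * c) := ha'.trans (by gcongr)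
      calc |g w - nv n a w| ≤ |g w| + |nv n a w| := abs_sub _ _
        _ ≤ _ := by linarith
    have h2 := Apow_bd hn N (by positivity) h1
    have h3 := h g c hc hg
    have e : (A hn ^ N) (R hn g) = (th n)⁻¹ • ((A hn ^ (N+1)) (R hn g) - (A hn ^ N) (g - Pn hn g)) := by
      have : A hn (R hn g) = th n • R hn g + (g - Pn hn g) := by rw [← A_R hn]; abel
      rw [pow_succ, ContinuousLinearMap.mul_apply, this, map_add, map_smul, add_sub_cancel_right, smul_smul, inv_mul_cancel₀ hth.ne', one_smul]
    rw [e]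
    filter_upwards [coe_smul (th n)⁻¹ ((A hn ^ (N+1)) (R hn g) - (A hn ^ N) (g - Pn hn g)), coe_sub ((A hn ^ (N+1)) (R hn g)) ((A hn ^ N) (g - Pn hn g)), h2, h3] with w x y z v
    rw [x, y, abs_mul, abs_of_pos (inv_pos.2 hth), mul_assoc]
    gcongr
    refine (abs_sub _ _).trans ?_
    rw [add_mul]; exact add_le_add v z
  · obtain ⟨C, hC, h⟩ := smoothing hn
    have hS := Sn_pos (n := n)
    refine ⟨C * (‖R hn‖ * Sn n) + 1, by positivity, fun g c hc hg => ?_⟩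
    filter_upwards [h (R hn g)] with w x
    refine x.trans ?_
    have h1 : ‖R hn g‖ ≤ ‖R hn‖ * (Sn n * c) := ((R hn).le_opNorm g).trans (by gcongr; exact norm_bd hc hg)
    calc C * ‖R hn g‖ ≤ C * (‖R hn‖ * (Sn n * c)) := by gcongr
      _ ≤ _ := by nlinarith
lemma mp_W : MeasurePreserving (Wm n) (mu n) (nu n) := ⟨measurable_Wm, rfl⟩

lemma lim_int (m : ℕ) {ψ : Pt n → ℝ} (hψ : Continuous ψ) (hc : HasCompactSupport ψ) {f : ℕ → H n} {g : H n}
    (h : Tendsto f atTop (𝓝 g)) :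
    Tendsto (fun i => ∫ p, (nq n p ^ m)⁻¹ * f i (Wm n p) * ψ p) atTop (𝓝 (∫ p, (nq n p ^ m)⁻¹ * g (Wm n p) * ψ p)) := by
  set χ : Pt n → ℝ := fun p => nq n p ^ (2*n+2) * (nq n p ^ m)⁻¹ * ψ p with hχ
  have hχc : Continuous χ := by
    refine ((continuous_nq.pow _).mul ((continuous_nq.pow _).inv₀ fun p => (pow_pos (nq_pos p) _).ne')).mul hψ
  have hχm : MemLp χ 2 (mu n) := hχc.memLp_of_hasCompactSupport (hc.mul_left)
  have key : ∀ f : H n, ∫ p, (nq n p ^ m)⁻¹ * f (Wm n p) * ψ p =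
      inner ℝ (hχm.toLp χ) (Lp.compMeasurePreserving (Wm n) mp_W f) := by
    intro f
    rw [L2.inner_def]
    have : ∫ p, inner ℝ (hχm.toLp χ p) (Lp.compMeasurePreserving (Wm n) mp_W f p) ∂(mu n) = ∫ p, χ p * f (Wm n p) ∂(mu n) := by
      refine integral_congr_ae ?_
      filter_upwards [hχm.coeFn_toLp, Lp.coeFn_compMeasurePreserving f mp_W] with p a b
      rw [a, b]; simp [mul_comm]
    rw [this, int_mu]
    congr 1; funext p
    have := nq_pos p
    simp only [hχ, smul_eq_mul]; field_simp
  simp only [key]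
  exact (tendsto_const_nhds).inner (((Lp.isometry_compMeasurePreserving mp_W).continuous.tendsto g).comp h)

lemma L2lim {F : ℕ → Pt n → ℝ} (hF : ∀ i, MemLp (F i) 2 volume) {C : ℝ} (hC : 0 ≤ C) {b : ℕ → H n} (hb : CauchySeq b)
    (h : ∀ i j, ∫ p, (F i p - F j p)^2 ≤ C * ‖b i - b j‖^2) :
    ∃ g, MemLp g 2 (volume : Measure (Pt n)) ∧ ∀ φ, MemLp φ 2 (volume : Measure (Pt n)) →
      Tendsto (fun i => ∫ p, F i p * φ p) atTop (𝓝 (∫ p, g p * φ p)) := by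
  set a : ℕ → Lp ℝ 2 (volume : Measure (Pt n)) := fun i => (hF i).toLp (F i) with ha
  have hd : ∀ i j, ‖a i - a j‖ ≤ Real.sqrt C * ‖b i - b j‖ := by
    intro i j
    refine abs_le_of_sq_le_sq (a := ‖a i - a j‖) ?_ (by positivity) |> le_trans (le_abs_self _)
    rw [mul_pow, Real.sq_sqrt hC]
    refine le_trans (le_of_eq ?_) (h i j)
    rw [← real_inner_self_eq_norm_sq, L2.inner_def]
    refine integral_congr_ae ?_
    filter_upwards [Lp.coeFn_sub (a i) (a j), (hF i).coeFn_toLp, (hF j).coeFn_toLp] with p x y z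
    rw [x, Pi.sub_apply, ha, y, z]; simp [sq]
  have hcs : CauchySeq a := by
    rw [Metric.cauchySeq_iff'] at hb ⊢
    intro ε hε
    obtain ⟨N, hN⟩ := hb (ε / (Real.sqrt C + 1)) (by positivity)
    refine ⟨N, fun k hk => ?_⟩
    have h1 := hN k hk
    rw [dist_eq_norm, lt_div_iff₀ (by positivity)] at h1
    rw [dist_eq_norm]
    exact lt_of_le_of_lt (hd k N) (by nlinarith [norm_nonneg (b k - b N), Real.sqrt_nonneg C])
  obtain ⟨G, hG⟩ := cauchySeq_tendsto_of_complete hcs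
  refine ⟨G, Lp.memLp G, fun φ hφ => ?_⟩
  have key : ∀ f : Lp ℝ 2 (volume : Measure (Pt n)), inner ℝ (hφ.toLp φ) f = ∫ p, f p * φ p := by
    intro f
    rw [L2.inner_def]
    refine integral_congr_ae ?_
    filter_upwards [hφ.coeFn_toLp] with p x
    rw [x]; simp
  have h2 := (tendsto_const_nhds (x := hφ.toLp φ) (f := atTop)).inner (𝕜 := ℝ) hG
  simp only [key] at h2
  refine h2.congr fun i => integral_congr_ae ?_
  filter_upwards [(hF i).coeFn_toLp] with p x
  rw [ha, x]

lemma uf_sub (P Q : Po) : uf n 1 P = fun p => uf n 1 (P - Q) p + uf n 1 Q p := by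
  funext p; rw [uf_one, uf_one, uf_one, ← mul_add, ← ev_add, sub_add_cancel]

lemma en_le (hn : 1 ≤ n) (P Q : Po) (j : Fin n) :
    (∫ p, (Xd n j (uf n 1 P) p - Xd n j (uf n 1 Q) p)^2 ≤ 4 * n^2 * ‖A hn‖ * ‖evL n (Lop n P) - evL n (Lop n Q)‖^2) ∧
    (∫ p, (Yd n j (uf n 1 P) p - Yd n j (uf n 1 Q) p)^2 ≤ 4 * n^2 * ‖A hn‖ * ‖evL n (Lop n P) - evL n (Lop n Q)‖^2) := by
  have g1 := (good_poly (c := 1) (by simp) hn (P-Q)).1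
  have g2 := (good_poly (c := 1) (by simp) hn Q).1
  have e1 : ∀ p, Xd n j (uf n 1 P) p - Xd n j (uf n 1 Q) p = Xd n j (uf n 1 (P-Q)) p := fun p => by
    rw [uf_sub P Q, Xd_add (g1 p) (g2 p)]; ring
  have e2 : ∀ p, Yd n j (uf n 1 P) p - Yd n j (uf n 1 Q) p = Yd n j (uf n 1 (P-Q)) p := fun p => by
    rw [uf_sub P Q, Yd_add (g1 p) (g2 p)]; ring
  simp only [e1, e2]
  have E := energy hn (P-Q)
  have hh : 4 * n^2 * ∫ w, ev (P-Q) w * ev (Lop n (P-Q)) w ∂(nu n) ≤ 4 * n^2 * ‖A hn‖ * ‖evL n (Lop n P) - evL n (Lop n Q)‖^2 := by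
    rw [← inn_evL, ← A_Lop hn, ← map_sub, ← map_sub]
    generalize evL n (Lop n (P-Q)) = x
    have : inner ℝ (A hn x) x ≤ ‖A hn‖ * ‖x‖^2 := by
      refine (real_inner_le_norm _ _).trans ?_
      rw [sq, ← mul_assoc]; gcongr; exact (A hn).le_opNorm x
    calc _ ≤ 4 * (n:ℝ)^2 * (‖A hn‖ * ‖x‖^2) := by gcongr
      _ = _ := by ring
  have nn1 : ∀ i, 0 ≤ ∫ p, Xd n i (uf n 1 (P-Q)) p ^ 2 := fun i => integral_nonneg fun p => sq_nonneg _
  have nn2 : ∀ i, 0 ≤ ∫ p, Yd n i (uf n 1 (P-Q)) p ^ 2 := fun i => integral_nonneg fun p => sq_nonneg _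
  have s := Finset.single_le_sum (f := fun j => ((∫ p, Xd n j (uf n 1 (P-Q)) p ^ 2) + ∫ p, Yd n j (uf n 1 (P-Q)) p ^ 2))
    (fun i _ => add_nonneg (nn1 i) (nn2 i)) (Finset.mem_univ j)
  rw [E] at s
  have a1 := nn1 j
  have a2 := nn2 j

  constructor <;> linarith

lemma X_memLp (hn : 1 ≤ n) (P : Po) (j : Fin n) : MemLp (Xd n j (uf n 1 P)) 2 volume ∧ MemLp (Yd n j (uf n 1 P)) 2 volume := by
  have g := good_poly (c := 1) (by simp) hn P
  have h := (green hn g g).2.1 j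
  have a := (g.2.1 j).continuous
  have b := (g.2.2.1 j).continuous
  rw [memLp_two_iff_integrable_sq a.aestronglyMeasurable, memLp_two_iff_integrable_sq b.aestronglyMeasurable]
  simpa only [sq] using h

lemma weak_A (hn : 1 ≤ n) (h : H n) : ∃ G : Pt n → (Fin n → ℝ) × (Fin n → ℝ),
    HasWeakHGrad n (fun p => (nq n p ^ n)⁻¹ * A hn h (Wm n p)) G ∧
    ∀ φ, TestFun n φ → ∫ p, gDot n G φ p = 4 * n^2 * ∫ p, (nq n p ^ (n+2))⁻¹ * h (Wm n p) * φ p := by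
  obtain ⟨b, hbm, hbl⟩ := mem_closure_iff_seq_limit.1 (evL_dense (n := n) h)
  choose Q hQ using hbm
  choose P hP using fun i => Lop_surj hn (Q i)
  have hb' : ∀ i, evL n (Lop n (P i)) = b i := fun i => by rw [hP, hQ]
  have hAl : Tendsto (fun i => evL n (P i)) atTop (𝓝 (A hn h)) := by
    have := ((A hn).continuous.tendsto h).comp hbl
    refine this.congr fun i => ?_
    rw [Function.comp, ← hb', A_Lop]
  have hG1 : ∀ j, _ := fun j => L2lim (fun i => (X_memLp hn (P i) j).1) (C := 4 * n^2 * ‖A hn‖) (by positivity) hbl.cauchySeq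
    (fun i k => by rw [← hb', ← hb']; exact (en_le hn (P i) (P k) j).1)
  have hG2 : ∀ j, _ := fun j => L2lim (fun i => (X_memLp hn (P i) j).2) (C := 4 * n^2 * ‖A hn‖) (by positivity) hbl.cauchySeq
    (fun i k => by rw [← hb', ← hb']; exact (en_le hn (P i) (P k) j).2)
  choose G1 hG1m hG1 using hG1
  choose G2 hG2m hG2 using hG2
  have lim : ∀ (m : ℕ) (ψ : Pt n → ℝ), Continuous ψ → HasCompactSupport ψ → ∀ (P : ℕ → Po) (g : H n), Tendsto (fun i => evL n (P i)) atTop (𝓝 g) →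
      Tendsto (fun i => ∫ p, (nq n p ^ m)⁻¹ * ev (P i) (Wm n p) * ψ p) atTop (𝓝 (∫ p, (nq n p ^ m)⁻¹ * g (Wm n p) * ψ p)) := by
    intro m ψ h1 h2 P g hg
    refine (lim_int m h1 h2 hg).congr fun i => integral_congr_ae ?_
    filter_upwards [ae_nu_imp (evL_ae (n := n) (P i))] with p x
    rw [x]
  have hm : ∀ {ψ : Pt n → ℝ}, Continuous ψ → HasCompactSupport ψ → MemLp ψ 2 volume := fun a b => a.memLp_of_hasCompactSupport b
  refine ⟨fun p => (fun j => G1 j p, fun j => G2 j p), ⟨fun j => ⟨hG1m j, hG2m j⟩, fun φ hφ j => ?_⟩, fun φ hφ => ?_⟩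
  · have hX := Xd_test hφ j
    constructor
    · refine tendsto_nhds_unique (lim n _ hX.1 hX.2.1 P _ hAl) ?_
      refine ((hG1 j φ (hm hφ.1.continuous hφ.2)).neg).congr fun i => ?_
      exact ((green_test (good_poly (c := 1) (by simp) hn (P i)) hφ).1 j).symm
    · refine tendsto_nhds_unique (lim n _ hX.2.2.1 hX.2.2.2 P _ hAl) ?_
      refine ((hG2 j φ (hm hφ.1.continuous hφ.2)).neg).congr fun i => ?_
      exact ((green_test (good_poly (c := 1) (by simp) hn (P i)) hφ).2.1 j).symm
  · have hX := fun j => Xd_test hφ j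
    have m1 := fun j => hm (hX j).1 (hX j).2.1
    have m2 := fun j => hm (hX j).2.2.1 (hX j).2.2.2
    have e : ∫ p, gDot n (fun p => (fun j => G1 j p, fun j => G2 j p)) φ p =
        ∑ j, ((∫ p, G1 j p * Xd n j φ p) + ∫ p, G2 j p * Yd n j φ p) := by
      simp only [gDot]
      rw [integral_finset_sum]
      · refine Finset.sum_congr rfl fun j _ => integral_add ?_ ?_
        · exact (hG1m j).integrable_mul (m1 j)
        · exact (hG2m j).integrable_mul (m2 j)
      · intro j _
        exact ((hG1m j).integrable_mul (m1 j)).add ((hG2m j).integrable_mul (m2 j))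
    rw [e]
    have t1 : Tendsto (fun i => ∑ j, ((∫ p, Xd n j (uf n 1 (P i)) p * Xd n j φ p) + ∫ p, Yd n j (uf n 1 (P i)) p * Yd n j φ p)) atTop
      (𝓝 (∑ j, ((∫ p, G1 j p * Xd n j φ p) + ∫ p, G2 j p * Yd n j φ p))) :=
      tendsto_finsetSum _ fun j _ => (hG1 j _ (m1 j)).add (hG2 j _ (m2 j))
    refine tendsto_nhds_unique t1 ?_
    have t2 := (lim (n+2) φ hφ.1.continuous hφ.2 (fun i => Lop n (P i)) h (by simpa only [hb'] using hbl)).const_mul (4 * (n:ℝ)^2)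
    refine t2.congr fun i => ?_
    rw [(green_test (good_poly (c := 1) (by simp) hn (P i)) hφ).2.2, ← integral_const_mul, ← integral_neg]
    congr 1; funext p; rw [Lf_one]; ring

lemma weak_final (hn : 1 ≤ n) {K : Pt n → ℝ} {h : H n} {C : ℝ} (hpos : ∀ᵐ p : Pt n, 0 < A hn h (Wm n p))
    (hb : ∀ᵐ w ∂(nu n), |A hn h w| ≤ C)
    (hK : ∀ᵐ p : Pt n, K p * (A hn h (Wm n p)) ^ (Qs n - 1) = h (Wm n p)) : ∃ u, IsWeakSol n K u := by
  have hn' : (0:ℝ) < n := by exact_mod_cast hn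
  obtain ⟨G, ⟨hG0, hG1⟩, hG2⟩ := weak_A hn h
  set c : ℝ := (2*n)^n with hc
  have hc0 : 0 < c := by positivity
  have hQ : Qs n - 1 = ((n+2:ℕ):ℝ) / n := by
    have e : 2 * (n:ℝ) + 2 - 2 = 2 * n := by ring
    unfold Qs Qh; rw [e]; push_cast; field_simp; ring
  have hcp : c ^ (Qs n - 1) = c * (4 * n^2) := by
    rw [hQ, hc, ← Real.rpow_natCast (2*(n:ℝ)) n, ← Real.rpow_mul (by positivity), mul_div_cancel₀ _ hn'.ne', Real.rpow_natCast,
      Real.rpow_natCast, pow_add]; ring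
  refine ⟨fun p => c * ((nq n p ^ n)⁻¹ * A hn h (Wm n p)), ?_, ?_, ?_, fun p => (c • (G p).1, c • (G p).2), ⟨?_, ?_⟩, ?_⟩
  · refine ⟨fun r t => c * ((‖((r^2 - t * Complex.I : ℂ)) + 1‖ ^ n)⁻¹ * A hn h (Vf 1 (r^2 - t * Complex.I))), fun p => ?_⟩
    have : ((znorm n p : ℂ)^2 - p.2.2 * Complex.I) = sg n p := by
      have : (znorm n p)^2 = rho n p := by
        unfold znorm rho; rw [Real.sq_sqrt (by positivity)]
      rw [← Complex.ofReal_pow, this]; rfl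
    simp only [this]; rfl
  · have hm : AEStronglyMeasurable (fun p : Pt n => c * ((nq n p ^ n)⁻¹ * A hn h (Wm n p))) volume := by
      refine AEStronglyMeasurable.const_mul (AEStronglyMeasurable.mul ?_ ?_) _
      · exact ((continuous_nq.pow _).inv₀ fun p => (pow_pos (nq_pos p) _).ne').aestronglyMeasurable
      · exact ((Lp.stronglyMeasurable _).comp_measurable measurable_Wm).aestronglyMeasurable
    have hQ0 : 0 < Qs n := by
      have : (0:ℝ) < ((n+2:ℕ):ℝ) / n := by positivity
      linarith
    rw [← integrable_norm_rpow_iff hm (by simpa using hQ0) (by simp), ENNReal.toReal_ofReal hQ0.le]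
    refine (integrable_dens.const_mul ((c * |C|)^(Qs n))).mono' ?_ ?_
    · exact (hm.norm.aemeasurable.pow_const _).aestronglyMeasurable
    · filter_upwards [ae_nu_imp hb] with p hp
      have hq := nq_pos p
      rw [Real.norm_of_nonneg (by positivity)]
      have h1 : ‖c * ((nq n p ^ n)⁻¹ * A hn h (Wm n p))‖ ≤ (c * |C|) * (nq n p ^ n)⁻¹ := by
        rw [norm_mul, norm_mul, Real.norm_of_nonneg hc0.le, Real.norm_of_nonneg (by positivity : 0 ≤ (nq n p ^ n)⁻¹), Real.norm_eq_abs]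
        have := hp.trans (le_abs_self C)
        calc _ ≤ c * ((nq n p ^ n)⁻¹ * |C|) := by gcongr
          _ = _ := by ring
      refine (Real.rpow_le_rpow (norm_nonneg _) h1 hQ0.le).trans (le_of_eq ?_)
      rw [Real.mul_rpow (by positivity) (by positivity)]
      congr 1
      rw [← inv_pow, ← inv_pow, ← Real.rpow_natCast (nq n p)⁻¹ n, ← Real.rpow_mul (by positivity), ← Real.rpow_natCast]
      congr 1
      have : Qs n = ((n+2:ℕ):ℝ) / n + 1 := by linarith
      rw [this]; push_cast; field_simp; ring
  · filter_upwards [hpos] with p hp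
    have hq := nq_pos p
    positivity
  · exact fun j => ⟨(hG0 j).1.const_mul c, (hG0 j).2.const_mul c⟩
  · intro φ hφ j
    obtain ⟨a, b⟩ := hG1 φ hφ j
    constructor
    · have : ∀ p, c * ((nq n p ^ n)⁻¹ * A hn h (Wm n p)) * Xd n j φ p = c * ((nq n p ^ n)⁻¹ * A hn h (Wm n p) * Xd n j φ p) := fun p => by ring
      simp only [this, integral_const_mul, Pi.smul_apply, smul_eq_mul, mul_assoc c]
      rw [← mul_neg, ← a]
    · have : ∀ p, c * ((nq n p ^ n)⁻¹ * A hn h (Wm n p)) * Yd n j φ p = c * ((nq n p ^ n)⁻¹ * A hn h (Wm n p) * Yd n j φ p) := fun p => by ring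
      simp only [this, integral_const_mul, Pi.smul_apply, smul_eq_mul, mul_assoc c]
      rw [← mul_neg, ← b]
  · intro φ hφ
    have e : ∀ p, gDot n (fun p => (c • (G p).1, c • (G p).2)) φ p = c * gDot n G φ p := fun p => by
      simp only [gDot, Finset.mul_sum, Pi.smul_apply, smul_eq_mul]
      exact Finset.sum_congr rfl fun j _ => by ring
    simp only [e, integral_const_mul]
    rw [hG2 φ hφ, ← mul_assoc, ← hcp, ← integral_const_mul]
    refine integral_congr_ae ?_
    filter_upwards [hK, hpos] with p h1 h2
    have hq := nq_pos p
    rw [← h1, Real.mul_rpow hc0.le (by positivity), Real.mul_rpow (by positivity) h2.le]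
    have : ((nq n p ^ n)⁻¹) ^ (Qs n - 1) = (nq n p ^ (n+2))⁻¹ := by
      rw [hQ, ← inv_pow, ← inv_pow, ← Real.rpow_natCast (nq n p)⁻¹ n, ← Real.rpow_mul (by positivity), mul_div_cancel₀ _ hn'.ne', Real.rpow_natCast]
    rw [this]; ring
def Dc (c w : ℂ) : ℂ := 2 + (c - 1) * (1 + w)
def bet (c w : ℂ) : ℝ := 2 * √c.re / ‖Dc c w‖
def ta (c w : ℂ) : ℂ := 2 * c.re * (1 + w) / Dc c w - 1

lemma Dc_low {c : ℂ} (hc : 0 < c.re) : ∃ m > 0, ∀ w, ‖w‖ ≤ 1 → m ≤ ‖Dc c w‖ := by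
  refine ⟨min 1 (c.re / (‖c-1‖+1)), by positivity, fun w hw => ?_⟩
  by_cases h : ‖1+w‖ ≤ 1 / (‖c-1‖+1)
  · refine (min_le_left _ _).trans ?_
    rw [le_div_iff₀ (by positivity)] at h
    have h1 : ‖(2:ℂ)‖ ≤ ‖Dc c w‖ + ‖(c-1)*(1+w)‖ := by
      have : (2:ℂ) = Dc c w - (c-1)*(1+w) := by unfold Dc; ring
      calc ‖(2:ℂ)‖ = ‖Dc c w - (c-1)*(1+w)‖ := by rw [← this]
        _ ≤ _ := norm_sub_le _ _
    rw [norm_mul] at h1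
    simp only [Complex.norm_ofNat] at h1
    nlinarith [norm_nonneg (1+w)]
  · refine (min_le_right _ _).trans ?_
    push Not at h
    have h0 : 0 < ‖1+w‖ := lt_trans (by positivity) h
    have h1 : (conj (1+w) * Dc c w).re = 1 - ‖w‖^2 + c.re * ‖1+w‖^2 := by
      rw [← Complex.normSq_eq_norm_sq, ← Complex.normSq_eq_norm_sq, Complex.normSq_apply, Complex.normSq_apply]
      simp [Dc]; ring
    have h2 := Complex.re_le_norm (conj (1+w) * Dc c w)
    rw [norm_mul, RCLike.norm_conj, h1] at h2
    have h3 : c.re * ‖1+w‖ ≤ ‖Dc c w‖ := by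
      have : ‖1+w‖ * (c.re * ‖1+w‖) ≤ ‖1+w‖ * ‖Dc c w‖ := by nlinarith [norm_nonneg w]
      exact le_of_mul_le_mul_left this h0
    refine le_trans ?_ h3
    rw [div_eq_mul_one_div]; gcongr

lemma bet_bd {c : ℂ} (hc : 0 < c.re) : ∃ m > 0, ∃ M, 0 < M ∧ ∀ w, ‖w‖ ≤ 1 → m ≤ bet c w ∧ bet c w ≤ M := by
  obtain ⟨m, hm, h⟩ := Dc_low hc
  refine ⟨2 * √c.re / (2 + ‖c-1‖*2), by positivity, 2*√c.re/m, by positivity, fun w hw => ?_⟩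
  have h1 := h w hw
  have h2 : ‖Dc c w‖ ≤ 2 + ‖c-1‖*2 := by
    refine (norm_add_le _ _).trans ?_
    rw [norm_mul]; simp only [Complex.norm_ofNat]; gcongr
    refine (norm_add_le _ _).trans ?_
    simp; linarith
  unfold bet
  constructor <;> gcongr
  linarith

lemma meas_bet (c : ℂ) : Measurable (bet c) := by unfold bet Dc; fun_prop
lemma meas_ta (c : ℂ) : Measurable (ta c) := by unfold ta Dc; fun_prop

lemma q_ne (p : Pt n) : sg n p + 1 ≠ 0 := ne0 (by simp) (sg_nonneg p)
lemma Dc_W (c : ℂ) (p : Pt n) : Dc c (Wm n p) = 2 * (sg n p + c) / (sg n p + 1) := by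
  have := q_ne p
  unfold Dc Wm Vf; simp; field_simp; ring
lemma bet_W (c : ℂ) (p : Pt n) : bet c (Wm n p) = √c.re * nq n p / ‖sg n p + c‖ := by
  have := nq_pos p
  rw [bet, Dc_W, norm_div, norm_mul]
  simp only [Complex.norm_ofNat]
  rw [show ‖sg n p + 1‖ = nq n p from rfl]
  by_cases h : ‖sg n p + c‖ = 0
  · rw [h]; simp
  · field_simp
lemma ta_W {c : ℂ} (hc : 0 < c.re) (p : Pt n) : ta c (Wm n p) = Vf c (sg n p) := by
  have := q_ne p
  have h2 := ne0 hc (sg_nonneg p)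
  rw [ta, Dc_W]; unfold Wm Vf; simp; field_simp; try ring

/-- scaling + translation -/
def scl (n : ℕ) (c : ℂ) (p : Pt n) : Pt n := (√c.re • p.1, √c.re • p.2.1, c.re * p.2.2 + c.im)
lemma sg_scl {c : ℂ} (hc : 0 < c.re) (p : Pt n) : sg n (scl n c p) = c.re * sg n p - c.im * Complex.I := by
  have : rho n (scl n c p) = c.re * rho n p := by
    simp only [rho, scl, Pi.smul_apply, smul_eq_mul, mul_pow, Real.sq_sqrt hc.le, ← Finset.mul_sum]; ring
  rw [sg, this]; simp [scl, sg]; ring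
lemma Vf_scl {c : ℂ} (hc : 0 < c.re) (p : Pt n) : Vf c (sg n (scl n c p)) = Wm n p := by
  have h1 := q_ne p
  have h2 : (c.re : ℂ) ≠ 0 := by exact_mod_cast hc.ne'
  have : sg n (scl n c p) + c = c.re * (sg n p + 1) := by
    rw [sg_scl hc]; nth_rw 3 [← Complex.re_add_im c]; ring
  rw [Vf, this, Wm, Vf]; simp; field_simp
lemma nm_scl {c : ℂ} (hc : 0 < c.re) (p : Pt n) : ‖sg n (scl n c p) + c‖ = c.re * nq n p := by
  have : sg n (scl n c p) + c = c.re * (sg n p + 1) := by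
    rw [sg_scl hc]; nth_rw 3 [← Complex.re_add_im c]; ring
  rw [this, norm_mul, Complex.norm_real, Real.norm_of_nonneg hc.le]; rfl

lemma scl_map {c : ℂ} (hc : 0 < c.re) : Measure.map (scl n c) volume = ENNReal.ofReal ((c.re^(n+1))⁻¹) • (volume : Measure (Pt n)) := by
  have hs : √c.re ≠ 0 := (Real.sqrt_pos.2 hc).ne'
  have h1 : Measure.map (fun x : Fin n → ℝ => √c.re • x) volume = ENNReal.ofReal ((√c.re^n)⁻¹) • volume := by
    rw [Measure.map_addHaar_smul _ hs]; simp [abs_of_pos (Real.sqrt_pos.2 hc)]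
  have h2 : Measure.map (fun t : ℝ => c.re * t + c.im) volume = ENNReal.ofReal (c.re⁻¹) • volume := by
    have : (fun t : ℝ => c.re * t + c.im) = (fun t => t + c.im) ∘ (fun t => c.re * t) := rfl
    rw [this, ← Measure.map_map (by fun_prop) (by fun_prop), Real.map_volume_mul_left hc.ne', Measure.map_smul, map_add_right_eq_self]
    simp [abs_of_pos hc]
  have e : scl n c = Prod.map (fun x => √c.re • x) (Prod.map (fun x => √c.re • x) (fun t => c.re * t + c.im)) := rfl
  have hv : (volume : Measure (Pt n)) = (volume : Measure (Fin n → ℝ)).prod ((volume : Measure (Fin n → ℝ)).prod (volume : Measure ℝ)) := rfl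
  rw [e, hv, ← Measure.map_prod_map, ← Measure.map_prod_map, h1, h2]
  · simp only [Measure.prod_smul_left, Measure.prod_smul_right, smul_smul]
    congr 1
    rw [← ENNReal.ofReal_mul (by positivity), ← ENNReal.ofReal_mul (by positivity)]
    congr 1
    have : √c.re^n * √c.re^n = c.re^n := by rw [← mul_pow, Real.mul_self_sqrt hc.le]
    rw [← mul_inv, ← mul_inv, pow_succ, ← this]; ring
  all_goals fun_prop

lemma map_ta {c : ℂ} (hc : 0 < c.re) :
    MeasurePreserving (ta c) ((nu n).withDensity (fun w => ENNReal.ofReal (bet c w ^ (2*n+2)))) (nu n) := by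
  refine ⟨meas_ta c, ?_⟩
  refine Measure.ext_of_lintegral _ fun F hF => ?_
  have hb := ((meas_bet c).pow_const (2*n+2)).ennreal_ofReal
  have hF1 : Measurable (fun w => F (ta c w)) := hF.comp (meas_ta c)
  rw [lintegral_map hF (meas_ta c), lintegral_withDensity_eq_lintegral_mul _ hb hF1]
  simp only [Pi.mul_apply]
  have lnu : ∀ {f : ℂ → ENNReal}, Measurable f → ∫⁻ w, f w ∂(nu n) = ∫⁻ p, ENNReal.ofReal ((nq n p ^ (2*n+2))⁻¹) * f (Wm n p) := by
    intro f hf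
    rw [nu, lintegral_map hf measurable_Wm, mu, lintegral_withDensity_eq_lintegral_mul _ dens_cont.measurable.ennreal_ofReal (show Measurable (fun p => f (Wm n p)) from hf.comp measurable_Wm)]
    rfl
  rw [lnu (show Measurable (fun w => ENNReal.ofReal (bet c w ^ (2*n+2)) * F (ta c w)) from hb.mul hF1), lnu hF]
  have hsm : Measurable (scl n c) := by unfold scl; fun_prop
  set Gf : Pt n → ENNReal := fun p => ENNReal.ofReal (c.re^(n+1) * (‖sg n p + c‖^(2*n+2))⁻¹) * F (Vf c (sg n p)) with hGf
  have hGm : Measurable Gf := by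
    have h1 : Measurable (fun p : Pt n => ‖sg n p + c‖) := (continuous_sg.add continuous_const).norm.measurable
    have h2 : Measurable (fun p : Pt n => F (Vf c (sg n p))) := hF.comp (continuous_V hc).measurable
    exact (((h1.pow_const _).inv.const_mul _).ennreal_ofReal).mul h2
  have e1 : ∀ p, ENNReal.ofReal ((nq n p ^ (2*n+2))⁻¹) * (ENNReal.ofReal (bet c (Wm n p) ^ (2*n+2)) * F (ta c (Wm n p))) = Gf p := by
    intro p
    have := nq_pos p
    rw [← mul_assoc, ← ENNReal.ofReal_mul (by positivity), ta_W hc, bet_W, hGf]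
    congr 2
    rw [div_pow, mul_pow, show 2*n+2 = 2*(n+1) by ring, pow_mul √c.re, Real.sq_sqrt hc.le]
    field_simp
  simp only [e1]
  have h3 := lintegral_map hGm hsm (μ := volume)
  rw [scl_map hc, lintegral_smul_measure] at h3
  have h4 : ∫⁻ p, Gf p = ENNReal.ofReal (c.re^(n+1)) * ∫⁻ p, Gf (scl n c p) := by
    rw [← h3, smul_eq_mul, ← mul_assoc, ← ENNReal.ofReal_mul (by positivity), mul_inv_cancel₀ (by positivity)]; simp
  rw [h4, ← lintegral_const_mul _ (show Measurable (fun p => Gf (scl n c p)) from hGm.comp hsm)]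
  congr 1; funext p
  have := nq_pos p
  rw [hGf]; simp only
  rw [Vf_scl hc, nm_scl hc, ← mul_assoc, ← ENNReal.ofReal_mul (by positivity)]
  congr 2
  rw [mul_pow, show 2*n+2 = (n+1) + (n+1) by ring, pow_add]; field_simp; ring

lemma ae_ta {c : ℂ} (hc : 0 < c.re) {P : ℂ → Prop} (h : ∀ᵐ w ∂(nu n), P w) : ∀ᵐ w ∂(nu n), P (ta c w) := by
  have h1 := (map_ta (n := n) hc).quasiMeasurePreserving.ae h
  rw [ae_withDensity_iff ((meas_bet c).pow_const (2*n+2)).ennreal_ofReal] at h1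
  obtain ⟨m, hm, M, -, hb⟩ := bet_bd hc
  filter_upwards [h1, nu_disc] with w a b
  refine a ?_
  have := (hb w b).1
  simp only [ne_eq, ENNReal.ofReal_eq_zero, not_le]
  exact pow_pos (by linarith) _

lemma int_ta {c : ℂ} (hc : 0 < c.re) {f : ℂ → ℝ} (hf : AEStronglyMeasurable f (nu n)) :
    ∫ w, bet c w ^ (2*n+2) * f (ta c w) ∂(nu n) = ∫ w, f w ∂(nu n) := by
  have h := map_ta (n := n) hc
  have hf' : AEStronglyMeasurable f (Measure.map (ta c) ((nu n).withDensity (fun w => ENNReal.ofReal (bet c w ^ (2*n+2))))) := by rwa [h.map_eq]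
  rw [← h.map_eq, integral_map (meas_ta c).aemeasurable hf', h.map_eq]
  rw [integral_withDensity_eq_integral_toReal_smul ((meas_bet c).pow_const (2*n+2)).ennreal_ofReal (Eventually.of_forall fun p => ENNReal.ofReal_lt_top)]
  congr 1; funext w
  have : 0 ≤ bet c w := by unfold bet; positivity
  rw [ENNReal.toReal_ofReal (by positivity)]; rfl

lemma asm_ta {c : ℂ} (hc : 0 < c.re) {f : ℂ → ℝ} (hf : AEStronglyMeasurable f (nu n)) : AEStronglyMeasurable (fun w => f (ta c w)) (nu n) := by
  refine ⟨fun w => hf.mk f (ta c w), (hf.stronglyMeasurable_mk.comp_measurable (meas_ta c)), ae_ta hc hf.ae_eq_mk⟩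

lemma exists_C {c : ℂ} (hc : 0 < c.re) (m : ℕ) : ∃ T : H n →L[ℝ] H n, ∀ f, ∀ᵐ w ∂(nu n), T f w = bet c w ^ m * f (ta c w) := by
  obtain ⟨b, hb, M, hM, hbM⟩ := bet_bd hc
  have hms : ∀ f : H n, AEStronglyMeasurable (fun w => bet c w ^ m * f (ta c w)) (nu n) := fun f =>
    ((meas_bet c).pow_const m).aestronglyMeasurable.mul (asm_ta hc (Lp.aestronglyMeasurable f))
  have hle : ∀ f : H n, ∀ᵐ w ∂(nu n), (bet c w ^ m * f (ta c w))^2 ≤ (M^m)^2 * (b^(2*n+2))⁻¹ * (bet c w ^ (2*n+2) * (f (ta c w))^2) := by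
    intro f
    filter_upwards [nu_disc] with w hw
    obtain ⟨h1, h2⟩ := hbM w hw
    have h0 : 0 < bet c w := by linarith
    have : 1 ≤ (b^(2*n+2))⁻¹ * bet c w ^ (2*n+2) := by
      rw [inv_mul_eq_div, one_le_div (by positivity)]; gcongr
    calc (bet c w ^ m * f (ta c w))^2 = (bet c w ^ m)^2 * 1 * f (ta c w)^2 := by ring
      _ ≤ (M^m)^2 * ((b^(2*n+2))⁻¹ * bet c w ^ (2*n+2)) * f (ta c w)^2 := by gcongr
      _ = _ := by ring
  have hsq : ∀ f : H n, Integrable (fun w => f w ^ 2) (nu n) := fun f => (Lp.memLp f).integrable_sq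
  have hint : ∀ f : H n, Integrable (fun w => bet c w ^ (2*n+2) * (f (ta c w))^2) (nu n) := by
    intro f
    have h1 := (map_ta (n := n) hc).integrable_comp_of_integrable (hsq f)
    rw [integrable_withDensity_iff_integrable_smul' ((meas_bet c).pow_const (2*n+2)).ennreal_ofReal (Eventually.of_forall fun p => ENNReal.ofReal_lt_top)] at h1
    refine h1.congr (Eventually.of_forall fun w => ?_)
    have : 0 ≤ bet c w := by unfold bet; positivity
    simp only
    rw [ENNReal.toReal_ofReal (by positivity)]; rfl
  have hmem : ∀ f : H n, MemLp (fun w => bet c w ^ m * f (ta c w)) 2 (nu n) := by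
    intro f
    rw [memLp_two_iff_integrable_sq (hms f)]
    refine ((hint f).const_mul ((M^m)^2 * (b^(2*n+2))⁻¹)).mono' ((hms f).pow 2) ?_
    filter_upwards [hle f] with w h
    rwa [Real.norm_of_nonneg (sq_nonneg _)]
  have hnorm : ∀ f : H n, ‖(hmem f).toLp _‖ ≤ √((M^m)^2 * (b^(2*n+2))⁻¹) * ‖f‖ := by
    intro f
    refine (le_abs_self _).trans (abs_le_of_sq_le_sq ?_ (by positivity))
    rw [mul_pow, Real.sq_sqrt (by positivity), ← real_inner_self_eq_norm_sq, ← real_inner_self_eq_norm_sq f, inn, inn]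
    have e1 : ∫ w, f w * f w ∂(nu n) = ∫ w, bet c w ^ (2*n+2) * (f (ta c w))^2 ∂(nu n) := by
      rw [int_ta hc (f := fun w => f w ^2) (hsq f).1]; congr 1; funext w; ring
    have e2 : ∫ w, (hmem f).toLp _ w * (hmem f).toLp _ w ∂(nu n) = ∫ w, (bet c w ^ m * f (ta c w))^2 ∂(nu n) := by
      refine integral_congr_ae ?_
      filter_upwards [(hmem f).coeFn_toLp] with w b
      rw [b, sq]
    rw [e1, e2, ← integral_const_mul]
    exact integral_mono_ae (hmem f).integrable_sq ((hint f).const_mul _) (hle f)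
  refine ⟨LinearMap.mkContinuous ⟨⟨fun f => (hmem f).toLp _, fun f g => ?_⟩, fun r f => ?_⟩ _ hnorm, fun f => (hmem f).coeFn_toLp⟩
  · refine Lp.ext ?_
    filter_upwards [(hmem (f+g)).coeFn_toLp, coe_add ((hmem f).toLp _) ((hmem g).toLp _), (hmem f).coeFn_toLp, (hmem g).coeFn_toLp, ae_ta hc (coe_add f g)] with w a b c d e
    rw [a, b, c, d, e]; ring
  · refine Lp.ext ?_
    filter_upwards [(hmem (r • f)).coeFn_toLp, coe_smul r ((hmem f).toLp _), (hmem f).coeFn_toLp, ae_ta hc (coe_smul r f)] with w a b c e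
    simp only [RingHom.id_apply]
    rw [a, b, c, e]; ring

def Cop (n : ℕ) {c : ℂ} (hc : 0 < c.re) (m : ℕ) : H n →L[ℝ] H n := (exists_C hc m).choose
lemma Cop_ae {c : ℂ} (hc : 0 < c.re) (m : ℕ) (f : H n) : ∀ᵐ w ∂(nu n), Cop n hc m f w = bet c w ^ m * f (ta c w) := (exists_C hc m).choose_spec f

lemma inter (hn : 1 ≤ n) {c : ℂ} (hc : 0 < c.re) (h : H n) : A hn (Cop n hc (n+2) h) = Cop n hc n (A hn h) := by
  have hn' : (0:ℝ) < n := by exact_mod_cast hn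
  have key : ∀ P Q : Po, inner ℝ (A hn (Cop n hc (n+2) (evL n (Lop n P)))) (evL n (Lop n Q)) = inner ℝ (Cop n hc n (evL n P)) (evL n (Lop n Q)) := by
    intro P Q
    have hg := green_symm hn (good_poly (c := 1) (by simp) hn Q) (good_poly hc hn P)
    have m1 : ∀ (m : ℕ) (P Q : Po), AEStronglyMeasurable (fun w => bet c w ^ m * ev P (ta c w) * ev Q w) (nu n) := fun m P Q =>
      ((((meas_bet c).pow_const m).aestronglyMeasurable.mul (asm_ta hc (continuous_ev P).aestronglyMeasurable)).mul (continuous_ev Q).aestronglyMeasurable)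
    have e : ∀ (m : ℕ) (P Q : Po), inner ℝ (Cop n hc m (evL n P)) (evL n Q) =
       ∫ p, (nq n p ^ (2*n+2))⁻¹ * (bet c (Wm n p) ^ m * ev P (Vf c (sg n p)) * ev Q (Wm n p)) := by
      intro m P Q
      rw [inn]
      have : ∫ w, Cop n hc m (evL n P) w * evL n Q w ∂(nu n) = ∫ w, bet c w ^ m * ev P (ta c w) * ev Q w ∂(nu n) := by
        refine integral_congr_ae ?_
        filter_upwards [Cop_ae hc m (evL n P), ae_ta hc (evL_ae (n := n) P), evL_ae (n := n) Q] with w a b d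
        rw [a, b, d]
      rw [this, int_nu (m1 m P Q)]
      simp only [smul_eq_mul, ta_W hc]
    rw [A_sym, A_Lop, e, e]
    have hs : 0 < √c.re := Real.sqrt_pos.2 hc
    have c1 : ∫ p, (nq n p ^ (2*n+2))⁻¹ * (bet c (Wm n p) ^ (n+2) * ev (Lop n P) (Vf c (sg n p)) * ev Q (Wm n p)) =
        -(√c.re ^ n / (4 * n^2)) * ∫ p, uf n 1 Q p * Lf n c P p := by
      rw [← integral_const_mul]; congr 1; funext p
      have h1 := nq_pos p
      have h2 : 0 < ‖sg n p + c‖ := norm_pos_iff.2 (ne0 hc (sg_nonneg p))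
      rw [uf_one, Lf, bet_W, div_pow, mul_pow, pow_add √c.re n 2, Real.sq_sqrt hc.le, show 2*n+2 = n + (n+2) by ring, pow_add _ n (n+2)]
      field_simp
    have c2 : ∫ p, (nq n p ^ (2*n+2))⁻¹ * (bet c (Wm n p) ^ n * ev P (Vf c (sg n p)) * ev (Lop n Q) (Wm n p)) =
        -(√c.re ^ n / (4 * n^2)) * ∫ p, uf n c P p * Lf n 1 Q p := by
      rw [← integral_const_mul]; congr 1; funext p
      have h1 := nq_pos p
      have h2 : 0 < ‖sg n p + c‖ := norm_pos_iff.2 (ne0 hc (sg_nonneg p))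
      rw [Lf_one, uf, bet_W, div_pow, mul_pow, show 2*n+2 = n + (n+2) by ring, pow_add _ n (n+2)]
      field_simp
    rw [c1, c2, hg]
  have key2 : ∀ P, A hn (Cop n hc (n+2) (evL n (Lop n P))) = Cop n hc n (A hn (evL n (Lop n P))) := by
    intro P
    rw [A_Lop]
    refine ext_inner_right ℝ fun v => ?_
    have := Continuous.ext_on evL_dense (f := fun v => inner ℝ (A hn (Cop n hc (n+2) (evL n (Lop n P)))) v)
      (g := fun v => inner ℝ (Cop n hc n (evL n P)) v) (by fun_prop) (by fun_prop) (by
      rintro _ ⟨Q', rfl⟩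
      obtain ⟨Q, rfl⟩ := Lop_surj hn Q'
      exact key P Q)
    exact congrFun this v
  have := Continuous.ext_on evL_dense (f := fun h => A hn (Cop n hc (n+2) h)) (g := fun h => Cop n hc n (A hn h)) (by fun_prop) (by fun_prop) (by
    rintro _ ⟨Q', rfl⟩
    obtain ⟨Q, rfl⟩ := Lop_surj hn Q'
    exact key2 Q)
  exact congrFun this h
lemma rp_aux {θ : ℝ} (h0 : 0 < θ) (h1 : θ < 1) {x y r : ℝ} (hr : r ≤ 1/2) (hx : |x-1| ≤ r) (hy : |y-1| ≤ r) :
    |y^θ - x^θ| ≤ 2 * |y - x| ∧ |y^θ - x^θ - θ*(y-x)| ≤ 4 * r * |y-x| := by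
  have hr0 : 0 ≤ r := (abs_nonneg _).trans hx
  have low : ∀ t ∈ Set.Icc (1-r) (1+r), 1/2 ≤ t := fun t ht => by linarith [ht.1]
  have p2 : ∀ t : ℝ, 1/2 ≤ t → t^(θ-1-1) ≤ 4 := fun t ht => by
    calc t^(θ-1-1) ≤ (1/2:ℝ)^(θ-1-1) := Real.rpow_le_rpow_of_nonpos (by norm_num) ht (by linarith)
      _ ≤ (1/2:ℝ)^(-2:ℝ) := Real.rpow_le_rpow_of_exponent_ge (by norm_num) (by norm_num) (by linarith)
      _ = 4 := by rw [show (-2:ℝ) = ((-2:ℤ):ℝ) by norm_num, Real.rpow_intCast]; norm_num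
  have p1 : ∀ t : ℝ, 1/2 ≤ t → t^(θ-1) ≤ 2 := fun t ht => by
    calc t^(θ-1) ≤ (1/2:ℝ)^(θ-1) := Real.rpow_le_rpow_of_nonpos (by norm_num) ht (by linarith)
      _ ≤ (1/2:ℝ)^(-1:ℝ) := Real.rpow_le_rpow_of_exponent_ge (by norm_num) (by norm_num) (by linarith)
      _ = 2 := by rw [Real.rpow_neg_one]; norm_num
  have cv : Convex ℝ (Set.Icc (1-r) (1+r)) := convex_Icc _ _
  have mx : x ∈ Set.Icc (1-r) (1+r) := by rw [abs_le] at hx; constructor <;> linarith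
  have my : y ∈ Set.Icc (1-r) (1+r) := by rw [abs_le] at hy; constructor <;> linarith
  have mo : (1:ℝ) ∈ Set.Icc (1-r) (1+r) := by constructor <;> linarith
  have d1 : ∀ (e : ℝ), ∀ t ∈ Set.Icc (1-r) (1+r), HasDerivAt (fun t : ℝ => t^e) (e * t^(e-1)) t := fun e t ht =>
    Real.hasDerivAt_rpow_const (Or.inl (by linarith [low t ht]))
  constructor
  · refine cv.norm_image_sub_le_of_norm_hasDerivWithin_le (f := fun t : ℝ => t^θ) (fun t ht => (d1 θ t ht).hasDerivWithinAt) (C := 2) (fun t ht => ?_) mx my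
    have := low t ht
    rw [Real.norm_of_nonneg (by positivity)]
    nlinarith [p1 t this, Real.rpow_nonneg (by linarith : 0 ≤ t) (θ-1)]
  · have key : ∀ t ∈ Set.Icc (1-r) (1+r), |t^(θ-1) - 1| ≤ 4 * r := by
      intro t ht
      have h := cv.norm_image_sub_le_of_norm_hasDerivWithin_le (f := fun t : ℝ => t^(θ-1)) (fun t ht => (d1 (θ-1) t ht).hasDerivWithinAt) (C := 4) (fun t ht => ?_) mo ht
      · simp only [Real.one_rpow, Real.norm_eq_abs] at h
        refine h.trans ?_
        gcongr; rw [abs_le]; constructor <;> linarith [ht.1, ht.2]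
      · have := low t ht
        rw [norm_mul, Real.norm_of_nonneg (by positivity : 0 ≤ t^(θ-1-1)), Real.norm_eq_abs, abs_of_neg (by linarith)]
        nlinarith [p2 t this, Real.rpow_nonneg (by linarith : 0 ≤ t) (θ-1-1)]
    have h := cv.norm_image_sub_le_of_norm_hasDerivWithin_le (f := fun t : ℝ => t^θ - θ * t) (f' := fun t => θ * t^(θ-1) - θ * 1)
      (fun t ht => ((d1 θ t ht).sub ((hasDerivAt_id t).const_mul θ)).hasDerivWithinAt) (C := 4*r) (fun t ht => ?_) mx my
    · simp only [Real.norm_eq_abs] at h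
      convert h using 2; ring
    · rw [← mul_sub, norm_mul, Real.norm_of_nonneg h0.le, Real.norm_eq_abs]
      have := key t ht
      nlinarith [abs_nonneg (t^(θ-1) - 1)]

lemma rp_aux2 {θ : ℝ} (h0 : 0 < θ) (h1 : θ < 1) {x y : ℝ} (hx : |x-1| ≤ 1/2) (hy : |y-1| ≤ 1/2) :
    |y^(1+θ) - x^(1+θ) - (1+θ)*x^θ*(y-x)| ≤ 4 * |y-x|^2 := by
  have cv : Convex ℝ (Set.uIcc x y) := convex_uIcc _ _
  rw [abs_le] at hx hy
  have hb : ∀ t ∈ Set.uIcc x y, |t - 1| ≤ 1/2 ∧ |t - x| ≤ |y - x| := fun t ht => by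
    have := Set.uIcc_subset_Icc (a₂ := 1/2) (b₂ := 3/2) ⟨by linarith, by linarith⟩ ⟨by linarith, by linarith⟩ ht
    refine ⟨?_, Set.abs_sub_left_of_mem_uIcc ht⟩
    rw [abs_le]; constructor <;> linarith [this.1, this.2]
  have h := cv.norm_image_sub_le_of_norm_hasDerivWithin_le (f := fun t : ℝ => t^(1+θ) - (1+θ)*x^θ * t) (f' := fun t => (1+θ) * t^(1+θ-1) - (1+θ)*x^θ * 1)
      (fun t ht => ((Real.hasDerivAt_rpow_const (Or.inl (by have := (abs_le.1 (hb t ht).1).1; linarith))).sub ((hasDerivAt_id t).const_mul ((1+θ)*x^θ))).hasDerivWithinAt)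
      (C := 4*|y-x|) (fun t ht => ?_) Set.left_mem_uIcc Set.right_mem_uIcc
  · simp only [Real.norm_eq_abs] at h
    rw [sq, ← mul_assoc]; convert h using 2; ring
  · have e : (1+θ) * t^(1+θ-1) - (1+θ)*x^θ * 1 = (1+θ) * (t^θ - x^θ) := by rw [show 1+θ-1 = θ by ring]; ring
    rw [e, norm_mul, Real.norm_of_nonneg (by linarith), Real.norm_eq_abs]
    have := (rp_aux h0 h1 le_rfl (abs_le.2 hx) (hb t ht).1).1
    have := (hb t ht).2
    nlinarith [abs_nonneg (t^θ - x^θ)]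

lemma pow_aux (m : ℕ) : ∃ C > 0, ∀ b : ℝ, |b-1| ≤ 1 → |b^m - 1| ≤ C * |b-1| ∧ |b^m - 1 - m*(b-1)| ≤ C * |b-1|^2 := by
  induction m with
  | zero => exact ⟨1, by norm_num, fun b hb => by simp; positivity⟩
  | succ m ih =>
    obtain ⟨C, hC, h⟩ := ih
    refine ⟨2*C+1, by positivity, fun b hb => ?_⟩
    obtain ⟨h1, h2⟩ := h b hb
    have h0 := abs_nonneg (b-1)
    have e1 : b^(m+1) - 1 = (b^m-1)*(b-1) + (b^m - 1) + (b-1) := by ring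
    have e2 : b^(m+1) - 1 - (m+1:ℕ)*(b-1) = (b^m-1)*(b-1) + (b^m - 1 - m*(b-1)) := by push_cast; ring
    constructor
    · rw [e1]; refine (abs_add_three _ _ _).trans ?_
      rw [abs_mul]; nlinarith [mul_nonneg hC.le h0, abs_nonneg (b^m-1)]
    · rw [e2]; refine (abs_add_le _ _).trans ?_
      rw [abs_mul]; nlinarith [mul_le_mul_of_nonneg_right h1 h0, sq_nonneg (b-1)]

lemma one_le_of_sq {d e : ℝ} (h : d^2 = 4*e) (he : 1/4 ≤ e) (hd : 0 ≤ d) : 1 ≤ d := by nlinarith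

lemma bs_real {g r a X b E : ℝ} (hg0 : 0 ≤ g) (hg : g ≤ 1/8) (hr : |r| ≤ g) (ha : |a| ≤ g) (hX0 : 0 ≤ X) (hX : X ≤ g^2)
    (hE : E = 1+r+a+X) (hb : 0 ≤ b) (hb2 : b^2 * E = 1 + r) : 1/2 ≤ E ∧ |b-1| ≤ 4*g ∧ |b-1+a/2| ≤ 12*g^2 := by
  have g2 : g^2 ≤ g/8 := by rw [sq]; linarith [mul_le_mul_of_nonneg_left hg hg0]
  have hr' := abs_le.1 hr
  have ha' := abs_le.1 ha
  have hE1 : 1/2 ≤ E := by rw [hE]; linarith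
  have hE0 : 0 < E := by linarith
  have k1 : b^2 - 1 = (-a - X)/E := by rw [eq_div_iff hE0.ne', sub_mul, hb2, hE]; ring
  have k2 : b^2 - 1 + a = (a*(E-1) - X)/E := by rw [eq_div_iff hE0.ne', add_mul, sub_mul, hb2, hE]; ring
  have a1 : |b^2 - 1| ≤ 4*g := by
    rw [k1, abs_div, abs_of_pos hE0, div_le_iff₀ hE0]
    have : |-a - X| ≤ g + g^2 := by rw [abs_le]; constructor <;> linarith
    have : 4*g*(1/2) ≤ 4*g*E := by gcongr
    linarith
  have a2 : |b^2 - 1 + a| ≤ 8*g^2 := by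
    rw [k2, abs_div, abs_of_pos hE0, div_le_iff₀ hE0]
    have h1 : |E - 1| ≤ 3*g := by rw [abs_le]; constructor <;> linarith
    have h2 : |a*(E-1)| ≤ g * (3*g) := by rw [abs_mul]; gcongr
    have h3 : |a*(E-1) - X| ≤ g * (3*g) + g^2 := (abs_sub _ _).trans (by rw [abs_of_nonneg hX0]; linarith)
    have : 8*g^2*(1/2) ≤ 8*g^2*E := by gcongr
    refine h3.trans (le_trans (le_of_eq ?_) this); ring
  have a3 : |b - 1| ≤ 4*g := by
    refine le_trans ?_ a1
    rw [show b^2-1 = (b-1)*(b+1) by ring, abs_mul, abs_of_nonneg (by linarith : 0 ≤ b+1)]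
    exact le_mul_of_one_le_right (abs_nonneg _) (by linarith)
  refine ⟨hE1, a3, ?_⟩
  rw [show b - 1 + a/2 = (b^2-1+a)/2 - (b-1)^2/2 by ring]
  refine (abs_sub _ _).trans ?_
  rw [abs_div, abs_div, abs_of_nonneg (sq_nonneg (b-1)), ← sq_abs (b-1)]
  simp only [Nat.abs_ofNat]
  have : |b-1|^2 ≤ (4*g)^2 := by gcongr
  rw [mul_pow] at this
  linarith

lemma bet_sq {γ w : ℂ} (hg : ‖γ‖ ≤ 1/8) (hw : ‖w‖ ≤ 1) :
    |bet (1+γ) w - 1| ≤ 4 * ‖γ‖ ∧ |bet (1+γ) w - 1 + (γ * w).re / 2| ≤ 12 * ‖γ‖^2 ∧ ‖ta (1+γ) w - w‖ ≤ 8 * ‖γ‖ := by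
  have hg0 := norm_nonneg γ
  have hre : |γ.re| ≤ ‖γ‖ := Complex.abs_re_le_norm γ
  have hgw : |(γ*w).re| ≤ ‖γ‖ := (Complex.abs_re_le_norm _).trans (by rw [norm_mul]; exact mul_le_of_le_one_right hg0 hw)
  have h1w : ‖1+w‖ ≤ 2 := (norm_add_le _ _).trans (by simp; linarith)
  set E : ℝ := 1 + γ.re + (γ*w).re + ‖γ‖^2*‖1+w‖^2/4 with hE
  have hD : ‖Dc (1+γ) w‖^2 = 4 * E := by
    rw [hE, ← Complex.normSq_eq_norm_sq, ← Complex.normSq_eq_norm_sq, ← Complex.normSq_eq_norm_sq, Complex.normSq_apply, Complex.normSq_apply, Complex.normSq_apply]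
    simp [Dc]; ring
  have hX : ‖γ‖^2*‖1+w‖^2/4 ≤ ‖γ‖^2 := by
    have : ‖γ‖^2*‖1+w‖^2 ≤ ‖γ‖^2*2^2 := by gcongr
    linarith
  have hX0 : 0 ≤ ‖γ‖^2*‖1+w‖^2/4 := by positivity
  have hb0 : 0 ≤ bet (1+γ) w := by unfold bet; positivity
  have hDp : 0 < ‖Dc (1+γ) w‖ := by
    rcases (norm_nonneg (Dc (1+γ) w)).eq_or_lt' with h | h
    · exfalso; rw [h] at hD
      have := abs_le.1 hre; have := abs_le.1 hgw
      linarith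
    · exact h
  have hb2 : bet (1+γ) w ^ 2 * E = 1+γ.re := by
    have : E = ‖Dc (1+γ) w‖^2/4 := by rw [hD]; ring
    rw [bet, div_pow, mul_pow, this, Real.sq_sqrt (by simp; linarith [(abs_le.1 hre).1])]; simp; field_simp; try ring
  obtain ⟨hE1, c1, c2⟩ := bs_real hg0 hg hre hgw hX0 hX hE hb0 hb2
  refine ⟨c1, c2, ?_⟩
  · have hDn : 1 ≤ ‖Dc (1+γ) w‖ := by
      refine one_le_of_sq hD ?_ (norm_nonneg _); linarith
    have hD0 : Dc (1+γ) w ≠ 0 := by rw [← norm_pos_iff]; linarith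
    have e : ta (1+γ) w - w = (1+w)*(2*γ.re - γ*(1+w))/Dc (1+γ) w := by
      unfold ta; field_simp; unfold Dc; simp; ring
    rw [e, norm_div, norm_mul, div_le_iff₀ (by linarith)]
    have : ‖2*(γ.re:ℂ) - γ*(1+w)‖ ≤ 4*‖γ‖ := by
      refine (norm_sub_le _ _).trans ?_
      rw [norm_mul, norm_mul, Complex.norm_real, Real.norm_eq_abs]
      simp only [Complex.norm_ofNat]
      have := mul_le_mul_of_nonneg_left h1w hg0
      linarith
    calc _ ≤ 2 * (4*‖γ‖) := by gcongr
      _ = 8*‖γ‖ * 1 := by ring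
      _ ≤ _ := by gcongr

/-- expansions on the disc -/
lemma bet_exp (m : ℕ) : ∃ C > 0, ∀ γ w : ℂ, ‖γ‖ ≤ 1/8 → ‖w‖ ≤ 1 →
    |bet (1+γ) w ^ m - 1| ≤ C * ‖γ‖ ∧ |bet (1+γ) w ^ m - 1 + m/2 * (γ*w).re| ≤ C * ‖γ‖^2 ∧
    |(bet (1+γ) w ^ m)⁻¹ - 1| ≤ C * ‖γ‖ := by
  obtain ⟨C, hC, h⟩ := pow_aux m
  refine ⟨(4*C+16*C+12*m) + 2^m*(4*C), by positivity, fun γ w hg hw => ?_⟩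
  obtain ⟨h1, h2, -⟩ := bet_sq hg hw
  set b := bet (1+γ) w
  have hg0 := norm_nonneg γ
  obtain ⟨h3, h4⟩ := h b (by linarith)
  have hb : 1/2 ≤ b := by linarith [(abs_le.1 h1).1]
  have i1 : |b^m - 1| ≤ 4*C*‖γ‖ := h3.trans (by nlinarith)
  have hm : (0:ℝ) ≤ m := by positivity
  have hp : 0 ≤ 2^m*(4*C) := by positivity
  refine ⟨i1.trans ?_, ?_, ?_⟩
  · gcongr; nlinarith
  · have e : b^m - 1 + m/2 * (γ*w).re = (b^m - 1 - m*(b-1)) + m*(b - 1 + (γ*w).re/2) := by ring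
    rw [e]
    refine (abs_add_le _ _).trans ?_
    rw [abs_mul, abs_of_nonneg hm]
    have h5 : |b-1|^2 ≤ (4*‖γ‖)^2 := by gcongr
    have : C*|b-1|^2 ≤ C*(4*‖γ‖)^2 := by gcongr
    have : m * |b - 1 + (γ*w).re/2| ≤ m*(12*‖γ‖^2) := by gcongr
    have : 0 ≤ (4*C+2^m*(4*C))*‖γ‖^2 := by positivity
    nlinarith
  · have hbm : (1/2:ℝ)^m ≤ b^m := by gcongr
    have hb0 : 0 < b^m := by positivity
    have : |(b^m)⁻¹ - 1| ≤ 2^m * |b^m - 1| := by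
      rw [show (b^m)⁻¹ - 1 = -((b^m)⁻¹ * (b^m-1)) by field_simp; ring, abs_neg, abs_mul, abs_of_pos (inv_pos.2 hb0)]
      gcongr
      rw [inv_le_comm₀ hb0 (by positivity), ← one_div, ← one_div_pow]; exact hbm
    refine this.trans ?_
    have : 2^m * |b^m-1| ≤ 2^m*(4*C*‖γ‖) := by gcongr
    have : 0 ≤ (4*C+16*C+12*m)*‖γ‖ := by positivity
    nlinarith
def one (n : ℕ) : H n := evL n (Finsupp.single (0,0) 1)
lemma one_ae : ∀ᵐ w ∂(nu n), one n w = 1 := by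
  filter_upwards [evL_ae (n := n) (Finsupp.single (0,0) 1)] with w h
  rw [one, h]; simp [ev, mon]
lemma A_one (hn : 1 ≤ n) : A hn (one n) = one n := by
  have := A_Lop hn (Finsupp.single (0,0) 1)
  rwa [Lop_single, show Lam n (0,0) = 1 by
    have : (n:ℝ) ≠ 0 := by positivity
    simp [Lam]; field_simp, show ((4 * ((0,0):ℕ×ℕ).1 * ((0,0):ℕ×ℕ).2 / n^2 : ℝ)) = 0 by simp,
    Complex.ofReal_zero, Complex.ofReal_one, mul_zero, mul_one, Finsupp.single_zero, sub_zero] at this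
lemma P_one (hn : 1 ≤ n) : Pn hn (one n) = 0 := by
  have h1 : inner ℝ (Pn hn (one n)) (Pn hn (one n)) = inner ℝ (Pn hn (one n)) (one n) := by
    rw [← Pn_sym hn (Pn hn (one n)), P_P hn]
  have h2 := A_sym hn (Pn hn (one n)) (one n)
  rw [A_one, A_P, real_inner_smul_left, ← h1] at h2
  have h3 := th_lt (n := n)
  have : inner ℝ (Pn hn (one n)) (Pn hn (one n)) = 0 := by
    by_contra h
    exact h3.ne (mul_right_cancel₀ h (by rw [h2, one_mul]))
  exact inner_self_eq_zero.1 this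

def cl (δ x : ℝ) : ℝ := max (min x δ) (-δ)
lemma cl_bd {δ : ℝ} (h : 0 ≤ δ) (x : ℝ) : |cl δ x| ≤ δ := by
  rw [cl, abs_le]; exact ⟨le_max_right _ _, max_le (min_le_right _ _) (by linarith)⟩
lemma cl_lip (δ x y : ℝ) : |cl δ x - cl δ y| ≤ |x - y| :=
  (abs_max_sub_max_le_abs _ _ _).trans ((abs_min_sub_min_le_max _ _ _ _).trans (by simp))
lemma cl_id {δ x : ℝ} (h : |x| ≤ δ) : cl δ x = x := by
  rw [abs_le] at h; rw [cl, min_eq_left h.2, max_eq_left h.1]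

def FF (θ δ m x : ℝ) : ℝ := m * (1 + cl δ x)^θ - 1 - θ * cl δ x
lemma FF_bd {θ δ m η x y : ℝ} (h0 : 0 < θ) (h1 : θ < 1) (hδ : 0 ≤ δ) (hδ' : δ ≤ 1/2) (hm : |m - 1| ≤ η) :
    |FF θ δ m x| ≤ 2*η + 4*δ^2 ∧ |FF θ δ m x - FF θ δ m y| ≤ (2*η+4*δ) * |x-y| := by
  have bx : |1 + cl δ x - 1| ≤ δ := by simpa using cl_bd hδ x
  have bc : |1 + cl δ y - 1| ≤ δ := by simpa using cl_bd hδ y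
  have b1 : |(1:ℝ) - 1| ≤ δ := by simpa using hδ
  have hη : 0 ≤ η := (abs_nonneg _).trans hm
  constructor
  · obtain ⟨c1, c2⟩ := rp_aux h0 h1 hδ' b1 bx
    rw [Real.one_rpow] at c1 c2
    rw [add_sub_cancel_left] at c1 c2 bx
    have e : FF θ δ m x = (m-1) * (1 + cl δ x)^θ + ((1 + cl δ x)^θ - 1 - θ * cl δ x) := by unfold FF; ring
    rw [e]
    refine (abs_add_le _ _).trans ?_
    rw [abs_mul]
    have : |(1 + cl δ x)^θ| ≤ 2 := by
      have c3 : |(1 + cl δ x)^θ - 1| ≤ 1 := c1.trans (by linarith)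
      rw [abs_le] at c3 ⊢; constructor <;> linarith
    have : |m-1| * |(1 + cl δ x)^θ| ≤ η * 2 := by gcongr
    have : 4*δ*|cl δ x| ≤ 4*δ*δ := by gcongr
    rw [sq]; linarith
  · obtain ⟨c1, c2⟩ := rp_aux h0 h1 hδ' bc bx
    rw [add_sub_add_left_eq_sub] at c1 c2
    have e : FF θ δ m x - FF θ δ m y = (m-1) * ((1 + cl δ x)^θ - (1 + cl δ y)^θ) + ((1 + cl δ x)^θ - (1 + cl δ y)^θ - θ * (cl δ x - cl δ y)) := by unfold FF; ring
    rw [e]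
    refine (abs_add_le _ _).trans ?_
    rw [abs_mul]
    have l := cl_lip δ x y
    calc _ ≤ η * (2 * |cl δ x - cl δ y|) + 4*δ*|cl δ x - cl δ y| := by gcongr
      _ = (2*η+4*δ) * |cl δ x - cl δ y| := by ring
      _ ≤ _ := by gcongr

def IsLS (hn : 1 ≤ n) (M : ℂ → ℝ) (c : ℝ) (g : H n) (a : ℂ) : Prop :=
  (∀ᵐ w ∂(nu n), |g w| ≤ c) ∧ Pn hn g = 0 ∧ ‖a‖ ≤ c ∧ ∀ᵐ w ∂(nu n), A hn (one n + g) w = M w * (1 + g w)^(th n) + nv n a w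

lemma LS_exists (hn : 1 ≤ n) : ∃ K > 0, ∃ η₀ > 0, ∀ (M : ℂ → ℝ) (η : ℝ), AEStronglyMeasurable M (nu n) → 0 ≤ η → η ≤ η₀ →
    (∀ᵐ w ∂(nu n), |M w - 1| ≤ η) → ∃ g a, IsLS hn M (K * η) g a := by
  obtain ⟨C, hC, hR⟩ := R_bd hn
  obtain ⟨CP, hCP, hP⟩ := Pn_form hn
  have hS := Sn_pos (n := n)
  set K := 3*C with hK
  have hK0 : 0 < K := by positivity
  set B := 2*K + 4*K^2 + 2*(‖R hn‖*(2+4*K)) + 1 with hB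
  have hB0 : 0 < B := by positivity
  refine ⟨3*C + CP*(Sn n*3), by positivity, 1/B, by positivity, fun M η hM hη hη' hMb => ?_⟩
  rw [le_div_iff₀ hB0, hB] at hη'
  have q1 : 0 ≤ η*(K^2) := by positivity
  have q2 : 0 ≤ η*K := by positivity
  have q3 : 0 ≤ η*(‖R hn‖*(2+4*K)) := by positivity
  set δ := K*η with hδ
  have hδ0 : 0 ≤ δ := by positivity
  have hδ1 : δ ≤ 1/2 := by linarith
  have hδ2 : 4*δ^2 ≤ η := by
    have : η*(4*K^2*η) ≤ η*1 := by gcongr; linarith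
    rw [hδ]; linarith
  have h0 := th_pos hn
  have h1 := th_lt (n := n)
  have hmeas : ∀ g : H n, AEStronglyMeasurable (fun w => FF (th n) δ (M w) (g w)) (nu n) := fun g => by
    have hg : AEMeasurable g (nu n) := (Lp.aestronglyMeasurable g).aemeasurable
    have hM' := hM.aemeasurable
    have hc : AEMeasurable (fun w => cl δ (g w)) (nu n) := by unfold cl; exact (hg.min aemeasurable_const).max aemeasurable_const
    unfold FF
    exact (((hM'.mul ((hc.const_add 1).pow_const (th n))).sub_const 1).sub (hc.const_mul _)).aestronglyMeasurable
  have hbd : ∀ g : H n, ∀ᵐ w ∂(nu n), |FF (th n) δ (M w) (g w)| ≤ 3*η := fun g => by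
    filter_upwards [hMb] with w h
    have := (FF_bd (x := g w) (y := 0) h0 h1 hδ0 hδ1 h).1
    linarith
  let Fo : H n → H n := fun g => (memLp_bd (hmeas g) (hbd g)).toLp _
  have Fo_ae : ∀ g, ∀ᵐ w ∂(nu n), Fo g w = FF (th n) δ (M w) (g w) := fun g => MemLp.coeFn_toLp _
  have Fl : ∀ g g', ‖Fo g - Fo g'‖ ≤ (2*η+4*δ) * ‖g - g'‖ := fun g g' => by
    refine Lp.norm_le_mul_norm_of_ae_le_mul ?_
    filter_upwards [hMb, Fo_ae g, Fo_ae g', coe_sub (Fo g) (Fo g'), coe_sub g g'] with w h a1 a2 a3 a4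
    rw [a3, a4, a1, a2, Real.norm_eq_abs, Real.norm_eq_abs]
    exact (FF_bd h0 h1 hδ0 hδ1 h).2
  have ct : ContractingWith (1/2) (fun g => R hn (Fo g)) := by
    refine ⟨by rw [← NNReal.coe_lt_coe]; norm_num, LipschitzWith.of_dist_le_mul fun g g' => ?_⟩
    rw [dist_eq_norm, dist_eq_norm, ← map_sub]
    refine ((R hn).le_opNorm _).trans ?_
    have e : ‖R hn‖*(2*η+4*δ) ≤ 1/2 := by rw [hδ]; linarith
    calc _ ≤ ‖R hn‖ * ((2*η+4*δ) * ‖g - g'‖) := by gcongr; exact Fl g g'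
      _ = ‖R hn‖ * (2*η+4*δ) * ‖g - g'‖ := by ring
      _ ≤ 1/2 * ‖g-g'‖ := by gcongr
      _ = _ := by simp
  set g := ct.fixedPoint _ with hg
  have fx : R hn (Fo g) = g := ct.fixedPoint_isFixedPt
  have Fb : ∀ᵐ w ∂(nu n), |Fo g w| ≤ 3*η := by
    filter_upwards [Fo_ae g, hbd g] with w h1 h2; rw [h1]; exact h2
  have gb : ∀ᵐ w ∂(nu n), |g w| ≤ δ := by
    have := hR (Fo g) (3*η) (by positivity) Fb
    rw [fx] at this
    filter_upwards [this] with w hw; rw [hδ, hK]; linarith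
  obtain ⟨a, ha, hab⟩ := hP (Fo g)
  have nF := norm_bd (by positivity) Fb
  have hle : 0 ≤ CP*(Sn n*3)*η := by positivity
  refine ⟨g, -a, ?_, ?_, ?_, ?_⟩
  · filter_upwards [gb] with w h; rw [hδ, hK] at h; linarith
  · rw [← fx, P_R]
  · rw [norm_neg]
    have : CP*‖Fo g‖ ≤ CP*(Sn n*(3*η)) := by gcongr
    have : 0 ≤ 3*C*η := by positivity
    linarith
  · have e := A_R hn (Fo g)
    rw [fx, ha] at e
    have e2 : A hn (one n + g) = one n + (th n • g + (Fo g - nv n a)) := by rw [map_add, A_one, ← e]; abel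
    rw [e2]
    filter_upwards [coe_add (one n) (th n • g + (Fo g - nv n a)), coe_add (th n • g) (Fo g - nv n a), coe_sub (Fo g) (nv n a),
      coe_smul (th n) g, one_ae (n := n), Fo_ae g, gb, nv_ae (n := n) a, nv_ae (n := n) (-a)] with w b1 b2 b3 b4 b5 b6 b7 b8 b9
    rw [b1, b2, b3, b4, b5, b6, b8, b9, FF, cl_id b7, neg_mul, Complex.neg_re]; ring
lemma integ_bd {f : ℂ → ℝ} (hf : AEStronglyMeasurable f (nu n)) {C : ℝ} (h : ∀ᵐ w ∂(nu n), |f w| ≤ C) : Integrable f (nu n) :=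
  Integrable.of_bound hf C h
lemma asm (h : H n) : AEStronglyMeasurable h (nu n) := Lp.aestronglyMeasurable h
lemma asm_rpow (h : H n) (e : ℝ) : AEStronglyMeasurable (fun w => h w ^ e) (nu n) :=
  ((asm h).aemeasurable.pow_const e).aestronglyMeasurable

def J (hn : 1 ≤ n) (M : ℂ → ℝ) (h : H n) : ℝ := 1/2 * inner ℝ h (A hn h) - 1/(1 + th n) * ∫ w, M w * h w ^ (1 + th n) ∂(nu n)

lemma bet_nonneg (c w : ℂ) : 0 ≤ bet c w := by unfold bet; positivity

lemma inner_Cop {c : ℂ} (hc : 0 < c.re) (f g : H n) : inner ℝ (Cop n hc n f) (Cop n hc (n+2) g) = inner ℝ f g := by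
  rw [inn, inn, ← int_ta hc ((asm f).fun_mul (asm g))]
  refine integral_congr_ae ?_
  filter_upwards [Cop_ae hc n f, Cop_ae hc (n+2) g] with w h1 h2
  rw [h1, h2]; ring

lemma bet_rpow (c w : ℂ) {x : ℝ} (hx : 0 ≤ x) : (bet c w ^ (n+2) * x)^(th n) = bet c w ^ n * x^(th n) := by
  rw [Real.mul_rpow (pow_nonneg (bet_nonneg _ _) _) hx, ← Real.rpow_natCast, ← Real.rpow_mul (bet_nonneg _ _), ← Real.rpow_natCast]
  congr 2; unfold th; push_cast; field_simp
lemma bet_rpow' (c w : ℂ) {x : ℝ} (hx : 0 ≤ x) : (bet c w ^ (n+2) * x)^(1+th n) = bet c w ^ (2*n+2) * x^(1+th n) := by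
  have h0 : 0 ≤ th n := by unfold th; positivity
  rw [Real.rpow_add_of_nonneg (by have := bet_nonneg c w; positivity) zero_le_one h0, bet_rpow c w hx, Real.rpow_add_of_nonneg hx zero_le_one h0,
    Real.rpow_one, Real.rpow_one]; ring

lemma J_inv (hn : 1 ≤ n) {c : ℂ} (hc : 0 < c.re) {M M' : ℂ → ℝ} (hM : AEStronglyMeasurable M' (nu n)) (h : H n)
    (hp : ∀ᵐ w ∂(nu n), 0 ≤ h w) (hMM : ∀ᵐ w ∂(nu n), M' (ta c w) = M w) : J hn M (Cop n hc (n+2) h) = J hn M' h := by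
  rw [J, J, inter, real_inner_comm, inner_Cop, real_inner_comm, ← int_ta hc (hM.fun_mul (asm_rpow h (1+th n)))]
  congr 2
  refine integral_congr_ae ?_
  filter_upwards [Cop_ae hc (n+2) h, hMM, ae_ta hc hp] with w h1 h2 h3
  rw [h1, bet_rpow' _ _ h3, h2]; ring

lemma inn_sq (d : H n) : Integrable (fun w => |d w|^2) (nu n) ∧ ∫ w, |d w|^2 ∂(nu n) = ‖d‖^2 := by
  constructor
  · simpa using (Lp.memLp d).integrable_sq
  · rw [← real_inner_self_eq_norm_sq, inn]; simp [sq]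

lemma J_exp (hn : 1 ≤ n) : ∃ C > 0, ∀ (M : ℂ → ℝ) (h h' : H n), AEStronglyMeasurable M (nu n) → (∀ᵐ w ∂(nu n), |M w - 1| ≤ 1) →
    (∀ᵐ w ∂(nu n), |h w - 1| ≤ 1/2) → (∀ᵐ w ∂(nu n), |h' w - 1| ≤ 1/2) →
    |J hn M h' - J hn M h - (inner ℝ (A hn h) (h' - h) - ∫ w, M w * h w ^ (th n) * (h' - h) w ∂(nu n))| ≤ C * ‖h' - h‖^2 := by
  refine ⟨‖A hn‖ + 8, by positivity, fun M h h' hM hMb hb hb' => ?_⟩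
  have h0 := th_pos hn
  have h1 := th_lt (n := n)
  set d := h' - h with hd
  have e1 : inner ℝ h' (A hn h') = inner ℝ h (A hn h) + 2 * inner ℝ (A hn h) d + inner ℝ d (A hn d) := by
    have : h' = h + d := by rw [hd]; abel
    rw [this, map_add, inner_add_left, inner_add_right, inner_add_right, ← A_sym hn h d, real_inner_comm (A hn h) d]; ring
  have dd := coe_sub h' h
  have pw : ∀ x : ℝ, |x - 1| ≤ 1/2 → ∀ e : ℝ, 0 ≤ e → |x^e| ≤ 2^e := fun x hx e he => by
    rw [abs_le] at hx
    rw [abs_of_nonneg (Real.rpow_nonneg (by linarith) _)]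
    exact Real.rpow_le_rpow (by linarith) (by linarith) he
  have i1 : ∀ k : H n, (∀ᵐ w ∂(nu n), |k w - 1| ≤ 1/2) → Integrable (fun w => M w * k w ^ (1 + th n)) (nu n) := fun k hk => by
    refine integ_bd (hM.mul (asm_rpow k _)) (C := 2 * 2^(1+th n)) ?_
    filter_upwards [hMb, hk] with w a1 a2
    rw [abs_mul]
    have := pw _ a2 (1+th n) (by linarith)
    gcongr
    rw [abs_le] at *; constructor <;> linarith
  have i2 : Integrable (fun w => M w * h w ^ (th n) * d w) (nu n) := by
    refine integ_bd ((hM.mul (asm_rpow h _)).mul (asm d)) (C := 2 * 2^(th n) * 1) ?_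
    filter_upwards [hMb, hb, hb', dd] with w a1 a2 a3 a4
    rw [abs_mul, abs_mul]
    have := pw _ a2 (th n) (by linarith)
    gcongr
    · rw [abs_le] at *; constructor <;> linarith
    · rw [a4]; rw [abs_le] at *; constructor <;> linarith
  have e2 : J hn M h' - J hn M h - (inner ℝ (A hn h) d - ∫ w, M w * h w ^ (th n) * d w ∂(nu n)) = 1/2 * inner ℝ d (A hn d) -
      1/(1+th n) * ∫ w, M w * (h' w ^ (1+th n) - h w ^ (1+th n) - (1+th n) * h w ^ (th n) * d w) ∂(nu n) := by
    have : ∫ w, M w * (h' w ^ (1+th n) - h w ^ (1+th n) - (1+th n) * h w ^ (th n) * d w) ∂(nu n) =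
        (∫ w, M w * h' w ^ (1+th n) ∂(nu n)) - (∫ w, M w * h w ^ (1+th n) ∂(nu n)) - (1+th n) * ∫ w, M w * h w ^ (th n) * d w ∂(nu n) := by
      rw [← integral_const_mul, ← integral_sub (i1 h' hb') (i1 h hb), ← integral_sub (show Integrable (fun w => M w * h' w ^ (1+th n) - M w * h w ^ (1+th n)) (nu n) from (i1 h' hb').sub (i1 h hb)) (i2.const_mul _)]
      refine integral_congr_ae (Eventually.of_forall fun w => ?_)
      ring
    rw [this, J, J, e1]; field_simp; ring
  rw [e2]
  refine (abs_sub _ _).trans ?_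
  rw [abs_mul, abs_mul]
  have f1 : |inner ℝ d (A hn d)| ≤ ‖A hn‖ * ‖d‖^2 := (abs_real_inner_le_norm _ _).trans (by
    calc _ ≤ ‖d‖ * (‖A hn‖ * ‖d‖) := by gcongr; exact (A hn).le_opNorm d
      _ = _ := by ring)
  have f2 : |∫ w, M w * (h' w ^ (1+th n) - h w ^ (1+th n) - (1+th n) * h w ^ (th n) * d w) ∂(nu n)| ≤ 8 * ‖d‖^2 := by
    rw [← (inn_sq d).2, ← integral_const_mul]
    rw [← Real.norm_eq_abs]
    refine norm_integral_le_of_norm_le ((inn_sq d).1.const_mul 8) ?_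
    filter_upwards [hMb, hb, hb', dd] with w a1 a2 a3 a4
    have := rp_aux2 h0 h1 a2 a3
    rw [a4, norm_mul, Real.norm_eq_abs, Real.norm_eq_abs]
    calc _ ≤ 2 * (4 * |h' w - h w|^2) := by gcongr; rw [abs_le] at a1 ⊢; constructor <;> linarith
      _ = _ := by ring
  have g1 : |1/(1+th n)| ≤ 1 := by rw [abs_of_pos (by positivity), div_le_one (by positivity)]; linarith
  have g2 : |(1/2:ℝ)| = 1/2 := abs_of_pos (by norm_num)
  rw [g2]
  have : |1/(1+th n)| * |∫ w, M w * (h' w ^ (1+th n) - h w ^ (1+th n) - (1+th n) * h w ^ (th n) * d w) ∂(nu n)| ≤ 1 * (8 * ‖d‖^2) := by gcongr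
  have : 0 ≤ ‖A hn‖ * ‖d‖^2 := by positivity
  linarith
lemma re_pos {γ : ℂ} (h : ‖γ‖ ≤ 1/8) : 0 < (1+γ).re := by
  have := abs_le.1 ((Complex.abs_re_le_norm γ).trans h)
  simp; linarith

lemma Cop_close (n : ℕ) : ∃ C > 0, ∀ (γ : ℂ) (hg : ‖γ‖ ≤ 1/8) (a : ℂ),
    ∀ᵐ w ∂(nu n), |(Cop n (re_pos hg) n (nv n a) - nv n a) w| ≤ C * ‖γ‖ * ‖a‖ := by
  obtain ⟨C, hC, h⟩ := bet_exp n
  refine ⟨C + 8, by positivity, fun γ hg a => ?_⟩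
  filter_upwards [coe_sub (Cop n (re_pos hg) n (nv n a)) (nv n a), Cop_ae (re_pos hg) n (nv n a), ae_ta (re_pos hg) (nv_ae (n := n) a),
    ae_ta (re_pos hg) (nu_disc (n := n)), nv_ae (n := n) a, nu_disc (n := n)] with w h1 h2 h3 h4 h5 h6
  rw [h1, h2, h3, h5]
  have b1 := (h γ w hg h6).1
  have b2 := (bet_sq hg h6).2.2
  have e : bet (1+γ) w ^ n * (a * ta (1+γ) w).re - (a*w).re = (bet (1+γ) w ^ n - 1) * (a * ta (1+γ) w).re + (a * (ta (1+γ) w - w)).re := by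
    rw [mul_sub a, Complex.sub_re]; ring
  have b3 : |(a * ta (1+γ) w).re| ≤ ‖a‖ := (Complex.abs_re_le_norm _).trans (by rw [norm_mul]; exact mul_le_of_le_one_right (norm_nonneg _) h4)
  have b4 : |(a * (ta (1+γ) w - w)).re| ≤ ‖a‖ * (8*‖γ‖) := (Complex.abs_re_le_norm _).trans (by rw [norm_mul]; gcongr)
  rw [e]
  refine (abs_add_le _ _).trans ?_
  rw [abs_mul]
  have : |bet (1+γ) w ^ n - 1| * |(a * ta (1+γ) w).re| ≤ C*‖γ‖*‖a‖ := by gcongr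
  linarith

lemma Cop_bdd (n : ℕ) : ∃ C > 0, ∀ (γ : ℂ) (hg : ‖γ‖ ≤ 1/8) (f : H n) (r : ℝ), 0 ≤ r → (∀ᵐ w ∂(nu n), |f w| ≤ r) →
    ∀ᵐ w ∂(nu n), |Cop n (re_pos hg) (n+2) f w - f (ta (1+γ) w)| ≤ C * ‖γ‖ * r ∧ |Cop n (re_pos hg) (n+2) f w| ≤ C * r := by
  obtain ⟨C, hC, h⟩ := bet_exp (n+2)
  refine ⟨C + 1, by positivity, fun γ hg f r hr hf => ?_⟩
  filter_upwards [Cop_ae (re_pos hg) (n+2) f, ae_ta (re_pos hg) hf, nu_disc (n := n)] with w h1 h2 h3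
  have b1 := (h γ w hg h3).1
  have c1 : |Cop n (re_pos hg) (n+2) f w - f (ta (1+γ) w)| ≤ C * ‖γ‖ * r := by
    rw [h1, show bet (1+γ) w ^ (n+2) * f (ta (1+γ) w) - f (ta (1+γ) w) = (bet (1+γ) w ^ (n+2) - 1) * f (ta (1+γ) w) by ring, abs_mul]
    gcongr
  have g0 := norm_nonneg γ
  constructor
  · refine c1.trans ?_; gcongr; linarith
  · have := abs_add_le (Cop n (re_pos hg) (n+2) f w - f (ta (1+γ) w)) (f (ta (1+γ) w))
    rw [sub_add_cancel] at this
    have : C*‖γ‖*r ≤ C*1*r := by gcongr; linarith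
    linarith

lemma dual (n : ℕ) : ∃ C > 0, ∀ (γ : ℂ) (hg : ‖γ‖ ≤ 1/8) (a : ℂ) (f : H n) (r : ℝ), 0 ≤ r → (∀ᵐ w ∂(nu n), |f w| ≤ r) →
    |inner ℝ (nv n a) (Cop n (re_pos hg) (n+2) f) - inner ℝ (nv n a) f| ≤ C * ‖γ‖ * ‖a‖ * r := by
  obtain ⟨C, hC, h⟩ := Cop_close n
  obtain ⟨D, hD, h'⟩ := Cop_bdd n
  have := Sn_pos (n := n)
  refine ⟨Sn n * C * (Sn n * D), by positivity, fun γ hg a f r hr hf => ?_⟩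
  rw [← inner_Cop (re_pos hg) (nv n a) f, ← inner_sub_left, ← neg_sub, inner_neg_left, abs_neg]
  refine (abs_real_inner_le_norm _ _).trans ?_
  have n1 := norm_bd (by positivity) (h γ hg a)
  have n2 := norm_bd (by positivity) ((h' γ hg f r hr hf).mono fun w h => h.2)
  calc _ ≤ (Sn n * (C * ‖γ‖ * ‖a‖)) * (Sn n * (D * r)) := by gcongr
    _ = _ := by ring

lemma nv_P (hn : 1 ≤ n) (a : ℂ) {f : H n} (hf : Pn hn f = 0) : inner ℝ (nv n a) f = 0 := by
  rw [← Pn_nv hn a, Pn_sym, hf, inner_zero_right]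

lemma dual_one (hn : 1 ≤ n) : ∃ C > 0, ∀ (γ : ℂ) (hg : ‖γ‖ ≤ 1/8) (a : ℂ),
    |inner ℝ (nv n a) (Cop n (re_pos hg) (n+2) (one n)) + (n+2)/2 * inner ℝ (nv n a) (nv n γ)| ≤ C * ‖a‖ * ‖γ‖^2 := by
  obtain ⟨C, hC, h⟩ := bet_exp (n+2)
  have := Sn_pos (n := n)
  refine ⟨Sn n * 1 * Sn n * C, by positivity, fun γ hg a => ?_⟩
  have e : inner ℝ (nv n a) (Cop n (re_pos hg) (n+2) (one n)) + (n+2)/2 * inner ℝ (nv n a) (nv n γ) =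
      inner ℝ (nv n a) (Cop n (re_pos hg) (n+2) (one n) - one n + (((n:ℝ)+2)/2) • nv n γ) := by
    rw [inner_add_right, inner_sub_right, real_inner_smul_right, nv_P hn a (P_one hn)]; ring
  rw [e]
  refine (abs_real_inner_le_norm _ _).trans ?_
  have n1 := norm_bd (by positivity) (nv_bd (n := n) a)
  have n2 : ‖Cop n (re_pos hg) (n+2) (one n) - one n + (((n:ℝ)+2)/2) • nv n γ‖ ≤ Sn n * (C*‖γ‖^2) := by
    refine norm_bd (by positivity) ?_
    filter_upwards [coe_add (Cop n (re_pos hg) (n+2) (one n) - one n) ((((n:ℝ)+2)/2) • nv n γ), coe_sub (Cop n (re_pos hg) (n+2) (one n)) (one n),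
      coe_smul (((n:ℝ)+2)/2) (nv n γ), nv_ae (n := n) γ, Cop_ae (re_pos hg) (n+2) (one n), ae_ta (re_pos hg) (one_ae (n := n)), one_ae (n := n), nu_disc (n := n)]
      with w a1 a2 a3 a4 a5 a6 a7 a8
    rw [a1, a2, a3, a4, a5, a6, a7, mul_one]
    simpa using (h γ w hg a8).2.1
  calc _ ≤ (Sn n * ‖a‖) * (Sn n * (C * ‖γ‖^2)) := by gcongr
    _ = _ := by ring
lemma R_nv (hn : 1 ≤ n) (a : ℂ) : R hn (nv n a) = 0 := by rw [← Pn_nv hn a, R_P]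

lemma onep_ae (g : H n) : ∀ᵐ w ∂(nu n), (one n + g) w = 1 + g w := by
  filter_upwards [coe_add (one n) g, one_ae (n := n)] with w h1 h2; rw [h1, h2]

/-- first variation of the reduced functional -/
lemma var (hn : 1 ≤ n) {K : ℝ} (hK : 0 < K) : ∃ C > 0, ∃ γ₀ > 0, γ₀ ≤ 1/8 ∧ ∃ η₁ > 0, ∀ (M M' : ℂ → ℝ) (η : ℝ) (γ : ℂ) (g g' : H n) (a a' : ℂ),
    0 ≤ η → η ≤ η₁ → ‖γ‖ ≤ γ₀ → AEStronglyMeasurable M (nu n) → AEStronglyMeasurable M' (nu n) →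
    (∀ᵐ w ∂(nu n), |M w - 1| ≤ η) → (∀ᵐ w ∂(nu n), M' (ta (1+γ) w) = M w) →
    IsLS hn M (K*η) g a → IsLS hn M' (K*η) g' a' →
    |J hn M' (one n + g') - J hn M (one n + g) + (n+2)/2 * inner ℝ (nv n a) (nv n γ)| ≤ C * (η * ‖a‖ * ‖γ‖ + ‖γ‖^2) := by
  obtain ⟨C1, hC1, h1⟩ := Cop_close n
  obtain ⟨C2, hC2, h2⟩ := Cop_bdd n
  obtain ⟨C3, hC3, h3⟩ := dual n
  obtain ⟨C4, hC4, h4⟩ := dual_one hn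
  obtain ⟨C5, hC5, h5⟩ := J_exp hn
  obtain ⟨c, hc, h6⟩ := nv_norm_le hn
  obtain ⟨CP, hCP, hP⟩ := Pn_form hn
  have hS := Sn_pos (n := n)
  obtain ⟨Rn, hRn⟩ : ∃ Rn, Rn = ‖R hn‖ := ⟨_, rfl⟩
  have hRn0 : 0 ≤ Rn := hRn ▸ norm_nonneg _
  obtain ⟨ρ, hρ⟩ : ∃ ρ : ℝ, ρ = 1/(4+16*Rn) := ⟨_, rfl⟩
  have hρ0 : 0 < ρ := by rw [hρ]; positivity
  have hρ1 : ρ*(4+16*Rn) = 1 := by rw [hρ]; field_simp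
  have hρ2 : 0 ≤ ρ*Rn := by positivity
  obtain ⟨D, hD⟩ : ∃ D : ℝ, D = 2*(C3*2/c + Rn*(Sn n*C1)) := ⟨_, rfl⟩
  have hD0 : 0 < D := by rw [hD]; positivity
  refine ⟨C5*D^2 + C4 + C3*K, by positivity, min (1/8) (ρ/(4*C2)), lt_min (by norm_num) (by positivity), min_le_left _ _,
    min (ρ/2) (ρ/(2*K)), lt_min (by positivity) (by positivity), ?_⟩
  intro M M' η γ g g' a a' hη hη1 hγ hM hM' hMb hMM hL hL'
  have hg : ‖γ‖ ≤ 1/8 := hγ.trans (min_le_left _ _)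
  have hg2 : 2*C2*‖γ‖ ≤ ρ/2 := by
    have := hγ.trans (min_le_right _ _); rw [le_div_iff₀ (by positivity)] at this; linarith
  have hη2 : η ≤ ρ/2 := hη1.trans (min_le_left _ _)
  have hη3 : K*η ≤ ρ/2 := by
    have := hη1.trans (min_le_right _ _); rw [le_div_iff₀ (by positivity)] at this; linarith
  clear hη1 hγ
  have hKη : 0 ≤ K*η := by positivity
  have g0 := norm_nonneg γ
  obtain ⟨l1, l2, l3, l4⟩ := hL
  obtain ⟨m1, m2, m3, m4⟩ := hL'
  have th0 := th_pos hn
  have th1 := th_lt (n := n)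
  set hc' := re_pos hg with hhc
  obtain ⟨h, hh⟩ : ∃ h, h = one n + g := ⟨_, rfl⟩
  obtain ⟨q, hq⟩ : ∃ q, q = one n + g' := ⟨_, rfl⟩
  obtain ⟨p, hp⟩ : ∃ p, p = Cop n hc' (n+2) q := ⟨_, rfl⟩
  have hPh : Pn hn h = 0 := by rw [hh, map_add, P_one, l2, add_zero]
  have hPq : Pn hn q = 0 := by rw [hq, map_add, P_one, m2, add_zero]
  have hw : ∀ᵐ w ∂(nu n), h w = 1 + g w := hh ▸ onep_ae g
  have qw : ∀ᵐ w ∂(nu n), q w = 1 + g' w := hq ▸ onep_ae g'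
  have hb : ∀ᵐ w ∂(nu n), |h w - 1| ≤ ρ := by
    filter_upwards [hw, l1] with w e1 e2; rw [e1, add_sub_cancel_left]; linarith
  have qb1 : ∀ᵐ w ∂(nu n), |q w - 1| ≤ ρ/2 := by
    filter_upwards [qw, m1] with w e1 e2; rw [e1, add_sub_cancel_left]; linarith
  have hρ3 : ρ ≤ 1/4 := by linarith
  have qb2 : ∀ᵐ w ∂(nu n), |q w| ≤ 2 := by
    filter_upwards [qb1] with w e1; rw [abs_le] at *; constructor <;> linarith
  have q0 : ∀ᵐ w ∂(nu n), 0 ≤ q w := by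
    filter_upwards [qb1] with w e1; rw [abs_le] at e1; linarith
  have pb : ∀ᵐ w ∂(nu n), |p w - 1| ≤ ρ := by
    filter_upwards [h2 γ hg q 2 (by norm_num) qb2, ae_ta hc' qb1] with w e1 e2
    have := e1.1
    rw [← hhc, ← hp] at this
    have := abs_add_le (p w - q (ta (1+γ) w)) (q (ta (1+γ) w) - 1)
    rw [sub_add_sub_cancel] at this
    linarith
  obtain ⟨d, hd⟩ : ∃ d, d = p - h := ⟨_, rfl⟩
  have dw : ∀ᵐ w ∂(nu n), d w = p w - h w := hd ▸ coe_sub p h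
  have l4' : ∀ᵐ w ∂(nu n), A hn h w = M w * h w ^ (th n) + nv n a w := by
    filter_upwards [hw, l4] with w e1 e2; rw [hh, e2, ← e1, hh]
  have m4' : ∀ᵐ w ∂(nu n), A hn q w = M' w * q w ^ (th n) + nv n a' w := by
    filter_upwards [qw, m4] with w e1 e2; rw [hq, e2, ← e1, hq]
  have hAp : A hn p = Cop n hc' n (A hn q) := by rw [hp, inter]
  have Apw : ∀ᵐ w ∂(nu n), A hn p w = M w * p w ^ (th n) + Cop n hc' n (nv n a') w := by
    rw [hAp]
    filter_upwards [Cop_ae hc' n (A hn q), Cop_ae hc' n (nv n a'), ae_ta hc' m4', hMM, ae_ta hc' q0, Cop_ae hc' (n+2) q] with w e1 e2 e3 e4 e5 e6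
    rw [e1, e2, e3, hp, e6, bet_rpow _ _ e5, e4]; ring
  -- the error term
  obtain ⟨e, he⟩ : ∃ e, e = A hn d - th n • d - Cop n hc' n (nv n a') + nv n a := ⟨_, rfl⟩
  have ew : ∀ᵐ w ∂(nu n), |e w| ≤ (2*η+4*ρ) * |d w| := by
    have hAd : A hn d = A hn p - A hn h := by rw [hd, map_sub]
    rw [he]
    filter_upwards [coe_add (A hn d - th n • d - Cop n hc' n (nv n a')) (nv n a), coe_sub (A hn d - th n • d) (Cop n hc' n (nv n a')),
      coe_sub (A hn d) (th n • d), coe_smul (th n) d, hAd ▸ coe_sub (A hn p) (A hn h), Apw, l4', hb, pb, dw, hMb] with w e1 e2 e3 e4 e5 e6 e7 e8 e9 e10 e11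
    rw [e1, e2, e3, e4, e5, e6, e7, e10]
    obtain ⟨c1, c2⟩ := rp_aux th0 th1 (by linarith) e8 e9
    have : M w * p w ^ th n + Cop n hc' n (nv n a') w - (M w * h w ^ th n + nv n a w) - th n * (p w - h w) - Cop n hc' n (nv n a') w + nv n a w =
      (M w - 1) * (p w ^ th n - h w ^ th n) + (p w ^ th n - h w ^ th n - th n * (p w - h w)) := by ring
    rw [this]
    refine (abs_add_le _ _).trans ?_
    rw [abs_mul]
    have : |M w - 1| * |p w ^ th n - h w ^ th n| ≤ η * (2 * |p w - h w|) := by gcongr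
    linarith
  have en : ‖e‖ ≤ (2*η+4*ρ) * ‖d‖ := Lp.norm_le_mul_norm_of_ae_le_mul ew
  have key : d - Pn hn d = R hn e + R hn (Cop n hc' n (nv n a') - nv n a') := by
    rw [← R_A, he]; simp only [map_add, map_sub, R_nv]; abel
  have Pd : ‖Pn hn d‖ ≤ C3*2/c*‖γ‖ := by
    obtain ⟨b, hb', -⟩ := hP d
    have k1 : ‖Pn hn d‖^2 = inner ℝ (nv n b) p - inner ℝ (nv n b) q := by
      rw [← real_inner_self_eq_norm_sq, ← Pn_sym, P_P, hb', nv_P hn b hPq, hd, inner_sub_right, nv_P hn b hPh]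
    have k2 := h3 γ hg b q 2 (by norm_num) qb2
    rw [← hhc, ← hp, ← k1, abs_of_nonneg (by positivity)] at k2
    have k3 := h6 b
    rw [← hb'] at k3
    rcases (norm_nonneg (Pn hn d)).eq_or_lt' with k4 | k4
    · rw [k4]; positivity
    · refine le_of_mul_le_mul_right ?_ k4
      calc ‖Pn hn d‖ * ‖Pn hn d‖ ≤ C3*‖γ‖*‖b‖*2 := by rw [← sq]; exact k2
        _ = C3*2/c*‖γ‖ * (c*‖b‖) := by field_simp
        _ ≤ _ := by gcongr
  have dn : ‖d‖ ≤ D*‖γ‖ := by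
    have k1 : ‖R hn e‖ ≤ 1/2*‖d‖ := by
      calc ‖R hn e‖ ≤ Rn*((2*η+4*ρ) * ‖d‖) := by rw [hRn]; exact ((R hn).le_opNorm e).trans (by gcongr)
        _ = (Rn*(2*η+4*ρ)) * ‖d‖ := by ring
        _ ≤ (Rn*(ρ+4*ρ))*‖d‖ := by gcongr; linarith
        _ ≤ 1/2*‖d‖ := by gcongr; linarith
    have k2 : ‖R hn (Cop n hc' n (nv n a') - nv n a')‖ ≤ Rn*(Sn n * C1*‖γ‖) := by
      calc _ ≤ Rn*‖Cop n hc' n (nv n a') - nv n a'‖ := hRn ▸ (R hn).le_opNorm _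
        _ ≤ Rn*(Sn n*(C1*‖γ‖*‖a'‖)) := by gcongr; exact norm_bd (by positivity) (h1 γ hg a')
        _ ≤ Rn*(Sn n*(C1*‖γ‖*1)) := by gcongr; linarith
        _ = _ := by ring
    have k3 : ‖d‖ ≤ ‖Pn hn d‖ + ‖d - Pn hn d‖ := by
      have := norm_add_le (Pn hn d) (d - Pn hn d); rwa [add_sub_cancel] at this
    rw [key] at k3
    have k4 := norm_add_le (R hn e) (R hn (Cop n hc' n (nv n a') - nv n a'))
    rw [hD]; linarith
  have Jq : J hn M' q = J hn M p := by rw [hp, J_inv hn hc' hM' q q0 hMM]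
  have Jx := h5 M h p hM (by filter_upwards [hMb] with w hw; linarith) (by filter_upwards [hb] with w hw; linarith)
    (by filter_upwards [pb] with w hw; linarith)
  rw [← hd] at Jx
  have lin : inner ℝ (A hn h) d - ∫ w, M w * h w ^ (th n) * d w ∂(nu n) = inner ℝ (nv n a) d := by
    have : ∫ w, M w * h w ^ (th n) * d w ∂(nu n) = inner ℝ (A hn h - nv n a) d := by
      rw [inn]
      refine integral_congr_ae ?_
      filter_upwards [coe_sub (A hn h) (nv n a), l4'] with w e1 e2
      rw [e1, e2]; ring
    rw [this, inner_sub_left]; ring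
  have fin1 : inner ℝ (nv n a) d = inner ℝ (nv n a) (Cop n hc' (n+2) (one n)) + inner ℝ (nv n a) (Cop n hc' (n+2) g') := by
    rw [hd, inner_sub_right, nv_P hn a hPh, sub_zero, hp, hq, map_add, inner_add_right]
  have f1 := h4 γ hg a
  have f2 := h3 γ hg a g' (K*η) hKη m1
  rw [nv_P hn a m2, sub_zero] at f2
  rw [← hhc] at f1 f2
  rw [lin, fin1] at Jx
  have f3 : C5*‖d‖^2 ≤ C5*(D*‖γ‖)^2 := by gcongr
  have f4 : C4*‖a‖*‖γ‖^2 ≤ C4*1*‖γ‖^2 := by gcongr; linarith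
  rw [← hh, ← hq, Jq]
  have f5 : 0 ≤ (C5*D^2+C4)*(η*‖a‖*‖γ‖) := by positivity
  have f6 : 0 ≤ C3*K*‖γ‖^2 := by positivity
  have tri : ∀ x y z u v : ℝ, |x - (y+z)| ≤ u → |y + v| ≤ C4*‖a‖*‖γ‖^2 → |z| ≤ C3*‖γ‖*‖a‖*(K*η) → |x + v| ≤ u + C4*‖a‖*‖γ‖^2 + C3*‖γ‖*‖a‖*(K*η) := by
    intro x y z u v i1 i2 i3
    rw [abs_le] at *; constructor <;> linarith
  have := tri _ _ _ _ _ Jx f1 f2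
  linarith
lemma inv_aux {θ x : ℝ} (h0 : 0 < θ) (h1 : θ < 1) (hx : |x| ≤ 1/4) :
    |(1+x)^(-θ) - 1| ≤ 4*|x| ∧ |(1+x)^(-θ) - 1 + θ*x| ≤ 12*|x|^2 := by
  obtain ⟨c1, c2⟩ := rp_aux h0 h1 (r := |x|) (x := 1) (y := 1+x) (by linarith) (by simp) (by simp)
  rw [Real.one_rpow, add_sub_cancel_left] at c1 c2
  have hp : 0 ≤ 1 + x := by have := (abs_le.1 hx).1; linarith
  rw [Real.rpow_neg hp]
  obtain ⟨y, hy⟩ : ∃ y, y = (1+x)^θ := ⟨_, rfl⟩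
  rw [← hy] at c1 c2 ⊢
  have y1 : 1/2 ≤ y := by have := (abs_le.1 c1).1; linarith
  have y0 : 0 < y := by linarith
  have yi : y⁻¹ ≤ 2 := by rw [inv_le_comm₀ y0 (by norm_num)]; linarith
  have yi0 : 0 < y⁻¹ := by positivity
  constructor
  · rw [show y⁻¹ - 1 = -(y⁻¹*(y-1)) by field_simp; ring, abs_neg, abs_mul, abs_of_pos yi0]
    calc _ ≤ 2*(2*|x|) := by gcongr
      _ = _ := by ring
  · rw [show y⁻¹ - 1 + θ*x = y⁻¹*(-(y-1-θ*x) + θ*x*(y-1)) by field_simp; ring, abs_mul, abs_of_pos yi0]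
    have : |-(y-1-θ*x) + θ*x*(y-1)| ≤ 4*|x| * |x| + 1*|x| * (2*|x|) := by
      refine (abs_add_le _ _).trans ?_
      rw [abs_neg, abs_mul, abs_mul, abs_of_pos h0]; gcongr
    calc _ ≤ 2*(4*|x| * |x| + 1*|x| * (2*|x|)) := by gcongr
      _ = _ := by ring

lemma abs_int_le {f : ℂ → ℝ} {C : ℝ} (h : ∀ᵐ w ∂(nu n), |f w| ≤ C) : |∫ w, f w ∂(nu n)| ≤ C * nn n := by
  rw [← Real.norm_eq_abs]; exact norm_integral_le_of_norm_le_const h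

/-- expansion of the reduced functional in `ε` -/
lemma J_app (hn : 1 ≤ n) {K B : ℝ} (hK : 0 < K) (hB : 0 < B) : ∃ C > 0, ∃ ε₁ > 0, ∀ (κ : ℂ → ℝ) (ε : ℝ) (g : H n), |ε| ≤ ε₁ →
    AEStronglyMeasurable κ (nu n) → (∀ᵐ w ∂(nu n), |κ w| ≤ B) → (∀ᵐ w ∂(nu n), |g w| ≤ K*(4*B*|ε|)) →
    |J hn (fun w => (1+ε*κ w)^(-th n)) (one n + g) - J hn (fun _ => 1) (one n) - th n/(1+th n) * (ε * ∫ w, κ w ∂(nu n))| ≤ C * |ε|^2 := by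
  obtain ⟨C5, hC5, h5⟩ := J_exp hn
  have hS := Sn_pos (n := n)
  have hnn : 0 ≤ nn n := measureReal_nonneg
  have th0 := th_pos hn
  have th1 := th_lt (n := n)
  refine ⟨C5*(Sn n*(K*(4*B)))^2 + 4*B*(K*(4*B))*nn n + 12*B^2*nn n, by have := nu_pos (n := n); rw [nn]; positivity,
    1/(8*(B + K*B)), by positivity, fun κ ε g hε hκ hκb hgb => ?_⟩
  rw [le_div_iff₀ (by positivity)] at hε
  have e0 := abs_nonneg ε
  have hKB : 0 ≤ |ε| * (K*B) := by positivity
  have hBe : 0 ≤ |ε| * B := by positivity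
  obtain ⟨M, hM⟩ : ∃ M : ℂ → ℝ, M = fun w => (1+ε*κ w)^(-th n) := ⟨_, rfl⟩
  rw [← hM]
  have hx : ∀ᵐ w ∂(nu n), |ε*κ w| ≤ |ε| * B := by filter_upwards [hκb] with w h; rw [abs_mul]; gcongr
  have hMm : AEStronglyMeasurable M (nu n) := by
    rw [hM]; exact (((hκ.aemeasurable.const_mul ε).const_add 1).pow_const _).aestronglyMeasurable
  have M1 : ∀ᵐ w ∂(nu n), |M w - 1| ≤ 4*B*|ε| := by
    filter_upwards [hx] with w h; rw [hM]
    exact (inv_aux th0 th1 (by linarith)).1.trans (by linarith)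
  have M2 : ∀ᵐ w ∂(nu n), |M w - 1 + th n*(ε*κ w)| ≤ 12*(|ε| * B)^2 := by
    filter_upwards [hx] with w h; rw [hM]
    exact (inv_aux th0 th1 (by linarith)).2.trans (by gcongr)
  have o1 := one_ae (n := n)
  have ob : ∀ᵐ w ∂(nu n), |one n w - 1| ≤ 1/2 := by filter_upwards [o1] with w h; rw [h]; norm_num
  have og : ∀ᵐ w ∂(nu n), |(one n + g) w - 1| ≤ 1/2 := by
    filter_upwards [onep_ae g, hgb] with w h1 h2; rw [h1, add_sub_cancel_left]; linarith
  have Jx := h5 M (one n) (one n + g) hMm (by filter_upwards [M1] with w h; linarith) ob og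
  rw [add_sub_cancel_left, A_one] at Jx
  have iM : Integrable M (nu n) := by
    refine integ_bd hMm (C := 2) ?_
    filter_upwards [M1] with w h
    rw [abs_le] at *; constructor <;> linarith
  have ig : Integrable g (nu n) := integ_bd (asm g) hgb
  have lin : inner ℝ (one n) g - ∫ w, M w * one n w ^ (th n) * g w ∂(nu n) = - ∫ w, (M w - 1) * g w ∂(nu n) := by
    have iMg : Integrable (fun w => M w * g w) (nu n) := by
      refine integ_bd (hMm.mul (asm g)) (C := 2*(K*(4*B*|ε|))) ?_
      filter_upwards [M1, hgb] with w h h'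
      rw [abs_mul]; gcongr
      rw [abs_le] at *; constructor <;> linarith
    have e1 : inner ℝ (one n) g = ∫ w, g w ∂(nu n) := by
      rw [inn]; refine integral_congr_ae ?_
      filter_upwards [o1] with w h; rw [h, one_mul]
    have e2 : ∫ w, M w * one n w ^ (th n) * g w ∂(nu n) = ∫ w, M w * g w ∂(nu n) := by
      refine integral_congr_ae ?_
      filter_upwards [o1] with w h; rw [h, Real.one_rpow, mul_one]
    have e3 : ∫ w, (M w - 1) * g w ∂(nu n) = (∫ w, M w * g w ∂(nu n)) - ∫ w, g w ∂(nu n) := by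
      rw [← integral_sub iMg ig]; simp only [sub_mul, one_mul]
    rw [e1, e2, e3]; ring
  have b1 : |∫ w, (M w - 1) * g w ∂(nu n)| ≤ (4*B*|ε|)*(K*(4*B*|ε|)) * nn n := by
    refine abs_int_le ?_
    filter_upwards [M1, hgb] with w h h'
    rw [abs_mul]; gcongr
  have b2 : C5*‖g‖^2 ≤ C5*(Sn n*(K*(4*B*|ε|)))^2 := by
    have := norm_bd (by positivity) hgb
    gcongr
  have iκ : Integrable κ (nu n) := integ_bd hκ hκb
  have Jo : J hn M (one n) - J hn (fun _ => 1) (one n) - th n/(1+th n) * (ε * ∫ w, κ w ∂(nu n)) =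
      -(1/(1+th n)) * ∫ w, (M w - 1 + th n*(ε*κ w)) ∂(nu n) := by
    have e1 : ∀ f : ℂ → ℝ, ∫ w, f w * one n w ^ (1+th n) ∂(nu n) = ∫ w, f w ∂(nu n) := fun f => by
      refine integral_congr_ae ?_
      filter_upwards [o1] with w h; rw [h, Real.one_rpow, mul_one]
    have e2 : ∫ w, (M w - 1 + th n*(ε*κ w)) ∂(nu n) = (∫ w, M w ∂(nu n)) - (∫ _, (1:ℝ) ∂(nu n)) + th n*(ε*∫ w, κ w ∂(nu n)) := by
      rw [integral_add (show Integrable (fun w => M w - 1) (nu n) from iM.sub (integrable_const _)) ((iκ.const_mul ε).const_mul _), integral_sub iM (integrable_const _), integral_const_mul, integral_const_mul]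
    rw [J, J, e1, e1, e2]; ring
  have b3 : |-(1/(1+th n)) * ∫ w, (M w - 1 + th n*(ε*κ w)) ∂(nu n)| ≤ 1*(12*(|ε| * B)^2*nn n) := by
    rw [abs_mul, abs_neg]
    have g1 : |1/(1+th n)| ≤ 1 := by rw [abs_of_pos (by positivity), div_le_one (by positivity)]; linarith
    have := abs_int_le M2
    gcongr
  rw [← Jo] at b3
  rw [lin] at Jx
  have tri : ∀ a b c d i u v x : ℝ, |a - b - (-i)| ≤ u → |i| ≤ v → |b - c - d| ≤ x → |a - c - d| ≤ u + v + x := by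
    intro a b c d i u v x i1 i2 i3
    rw [abs_le] at *; constructor <;> linarith
  refine (tri _ _ _ _ _ _ _ _ (Jx.trans b2) b1 b3).trans (le_of_eq ?_)
  ring
lemma nv_smul (t : ℝ) (a : ℂ) : nv n (t * a) = t • nv n a := by
  refine Lp.ext ?_
  filter_upwards [nv_ae (n := n) (t*a), coe_smul t (nv n a), nv_ae (n := n) a] with w h1 h2 h3
  rw [h1, h2, h3, mul_assoc, Complex.re_ofReal_mul]

/-- quantitative criticality -/
lemma crit_aux (hn : 1 ≤ n) {C γ₀ : ℝ} (hC : 0 < C) (hγ : 0 < γ₀) : ∃ η₂ > 0, ∀ (η s : ℝ) (a : ℂ) (Ψ : ℂ → ℝ), 0 ≤ η → η ≤ η₂ → s^2 = 1 →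
    (∀ γ, ‖γ‖ ≤ γ₀ → |Ψ γ + (n+2)/2 * inner ℝ (nv n a) (nv n γ)| ≤ C * (η * ‖a‖ * ‖γ‖ + ‖γ‖^2)) →
    (∀ γ, ‖γ‖ ≤ γ₀ → s * Ψ γ ≤ 0) → a = 0 := by
  obtain ⟨c, hc, h6⟩ := nv_norm_le hn
  refine ⟨c^2/(4*C), by positivity, fun η s a Ψ hη hη2 hs h1 h2 => ?_⟩
  by_contra ha
  have ha' : 0 < ‖a‖ := norm_pos_iff.2 ha
  rw [le_div_iff₀ (by positivity)] at hη2
  obtain ⟨t, ht0, ht1, ht2⟩ : ∃ t : ℝ, 0 < t ∧ t*‖a‖ ≤ γ₀ ∧ t*(4*C) ≤ c^2 := by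
    refine ⟨min (γ₀/‖a‖) (c^2/(4*C)), lt_min (by positivity) (by positivity), ?_, ?_⟩
    · rw [← le_div_iff₀ ha']; exact min_le_left _ _
    · rw [← le_div_iff₀ (by positivity)]; exact min_le_right _ _
  have hs1 : |s| = 1 := by rw [← sq_eq_sq₀ (abs_nonneg _) zero_le_one, sq_abs, hs]; norm_num
  have hn1 : ‖((-(s*t):ℝ):ℂ) * a‖ = t*‖a‖ := by
    rw [norm_mul, Complex.norm_real, Real.norm_eq_abs, abs_neg, abs_mul, hs1, abs_of_pos ht0, one_mul]
  have k1 := h1 _ (hn1.trans_le ht1)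
  have k2 := h2 _ (hn1.trans_le ht1)
  rw [hn1, nv_smul, real_inner_smul_right, real_inner_self_eq_norm_sq] at k1
  obtain ⟨P, hP⟩ : ∃ P, P = Ψ (((-(s*t):ℝ):ℂ) * a) := ⟨_, rfl⟩
  rw [← hP] at k1 k2
  have k3 : |s * (P + (n+2)/2 * (-(s*t) * ‖nv n a‖^2))| ≤ C*(η*‖a‖*(t*‖a‖) + (t*‖a‖)^2) := by rw [abs_mul, hs1, one_mul]; exact k1
  have k4 : s * (P + (n+2)/2 * (-(s*t) * ‖nv n a‖^2)) = s*P - (n+2)/2 * (t * ‖nv n a‖^2) * s^2 := by ring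
  rw [k4, hs, mul_one] at k3
  have k5 := (abs_le.1 k3).1
  have k6 : (c*‖a‖)^2 ≤ ‖nv n a‖^2 := by gcongr; exact h6 a
  have k7 : 1*(t*(c*‖a‖)^2) ≤ ((n:ℝ)+2)/2 * (t * ‖nv n a‖^2) := by
    gcongr; have : (0:ℝ) ≤ n := by positivity
    linarith
  have k8 : (t*‖a‖^2)*(η*(4*C)) ≤ (t*‖a‖^2)*c^2 := by gcongr
  have k9 : (t*‖a‖^2)*(t*(4*C)) ≤ (t*‖a‖^2)*c^2 := by gcongr
  have k10 : 0 < (t*‖a‖^2)*c^2 := by positivity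
  linarith

lemma exist_abs (hn : 1 ≤ n) (κ : ℂ → ℂ → ℝ) {B : ℝ} (hB : 0 < B) (hm : ∀ c : ℂ, 0 < c.re → AEStronglyMeasurable (κ c) (nu n))
    (hb : ∀ c : ℂ, 0 < c.re → ∀ᵐ w ∂(nu n), |κ c w| ≤ B)
    (hinv : ∀ c γ : ℂ, 0 < c.re → ‖γ‖ ≤ 1/8 → ∀ᵐ w ∂(nu n), κ (c + c.re*γ) (ta (1+γ) w) = κ c w)
    {S : Set ℂ} (hS : IsCompact S) (hSp : ∀ c ∈ S, 0 < c.re) {cs : ℂ} (hcs : cs ∈ S) {b : ℝ}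
    (hout : ∀ c : ℂ, 0 < c.re → c ∉ S → ∫ w, κ c w ∂(nu n) ≤ b) (hgt : b < ∫ w, κ cs w ∂(nu n)) :
    ∃ ε₀ > 0, ∀ ε : ℝ, ε ≠ 0 → |ε| < ε₀ → ∃ c : ℂ, 0 < c.re ∧ ∃ h : H n, (∀ᵐ w ∂(nu n), |h w - 1| ≤ 1/2) ∧
      ∀ᵐ w ∂(nu n), A hn h w = (1 + ε*κ c w)^(-th n) * h w^(th n) := by
  obtain ⟨K, hK, η₀, hη₀, hLS⟩ := LS_exists hn
  obtain ⟨C, hC, γ₀, hγ₀, hγ8, η₁, hη₁, hvar⟩ := var hn hK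
  obtain ⟨η₂, hη₂, hcrit⟩ := crit_aux hn hC hγ₀
  obtain ⟨C', hC', ε₁, hε₁, happ⟩ := J_app hn hK hB
  have th0 := th_pos hn
  have th1 := th_lt (n := n)
  obtain ⟨τ, hτ⟩ : ∃ τ, τ = th n/(1+th n) := ⟨_, rfl⟩
  have hτ0 : 0 < τ := by rw [hτ]; positivity
  obtain ⟨G, hG⟩ : ∃ G, G = (∫ w, κ cs w ∂(nu n)) - b := ⟨_, rfl⟩
  have hG0 : 0 < G := by rw [hG]; linarith
  refine ⟨min (min (min η₀ η₁) η₂ / (4*B)) (min (min ε₁ (1/(4*B))) (min (τ*G/(2*C')) (1/(8*B*K)))), by positivity, fun ε hε0 hε => ?_⟩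
  simp only [lt_min_iff, lt_div_iff₀ (show 0 < 4*B by positivity)] at hε
  obtain ⟨⟨⟨q1, q2⟩, q3⟩, ⟨q4, q5⟩, q6, q7⟩ := hε
  have e0 : 0 < |ε| := abs_pos.2 hε0
  obtain ⟨η, hη⟩ : ∃ η, η = 4*B*|ε| := ⟨_, rfl⟩
  have hη0 : 0 ≤ η := by rw [hη]; positivity
  rw [show |ε| * (4*B) = η by rw [hη]; ring] at q1 q2 q3 q5
  have hKη : K*η ≤ 1/2 := by rw [lt_div_iff₀ (by positivity)] at q7; rw [hη]; linarith
  rw [lt_div_iff₀ (by positivity)] at q6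
  let M : ℂ → ℂ → ℝ := fun c w => (1+ε*κ c w)^(-th n)
  have hMm : ∀ c : ℂ, 0 < c.re → AEStronglyMeasurable (M c) (nu n) := fun c hc =>
    ((((hm c hc).aemeasurable.const_mul ε).const_add 1).pow_const _).aestronglyMeasurable
  have hMb : ∀ c : ℂ, 0 < c.re → ∀ᵐ w ∂(nu n), |M c w - 1| ≤ η := fun c hc => by
    filter_upwards [hb c hc] with w h
    have hx : |ε*κ c w| ≤ |ε| * B := by rw [abs_mul]; gcongr
    exact (inv_aux th0 th1 (by linarith)).1.trans (by linarith)
  have hex : ∀ c : ℂ, ∃ g a, 0 < c.re → IsLS hn (M c) (K*η) g a := fun c => by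
    by_cases hc : 0 < c.re
    · obtain ⟨g, a, h⟩ := hLS (M c) η (hMm c hc) hη0 q1.le (hMb c hc)
      exact ⟨g, a, fun _ => h⟩
    · exact ⟨0, 0, fun h => (hc h).elim⟩
  choose g a hga using hex
  let Φ : ℂ → ℝ := fun c => J hn (M c) (one n + g c)
  have hre : ∀ c γ : ℂ, (c + c.re*γ).re = c.re * (1+γ).re := fun c γ => by simp; ring
  have hV : ∀ c : ℂ, 0 < c.re → ∀ γ : ℂ, ‖γ‖ ≤ γ₀ →
      |(Φ (c + c.re*γ) - Φ c) + (n+2)/2 * inner ℝ (nv n (a c)) (nv n γ)| ≤ C * (η * ‖a c‖ * ‖γ‖ + ‖γ‖^2) := fun c hc γ hγ => by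
    have hc' : 0 < (c + c.re*γ).re := by rw [hre]; exact mul_pos hc (re_pos (hγ.trans hγ8))
    refine hvar (M c) (M (c + c.re*γ)) η γ (g c) (g _) (a c) (a _) hη0 q2.le hγ (hMm c hc) (hMm _ hc') (hMb c hc) ?_ (hga c hc) (hga _ hc')
    filter_upwards [hinv c γ hc (hγ.trans hγ8)] with w h
    simp only [M]; rw [h]
  have hcont : ∀ c : ℂ, 0 < c.re → ContinuousAt Φ c := fun c hc => by
    let L : ℂ → ℝ := fun γ => C * (η * ‖a c‖ * ‖γ‖ + ‖γ‖^2) + |((n:ℝ)+2)/2| * (‖nv n (a c)‖ * (Sn n * ‖γ‖))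
    have hL : Tendsto (fun q : ℂ => L ((q - c)/c.re)) (𝓝 c) (𝓝 0) := by
      have : ContinuousAt (fun q : ℂ => L ((q - c)/c.re)) c := by
        simp only [L]; fun_prop
      have h2 := this.tendsto
      simpa [L] using h2
    refine tendsto_iff_norm_sub_tendsto_zero.2 (squeeze_zero' (Eventually.of_forall fun _ => norm_nonneg _) ?_ hL)
    have hev : ∀ᶠ q in 𝓝 c, ‖(q - c)/c.re‖ < γ₀ := by
      have : ContinuousAt (fun q : ℂ => ‖(q - c)/c.re‖) c := by fun_prop
      exact this.eventually_lt continuousAt_const (by simpa using hγ₀)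
    filter_upwards [hev] with q hq
    have := hV c hc _ hq.le
    have hcc : (c.re:ℂ) ≠ 0 := by exact_mod_cast hc.ne'
    rw [mul_div_cancel₀ _ hcc, add_sub_cancel] at this
    rw [Real.norm_eq_abs]
    have h3 : |((n:ℝ)+2)/2 * inner ℝ (nv n (a c)) (nv n ((q-c)/c.re))| ≤ |((n:ℝ)+2)/2| * (‖nv n (a c)‖ * (Sn n * ‖(q-c)/c.re‖)) := by
      rw [abs_mul]; gcongr
      refine (abs_real_inner_le_norm _ _).trans ?_
      gcongr
      exact norm_bd (norm_nonneg _) (nv_bd _)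
    have h4 := abs_sub (Φ q - Φ c + ((n:ℝ)+2)/2 * inner ℝ (nv n (a c)) (nv n ((q-c)/c.re))) (((n:ℝ)+2)/2 * inner ℝ (nv n (a c)) (nv n ((q-c)/c.re)))
    rw [add_sub_cancel_right] at h4
    simp only [L]; linarith
  obtain ⟨s, hs, hsε⟩ : ∃ s : ℝ, s^2 = 1 ∧ s*ε = |ε| := by
    rcases le_total 0 ε with h | h
    · exact ⟨1, by norm_num, by rw [abs_of_nonneg h, one_mul]⟩
    · exact ⟨-1, by norm_num, by rw [abs_of_nonpos h]; ring⟩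
  obtain ⟨c₀, hc₀, hmax⟩ := hS.exists_isMaxOn ⟨cs, hcs⟩ (f := fun c => s * Φ c) (fun c hc => ((hcont c (hSp c hc)).const_mul s).continuousWithinAt)
  have hc₀p := hSp c₀ hc₀
  have hE : ∀ c : ℂ, 0 < c.re → |s * Φ c - s * J hn (fun _ => 1) (one n) - τ*(|ε| * ∫ w, κ c w ∂(nu n))| ≤ C' * |ε|^2 := fun c hc => by
    have := happ (κ c) ε (g c) q4.le (hm c hc) (hb c hc) (hη ▸ (hga c hc).1)
    have hs1 : |s| = 1 := by rw [← sq_eq_sq₀ (abs_nonneg _) zero_le_one, sq_abs, hs]; norm_num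
    rw [← hτ] at this
    have e : s * Φ c - s * J hn (fun _ => 1) (one n) - τ*(|ε| * ∫ w, κ c w ∂(nu n)) = s * (J hn (fun w => (1+ε*κ c w)^(-th n)) (one n + g c) - J hn (fun _ => 1) (one n) - τ*(ε * ∫ w, κ c w ∂(nu n))) := by
      rw [← hsε]
      change s * J hn (fun w => (1+ε*κ c w)^(-th n)) (one n + g c) - _ - _ = _
      ring
    rw [e, abs_mul, hs1, one_mul]
    exact this
  have hglob : ∀ c : ℂ, 0 < c.re → s * Φ c ≤ s * Φ c₀ := fun c hc => by
    by_cases hcS : c ∈ S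
    · exact hmax hcS
    · have h1 : s * Φ cs ≤ s * Φ c₀ := hmax hcs
      have h2 := (abs_le.1 (hE c hc)).2
      have h3 := (abs_le.1 (hE cs (hSp cs hcs))).1
      have h4 : τ*(|ε| * ∫ w, κ c w ∂(nu n)) ≤ τ*(|ε| * b) := by gcongr; exact hout c hc hcS
      have h5 : (∫ w, κ cs w ∂(nu n)) = b + G := by rw [hG]; ring
      rw [h5] at h3
      have h6 : |ε| * (|ε| * (2*C')) ≤ |ε| * (τ*G) := by gcongr
      linarith
  have ha0 : a c₀ = 0 := by
    refine hcrit η s (a c₀) (fun γ => Φ (c₀ + c₀.re*γ) - Φ c₀) hη0 q3.le hs (hV c₀ hc₀p) fun γ hγ => ?_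
    have := hglob (c₀ + c₀.re*γ) (by rw [hre]; exact mul_pos hc₀p (re_pos (hγ.trans hγ8)))
    rw [mul_sub]; linarith
  obtain ⟨l1, -, -, l4⟩ := hga c₀ hc₀p
  refine ⟨c₀, hc₀p, one n + g c₀, ?_, ?_⟩
  · filter_upwards [onep_ae (g c₀), l1] with w h1 h2
    rw [h1, add_sub_cancel_left]; linarith
  · filter_upwards [onep_ae (g c₀), l4, nv_ae (n := n) (a c₀)] with w h1 h2 h3
    rw [h2, h1, h3, ha0]; simp [M]
def ks (hn : 1 ≤ n) (k : Pt n → ℝ) (σ : ℂ) : ℝ := k (√σ.re • Pi.single ⟨0, hn⟩ 1, 0, -σ.im)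
def kpp (hn : 1 ≤ n) (k : Pt n → ℝ) (c w : ℂ) : ℝ := ks hn k (c.re * (2/(1+w) - 1) - c.im * Complex.I)

lemma znorm_rho (p : Pt n) : znorm n p = √(rho n p) := rfl

lemma ks_sg (hn : 1 ≤ n) {k : Pt n → ℝ} (hk : ∃ Kt : ℝ → ℝ → ℝ, ∀ p : Pt n, k p = Kt (znorm n p) p.2.2) (p : Pt n) :
    ks hn k (sg n p) = k p := by
  obtain ⟨Kt, h⟩ := hk
  rw [ks, h, h p]
  congr 1
  · rw [znorm_rho, znorm_rho]; congr 1
    simp [rho, mul_pow, Pi.single_apply, Real.sq_sqrt (rho_nonneg p)]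
    exact Real.sq_sqrt (rho_nonneg p)
  · simp

lemma kpp_meas (hn : 1 ≤ n) {k : Pt n → ℝ} (hk : Continuous k) (c : ℂ) : Measurable (kpp hn k c) := by
  have h : Continuous (ks hn k) := by unfold ks; fun_prop
  unfold kpp
  exact h.measurable.comp (by fun_prop)

lemma rho_scl {c : ℂ} (hc : 0 < c.re) (p : Pt n) : rho n (scl n c p) = c.re * rho n p := by
  have := congrArg Complex.re (sg_scl hc p)
  rw [sg_re, Complex.sub_re, Complex.re_ofReal_mul, sg_re, Complex.re_ofReal_mul, Complex.I_re] at this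
  rw [this]; ring

lemma T_Vf {δ σ : ℂ} (hδ : 0 < δ.re) (hσ : 0 ≤ σ.re) : 2/(1+Vf δ σ) - 1 = (σ + δ.im * Complex.I)/δ.re := by
  have h1 := ne0 hδ hσ
  have h2 : (δ.re : ℂ) ≠ 0 := by exact_mod_cast hδ.ne'
  have h3 : 1 + Vf δ σ = 2*δ.re/(σ+δ) := by unfold Vf; ring
  have h4 : σ + δ.im * Complex.I = σ + δ - δ.re := by nth_rw 2 [← Complex.re_add_im δ]; ring
  rw [h3, h4]; field_simp

lemma kpp_W (hn : 1 ≤ n) {k : Pt n → ℝ} (hk : ∃ Kt : ℝ → ℝ → ℝ, ∀ p : Pt n, k p = Kt (znorm n p) p.2.2) {c : ℂ} (hc : 0 < c.re) (p : Pt n) :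
    kpp hn k c (Wm n p) = k (scl n c p) := by
  rw [← ks_sg hn hk, sg_scl hc, kpp, Wm, T_Vf (by simp) (sg_nonneg p)]; simp

lemma kpp_ta (hn : 1 ≤ n) {k : Pt n → ℝ} (hk : ∃ Kt : ℝ → ℝ → ℝ, ∀ p : Pt n, k p = Kt (znorm n p) p.2.2) {c : ℂ} (hc : 0 < c.re) (p : Pt n) :
    kpp hn k c (ta c (Wm n p)) = k p := by
  have h2 : (c.re : ℂ) ≠ 0 := by exact_mod_cast hc.ne'
  rw [← ks_sg hn hk p, kpp, ta_W hc, T_Vf hc (sg_nonneg p)]; congr 1; field_simp; ring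

lemma kpp_inv (hn : 1 ≤ n) {k : Pt n → ℝ} (hkc : Continuous k) (hk : ∃ Kt : ℝ → ℝ → ℝ, ∀ p : Pt n, k p = Kt (znorm n p) p.2.2) (c γ : ℂ) (hc : 0 < c.re)
    (hγ : ‖γ‖ ≤ 1/8) : ∀ᵐ w ∂(nu n), kpp hn k (c + c.re*γ) (ta (1+γ) w) = kpp hn k c w := by
  refine (ae_nu (measurableSet_eq_fun ((kpp_meas hn hkc _).comp (meas_ta _)) (kpp_meas hn hkc _))).2 ?_
  refine Eventually.of_forall fun p => ?_
  change kpp hn k (c + c.re*γ) (ta (1+γ) (Wm n p)) = kpp hn k c (Wm n p)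
  have hδ := re_pos hγ
  have h2 : ((1+γ).re : ℂ) ≠ 0 := by exact_mod_cast hδ.ne'
  rw [kpp_W hn hk hc, ← ks_sg hn hk, sg_scl hc, kpp, ta_W hδ, T_Vf hδ (sg_nonneg p)]
  congr 1
  have e1 : ((c + c.re*γ).re : ℂ) = c.re * (1+γ).re := by rw [← Complex.ofReal_mul]; congr 1; simp; ring
  have e2 : ((c + c.re*γ).im : ℂ) = c.im + c.re * (1+γ).im := by rw [← Complex.ofReal_mul, ← Complex.ofReal_add]; congr 1; simp
  rw [e1, e2]; field_simp; ring

lemma x_ne (hn : 1 ≤ n) : ∀ᵐ p : Pt n, 0 < rho n p := by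
  haveI : Nonempty (Fin n) := ⟨⟨0, hn⟩⟩
  have h : ∀ᵐ p : Pt n, p.1 ≠ 0 := by
    rw [ae_iff]
    have : {p : Pt n | ¬ p.1 ≠ 0} = ({0} : Set (Fin n → ℝ)) ×ˢ Set.univ := by ext p; simp
    rw [this]
    change (Measure.prod volume volume) _ = 0
    rw [Measure.prod_prod]; simp
  filter_upwards [h] with p hp
  refine lt_of_le_of_ne (rho_nonneg p) fun h0 => hp ?_
  funext j
  have := x_sq_le p j
  rw [← h0] at this
  exact pow_eq_zero_iff (two_ne_zero) |>.1 (le_antisymm this (sq_nonneg _))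

def Nf (c : ℂ) : ℝ := c.re⁻¹ + c.re + |c.im|

lemma escape_pt {k : Pt n → ℝ} {b kinf : ℝ} (hkc : Continuous k) (hlim : Tendsto k (cocompact (Pt n)) (𝓝 kinf)) (hb : kinf ≤ b)
    (hax : ∀ p : Pt n, rho n p = 0 → k p ≤ b) {p : Pt n} (hp : 0 < rho n p) {η : ℝ} (hη : 0 < η) :
    ∃ T, ∀ c : ℂ, 0 < c.re → T < Nf c → k (scl n c p) < b + η := by
  have h1 : ∀ᶠ q in cocompact (Pt n), k q < b + η := hlim.eventually_lt_const (by linarith)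
  obtain ⟨S, hS, hSs⟩ := mem_cocompact.1 h1
  let S' := S ∩ {q | b + η ≤ k q}
  have hS' : IsCompact S' := hS.inter_right (isClosed_le continuous_const hkc)
  have hmem : ∀ q, b + η ≤ k q → q ∈ S' := fun q hq => ⟨by_contra fun h => absurd (hSs h) (not_lt.2 hq), hq⟩
  obtain ⟨R, hR⟩ := (hS'.image (continuous_rho (n := n))).isBounded.exists_norm_le
  obtain ⟨R', hR'⟩ := (hS'.image (show Continuous (fun q : Pt n => q.2.2) by fun_prop)).isBounded.exists_norm_le
  obtain ⟨r, hr0, hr⟩ : ∃ r > 0, ∀ q ∈ S', r ≤ rho n q := by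
    rcases S'.eq_empty_or_nonempty with h | h
    · exact ⟨1, one_pos, fun q hq => by rw [h] at hq; exact hq.elim⟩
    · obtain ⟨q0, h0, hm⟩ := hS'.exists_isMinOn h (continuous_rho (n := n)).continuousOn
      refine ⟨rho n q0, lt_of_le_of_ne (rho_nonneg _) fun h => ?_, fun q hq => hm hq⟩
      have := hax q0 h.symm
      have h3 : b + η ≤ k q0 := h0.2
      linarith
  refine ⟨rho n p / r + R / rho n p + (R' + R / rho n p * |p.2.2|), fun c hc hN => ?_⟩
  by_contra hcon
  have hq := hmem _ (not_lt.1 hcon)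
  have a1 := hr _ hq
  have a2 := hR _ ⟨_, hq, rfl⟩
  have a3 := hR' _ ⟨_, hq, rfl⟩
  have e : rho n (scl n c p) = c.re * rho n p := rho_scl hc p
  rw [e] at a1 a2
  rw [Real.norm_of_nonneg (by positivity)] at a2
  have b1 : c.re⁻¹ ≤ rho n p / r := by
    rw [inv_le_iff_one_le_mul₀ hc, div_mul_eq_mul_div, le_div_iff₀ hr0]; linarith
  have b2 : c.re ≤ R / rho n p := by rw [le_div_iff₀ hp]; exact a2
  have b3 : |c.im| ≤ R' + R / rho n p * |p.2.2| := by
    have e2 : c.im = (scl n c p).2.2 - c.re * p.2.2 := by simp [scl]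
    rw [e2]
    refine (abs_sub _ _).trans ?_
    rw [abs_mul, abs_of_pos hc]
    exact add_le_add a3 (by gcongr)
  unfold Nf at hN; linarith

lemma escape (hn : 1 ≤ n) {k : Pt n → ℝ} {b kinf C : ℝ} (hkc : Continuous k) (hkb : ∀ p, |k p| ≤ C) (hlim : Tendsto k (cocompact (Pt n)) (𝓝 kinf)) (hb : kinf ≤ b)
    (hax : ∀ p : Pt n, rho n p = 0 → k p ≤ b) {η : ℝ} (hη : 0 < η) :
    ∃ T, ∀ c : ℂ, 0 < c.re → T < Nf c → ∫ p : Pt n, (nq n p ^ (2*n+2))⁻¹ * (k (scl n c p) - b) ≤ η := by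
  have hsc : ∀ c, Continuous (scl n c) := fun c => by unfold scl; fun_prop
  let F : Filter ℂ := comap Nf atTop ⊓ 𝓟 {c | 0 < c.re}
  have key : Tendsto (fun c => ∫ p : Pt n, (nq n p ^ (2*n+2))⁻¹ * max (k (scl n c p) - b) 0) F (𝓝 (∫ p : Pt n, (0:ℝ))) := by
    refine tendsto_integral_filter_of_dominated_convergence (fun p => (nq n p ^ (2*n+2))⁻¹ * (C + |b|)) ?_ ?_ (integrable_dens.mul_const _) ?_
    · exact Eventually.of_forall fun c => (dens_cont.mul (((hkc.comp (hsc c)).sub continuous_const).max continuous_const)).aestronglyMeasurable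
    · refine Eventually.of_forall fun c => Eventually.of_forall fun p => ?_
      rw [norm_mul, Real.norm_of_nonneg (dens_pos p).le, Real.norm_of_nonneg (le_max_right _ _)]
      refine mul_le_mul_of_nonneg_left ?_ (dens_pos p).le
      have := abs_le.1 (hkb (scl n c p))
      have := neg_abs_le b
      have h3 := abs_nonneg (k (scl n c p))
      have := hkb (scl n c p)
      have := abs_nonneg b
      exact max_le (by linarith) (by linarith)
    · filter_upwards [x_ne hn] with p hp
      have : Tendsto (fun c => max (k (scl n c p) - b) 0) F (𝓝 0) := by
        rw [Metric.tendsto_nhds]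
        intro e he
        obtain ⟨T, hT⟩ := escape_pt hkc hlim hb hax hp he
        refine mem_inf_of_inter (preimage_mem_comap (Ioi_mem_atTop T)) (mem_principal_self _) ?_
        rintro c ⟨h1, h2⟩
        have := hT c h2 h1
        change dist _ _ < e
        rw [Real.dist_eq, sub_zero, abs_of_nonneg (le_max_right _ _)]
        exact max_lt (by linarith) he
      simpa using this.const_mul ((nq n p ^ (2*n+2))⁻¹)
  rw [integral_zero] at key
  have hev := key.eventually_lt_const hη
  obtain ⟨t, ⟨T, hT⟩, hs⟩ : ∃ t : Set ℂ, (∃ T, ∀ c, T ≤ Nf c → c ∈ t) ∧ ∀ c ∈ t, 0 < c.re → (∫ p : Pt n, (nq n p ^ (2*n+2))⁻¹ * max (k (scl n c p) - b) 0) < η := by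
    obtain ⟨t, ht, hs⟩ := mem_inf_principal.1 hev |> fun h => (⟨_, h, fun c hc => hc⟩ : ∃ t ∈ comap Nf atTop, ∀ c ∈ t, 0 < c.re → (∫ p : Pt n, (nq n p ^ (2*n+2))⁻¹ * max (k (scl n c p) - b) 0) < η)
    obtain ⟨s, h1, h2⟩ := mem_comap.1 ht
    obtain ⟨T, hT⟩ := mem_atTop_sets.1 h1
    exact ⟨t, ⟨T, fun c hc => h2 (hT _ hc)⟩, hs⟩
  refine ⟨T, fun c hc hN => le_trans ?_ (hs c (hT c hN.le) hc).le⟩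
  have hI : ∀ f : Pt n → ℝ, Continuous f → (∃ D, ∀ p, |f p| ≤ D) → Integrable (fun p : Pt n => (nq n p ^ (2*n+2))⁻¹ * f p) := fun f hf ⟨D, hD⟩ => by
    refine (integrable_dens.mul_const D).mono' (dens_cont.mul hf).aestronglyMeasurable (Eventually.of_forall fun p => ?_)
    rw [norm_mul, Real.norm_of_nonneg (dens_pos p).le]
    exact mul_le_mul_of_nonneg_left (hD p) (dens_pos p).le
  have hD : ∀ p, |k (scl n c p) - b| ≤ C + |b| := fun p => (abs_sub _ _).trans (by linarith [hkb (scl n c p)])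
  have hc1 : Continuous fun p => k (scl n c p) - b := (hkc.comp (hsc c)).sub continuous_const
  refine integral_mono (hI _ hc1 ⟨_, hD⟩) (hI _ (hc1.max continuous_const) ⟨C + |b|, fun p => ?_⟩) fun p => ?_
  · rw [abs_of_nonneg (le_max_right _ _)]
    exact max_le ((le_abs_self _).trans (hD p)) ((abs_nonneg _).trans (hD p))
  · exact mul_le_mul_of_nonneg_left (le_max_left _ _) (dens_pos p).le

lemma bubble_scl (hn : 1 ≤ n) {μ s : ℝ} (hμ : 0 < μ) (p : Pt n) :
    bubble n μ s (scl n ⟨μ^2, s⟩ p) ^ Qs n = (μ ^ (-(Qh n - 2) / 2))^Qs n * (nq n p ^ (2*n+2))⁻¹ := by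
  have hn' : (0:ℝ) < n := by exact_mod_cast hn
  have hc : 0 < (⟨μ^2, s⟩ : ℂ).re := by simp only; positivity
  have e : rho n (scl n ⟨μ^2, s⟩ p) = μ^2 * rho n p := rho_scl hc p
  have e2 : (scl n ⟨μ^2, s⟩ p).2.2 = μ^2 * p.2.2 + s := rfl
  have e3 : nq n p ^ 2 = p.2.2^2 + (1 + rho n p)^2 := by
    rw [nq, ← Complex.normSq_eq_norm_sq, Complex.normSq_apply]; simp; ring
  have hq := nq_pos p
  rw [bubble, znorm_rho, Real.sq_sqrt (rho_nonneg _), e, e2, add_sub_cancel_right, mul_div_cancel_left₀ _ (by positivity), mul_div_cancel_left₀ _ (by positivity),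
    ← e3, Real.mul_rpow (by positivity) (by positivity)]
  congr 1
  rw [← Real.rpow_mul (by positivity), ← Real.rpow_natCast (nq n p) 2, ← Real.rpow_mul hq.le,
    ← Real.rpow_natCast (nq n p), ← Real.rpow_neg hq.le]
  congr 1
  unfold Qs Qh
  have : 2 * (n:ℝ) + 2 - 2 = 2 * n := by ring
  rw [this]; push_cast; field_simp; norm_num

lemma bubble_int (hn : 1 ≤ n) {k : Pt n → ℝ} (hkc : Continuous k) {μ s b : ℝ} (hμ : 0 < μ) (h : 0 < ∫ p : Pt n, (k p - b) * bubble n μ s p ^ Qs n) :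
    0 < ∫ p : Pt n, (nq n p ^ (2*n+2))⁻¹ * (k (scl n ⟨μ^2, s⟩ p) - b) := by
  have hc : 0 < (⟨μ^2, s⟩ : ℂ).re := by simp only; positivity
  have hsc : Continuous (scl n ⟨μ^2, s⟩) := by unfold scl; fun_prop
  have hm : Measurable fun p : Pt n => (k p - b) * bubble n μ s p ^ Qs n := by
    have hz : Measurable (znorm n) := ((continuous_rho (n := n)).sqrt).measurable
    have := hkc.measurable
    unfold bubble; fun_prop
  have h1 : (∫ p : Pt n, (k p - b) * bubble n μ s p ^ Qs n ∂(Measure.map (scl n ⟨μ^2, s⟩) volume)) = _ := integral_map hsc.measurable.aemeasurable hm.aestronglyMeasurable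
  rw [scl_map hc, integral_smul_measure, smul_eq_mul] at h1
  have h2 : 0 < (ENNReal.ofReal ((((⟨μ^2, s⟩ : ℂ).re)^(n+1))⁻¹)).toReal := by
    rw [ENNReal.toReal_ofReal (by positivity)]; positivity
  have h3 := mul_pos h2 h
  rw [h1] at h3
  have e : ∀ p : Pt n, (k (scl n ⟨μ^2, s⟩ p) - b) * bubble n μ s (scl n ⟨μ^2, s⟩ p) ^ Qs n =
      (μ ^ (-(Qh n - 2) / 2))^Qs n * ((nq n p ^ (2*n+2))⁻¹ * (k (scl n ⟨μ^2, s⟩ p) - b)) := fun p => by rw [bubble_scl hn hμ]; ring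
  simp_rw [e] at h3
  rw [integral_const_mul] at h3
  exact (pos_iff_pos_of_mul_pos h3).1 (by positivity)

lemma sol_of (hn : 1 ≤ n) {k : Pt n → ℝ} {C : ℝ} (hkb : ∀ p, |k p| ≤ C) (hk : ∃ Kt : ℝ → ℝ → ℝ, ∀ p : Pt n, k p = Kt (znorm n p) p.2.2)
    {ε : ℝ} (hε : |ε| * C < 1) {c : ℂ} (hc : 0 < c.re) {h : H n} (h1 : ∀ᵐ w ∂(nu n), |h w - 1| ≤ 1/2)
    (h2 : ∀ᵐ w ∂(nu n), A hn h w = (1 + ε * kpp hn k c w)^(-th n) * h w^(th n)) : ∃ u, IsWeakSol n (fun p => 1 + ε * k p) u := by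
  have hn' : (0:ℝ) < n := by exact_mod_cast hn
  obtain ⟨m, hm, M, hM, hmM⟩ := bet_bd hc
  have hf : ∀ᵐ p : Pt n, 0 < 1 + ε * k p ∧ 0 < Cop n hc (n+2) h (Wm n p) ∧
      A hn (Cop n hc (n+2) h) (Wm n p) = (1 + ε * k p)^(-th n) * (Cop n hc (n+2) h (Wm n p))^(th n) := by
    rw [inter]
    filter_upwards [ae_nu_imp (Cop_ae hc (n+2) h), ae_nu_imp (Cop_ae hc n (A hn h)), ae_nu_imp (ae_ta hc h1), ae_nu_imp (ae_ta hc h2)] with p a1 a2 a3 a4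
    have b1 : |ε * k p| < 1 := by
      rw [abs_mul]; exact lt_of_le_of_lt (by gcongr; exact hkb p) hε
    have b2 : 0 < h (ta c (Wm n p)) := by linarith [(abs_le.1 a3).1]
    have b3 : 0 < bet c (Wm n p) := lt_of_lt_of_le hm (hmM _ (Wm_norm p)).1
    refine ⟨by linarith [(abs_lt.1 b1).1], by rw [a1]; positivity, ?_⟩
    rw [a2, a4, a1, bet_rpow _ _ b2.le, kpp_ta hn hk hc]; ring
  have hQ : -th n * (Qs n - 1) = -1 := by
    unfold Qs Qh th
    have : 2 * (n:ℝ) + 2 - 2 = 2 * n := by ring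
    rw [this]; field_simp; ring
  have hbd : ∀ᵐ w ∂(nu n), |Cop n hc (n+2) h w| ≤ M^(n+2) * 2 := by
    filter_upwards [Cop_ae hc (n+2) h, ae_ta hc h1, nu_disc (n := n)] with w a1 a2 a3
    have b0 := bet_nonneg c w
    have b1 := (hmM w a3).2
    have b2 : |h (ta c w)| ≤ 2 := by rw [abs_le] at a2 ⊢; constructor <;> linarith
    rw [a1, abs_mul, abs_of_nonneg (by positivity)]
    gcongr
  refine weak_final hn (h := Cop n hc (n+2) h) ?_ (A_bd hn (by positivity) hbd) ?_
  · filter_upwards [hf] with p ⟨a, b, e⟩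
    rw [e]; positivity
  · filter_upwards [hf] with p ⟨a, b, e⟩
    have hQ2 : th n * (Qs n - 1) = 1 := by linarith
    rw [e, Real.mul_rpow (by positivity) (by positivity), ← Real.rpow_mul a.le, ← Real.rpow_mul b.le, hQ, hQ2, Real.rpow_one, Real.rpow_neg_one]
    field_simp

lemma half (hn : 1 ≤ n) {k : Pt n → ℝ} {b kinf C : ℝ} (hkc : Continuous k) (hkb : ∀ p, |k p| ≤ C) (hk : ∃ Kt : ℝ → ℝ → ℝ, ∀ p : Pt n, k p = Kt (znorm n p) p.2.2)
    (hlim : Tendsto k (cocompact (Pt n)) (𝓝 kinf)) (hax : ∀ σ : ℝ, k (0, 0, σ) ≤ b) {μ s : ℝ} (hμ : 0 < μ)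
    (h : 0 < ∫ p : Pt n, (k p - b) * bubble n μ s p ^ Qs n) :
    ∃ ε₀ : ℝ, 0 < ε₀ ∧ ∀ ε : ℝ, |ε| < ε₀ → ∃ u : Pt n → ℝ, IsWeakSol n (fun p => 1 + ε * k p) u := by
  have hC : 0 ≤ C := (abs_nonneg _).trans (hkb 0)
  have hb : kinf ≤ b := by
    have hcl : Topology.IsClosedEmbedding (fun σ : ℝ => ((0, 0, σ) : Pt n)) := by
      refine Topology.IsClosedEmbedding.of_continuous_injective_isClosedMap (by fun_prop) (fun x y h => by simpa using h) ?_
      exact (Function.LeftInverse.isClosedEmbedding (f := fun p : Pt n => p.2.2) (g := fun σ : ℝ => ((0, 0, σ) : Pt n)) (fun x => rfl) (by fun_prop) (by fun_prop)).isClosedMap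
    exact le_of_tendsto (hlim.comp hcl.tendsto_cocompact) (Eventually.of_forall hax)
  have hax' : ∀ p : Pt n, rho n p = 0 → k p ≤ b := fun p hp => by
    obtain ⟨Kt, hKt⟩ := hk
    have : k p = k (0, 0, p.2.2) := by
      rw [hKt, hKt (0, 0, p.2.2), znorm_rho, znorm_rho, hp]; simp [rho]
    rw [this]; exact hax _
  have h0 := bubble_int hn hkc hμ h
  obtain ⟨cs, hcs⟩ : ∃ cs : ℂ, cs = ⟨μ^2, s⟩ := ⟨_, rfl⟩
  have hcsp : 0 < cs.re := by rw [hcs]; simp only; positivity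
  rw [← hcs] at h0
  obtain ⟨G, hG⟩ : ∃ G, G = ∫ p : Pt n, (nq n p ^ (2*n+2))⁻¹ * (k (scl n cs p) - b) := ⟨_, rfl⟩
  rw [← hG] at h0
  obtain ⟨T, hT⟩ := escape hn hkc hkb hlim hb hax' (half_pos h0)
  obtain ⟨T', hT'⟩ : ∃ T', T' = max T (Nf cs) := ⟨_, rfl⟩
  have t1 : T ≤ T' := hT' ▸ le_max_left _ _
  have t2 : Nf cs ≤ T' := hT' ▸ le_max_right _ _
  have i0 := inv_pos.2 hcsp
  have a0 := abs_nonneg cs.im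
  unfold Nf at t2
  have tp : 0 < T' := by linarith
  have hint : ∀ c : ℂ, 0 < c.re → ∫ w, kpp hn k c w ∂(nu n) = (∫ p : Pt n, (nq n p ^ (2*n+2))⁻¹ * (k (scl n c p) - b)) + (∫ p : Pt n, (nq n p ^ (2*n+2))⁻¹ * b) := fun c hc => by
    have hsc : Continuous (scl n c) := by unfold scl; fun_prop
    rw [int_nu (kpp_meas hn hkc c).aestronglyMeasurable, ← integral_add _ (integrable_dens.mul_const b)]
    · refine integral_congr_ae (Eventually.of_forall fun p => ?_)
      simp only [smul_eq_mul]; rw [kpp_W hn hk hc]; ring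
    · refine (integrable_dens.mul_const (C + |b|)).mono' (dens_cont.mul ((hkc.comp hsc).sub continuous_const)).aestronglyMeasurable (Eventually.of_forall fun p => ?_)
      rw [norm_mul, Real.norm_of_nonneg (dens_pos p).le]
      exact mul_le_mul_of_nonneg_left ((abs_sub _ _).trans (by linarith [hkb (scl n c p)])) (dens_pos p).le
  obtain ⟨ε₀, he0, he⟩ := exist_abs hn (kpp hn k) (B := C + 1) (by linarith) (fun c _ => (kpp_meas hn hkc c).aestronglyMeasurable)
    (fun c _ => Eventually.of_forall fun w => (hkb _).trans (by linarith)) (fun c γ hc hγ => kpp_inv hn hkc hk c γ hc hγ)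
    (S := Set.Icc T'⁻¹ T' ×ℂ Set.Icc (-T') T') (isCompact_Icc.reProdIm isCompact_Icc) (fun c hc => lt_of_lt_of_le (inv_pos.2 tp) hc.1.1)
    (cs := cs) ⟨⟨inv_le_of_inv_le₀ hcsp (by linarith), by linarith⟩, by linarith [neg_abs_le cs.im], by linarith [le_abs_self cs.im]⟩
    (b := G/2 + (∫ p : Pt n, (nq n p ^ (2*n+2))⁻¹ * b)) (fun c hc hcS => by
      rw [hint c hc]
      refine add_le_add (hT c hc (lt_of_le_of_lt t1 ?_)) le_rfl
      by_contra hcon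
      push Not at hcon
      have i1 := inv_pos.2 hc
      have a1 := abs_nonneg c.im
      unfold Nf at hcon
      exact hcS ⟨⟨inv_le_of_inv_le₀ hc (by linarith), by linarith⟩, by linarith [neg_abs_le c.im], by linarith [le_abs_self c.im]⟩)
    (by rw [hint cs hcsp, ← hG]; linarith)
  refine ⟨min ε₀ (1/(C+1)), by positivity, fun ε hε => ?_⟩
  rw [lt_min_iff, lt_div_iff₀ (by positivity)] at hε
  have h1 : |ε| * C < 1 := by linarith [abs_nonneg ε, hε.2]
  by_cases h0 : ε = 0
  · refine sol_of hn hkb hk h1 (c := 1) (by simp) (h := one n) ?_ ?_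
    · filter_upwards [one_ae (n := n)] with w hw
      rw [hw]; norm_num
    · rw [A_one]
      filter_upwards [one_ae (n := n)] with w hw
      rw [hw, h0]; simp
  · obtain ⟨c, hc, g, g1, g2⟩ := he ε h0 hε.1
    exact sol_of hn hkb hk h1 hc g1 g2

lemma final (n : ℕ) (hn : 1 ≤ n)
    (k : Pt n → ℝ) (kinf : ℝ)
    (hkbd : ∃ C : ℝ, ∀ p : Pt n, |k p| ≤ C)
    (hkcont : Continuous k)
    (hkcyl : CylHolder n k)
    (hklim : Tendsto k (cocompact (Pt n)) (𝓝 kinf))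
    (halt : ∃ μ : ℝ, 0 < μ ∧ ∃ s : ℝ,
        (0 < ∫ p : Pt n,
            (k p - sSup (Set.range fun σ : ℝ => k (0, 0, σ))) * bubble n μ s p ^ Qs n) ∨
        ((∫ p : Pt n,
            (k p - sInf (Set.range fun σ : ℝ => k (0, 0, σ))) * bubble n μ s p ^ Qs n) < 0)) :
    ∃ ε₀ : ℝ, 0 < ε₀ ∧ ∀ ε : ℝ, |ε| < ε₀ →
      ∃ u : Pt n → ℝ, IsWeakSol n (fun p => 1 + ε * k p) u := by
  obtain ⟨C, hC⟩ := hkbd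
  obtain ⟨Kt, hKt, -⟩ := hkcyl
  obtain ⟨μ, hμ, s, h | h⟩ := halt
  · have hI : ∀ σ : ℝ, k (0, 0, σ) ≤ sSup (Set.range fun σ : ℝ => k (0, 0, σ)) := fun σ => by
      refine le_csSup ⟨C, ?_⟩ ⟨σ, rfl⟩
      rintro _ ⟨σ, rfl⟩
      exact (le_abs_self _).trans (hC _)
    exact half hn hkcont hC ⟨Kt, hKt⟩ hklim hI hμ h
  · have hI : ∀ σ : ℝ, sInf (Set.range fun σ : ℝ => k (0, 0, σ)) ≤ k (0, 0, σ) := fun σ => by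
      refine csInf_le ⟨-C, ?_⟩ ⟨σ, rfl⟩
      rintro _ ⟨σ, rfl⟩
      exact (abs_le.1 (hC _)).1
    obtain ⟨ε₀, h0, h1⟩ := half hn (k := fun p => -k p) (b := -sInf (Set.range fun σ : ℝ => k (0, 0, σ))) hkcont.neg
      (fun p => by rw [abs_neg]; exact hC p) ⟨fun a t => -Kt a t, fun p => by rw [hKt]⟩ hklim.neg
      (fun σ => neg_le_neg (hI σ)) hμ (s := s) (by
        rw [← neg_pos, ← integral_neg] at h
        refine h.trans_eq (integral_congr_ae (Eventually.of_forall fun p => ?_))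
        simp only; ring)
    refine ⟨ε₀, h0, fun ε hε => ?_⟩
    obtain ⟨u, hu⟩ := h1 (-ε) (by rwa [abs_neg])
    exact ⟨u, by simpa using hu⟩
end HW

/-- Theorem 1.2, perturbative existence with integral conditions.
If `k` is bounded, continuous, cylindrically symmetric with locally Hölder profile,
with finite limit at infinity, and for some `μ > 0`, `s ∈ ℝ` either
`∫ (k - sup_σ k(0,σ)) U_{μ,s}^{Q*} > 0` or `∫ (k - inf_σ k(0,σ)) U_{μ,s}^{Q*} < 0`,
then `-Δ_{ℍⁿ} u = (1 + εk) u^{Q*-1}` has a positive cylindrically symmetric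
finite-energy weak solution for all `|ε|` small. -/
theorem webster_existence_perturbative_integral (n : ℕ) (hn : 1 ≤ n)
    (k : Pt n → ℝ) (kinf : ℝ)
    (hkbd : ∃ C : ℝ, ∀ p : Pt n, |k p| ≤ C)
    (hkcont : Continuous k)
    (hkcyl : CylHolder n k)
    (hklim : Tendsto k (cocompact (Pt n)) (𝓝 kinf))
    (halt : ∃ μ : ℝ, 0 < μ ∧ ∃ s : ℝ,
        (0 < ∫ p : Pt n,
            (k p - sSup (Set.range fun σ : ℝ => k (0, 0, σ))) * bubble n μ s p ^ Qs n) ∨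
        ((∫ p : Pt n,
            (k p - sInf (Set.range fun σ : ℝ => k (0, 0, σ))) * bubble n μ s p ^ Qs n) < 0)) :
    ∃ ε₀ : ℝ, 0 < ε₀ ∧ ∀ ε : ℝ, |ε| < ε₀ →
      ∃ u : Pt n → ℝ, IsWeakSol n (fun p => 1 + ε * k p) u := by
  exact HW.final n hn k kinf hkbd hkcont hkcyl hklim halt
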